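/- arXiv:2009.07677 — 2 statements merged into one kernel-verified Lean document; each statement's English description precedes it below -/
import Mathlib

section
/- Let Λ = {a_1,…,a_ℓ} be a collection of sequences of positive integers satisfying Condition (**). Let (X,ℬ,μ,T) be an invertible measure preserving system on a standard Borel probability space, P_μ(T) its Pinsker σ-algebra, and μ = ∫ μ_z dμ(z) the disintegration of μ over P_μ(T). Then for any A_0, A_1,…,A_ℓ ∈ ℬ and any ε, δ > 0, there exists a subset F ⊆ ℕ of density 1 such that for every n ∈ F, μ{ z ∈ X : | μ_z( A_0 ∩ ⋂_{i=1}^{ℓ} T^{−a_i(n)}A_i ) − μ_z(A_0) · ∏_{i=1}^{ℓ} μ_z(T^{−a_i(n)}A_i) | < ε } > 1 − δ. -/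
open MeasureTheory Filter Topology Set

/-- Condition (*) for a sequence of integers: for every `L > 0`, the number of pairs
`(m,n) ∈ [1,N]²` with `|a m - a n| ≤ L` is `o(N²)`. -/
def CondStar (a : ℕ → ℕ) : Prop :=
  ∀ L : ℕ, 0 < L →
    Tendsto (fun N : ℕ =>
      ((((Finset.Icc 1 N) ×ˢ (Finset.Icc 1 N)).filter
        (fun p => |(a p.1 : ℤ) - (a p.2 : ℤ)| ≤ (L : ℤ))).card : ℝ) / (N : ℝ) ^ 2)
      atTop (𝓝 0)

/-- Condition (**) for a collection `a 0, …, a (ℓ-1)` of sequences: each sequence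
satisfies Condition (*) and `a (i+1) n - a i n → +∞`. -/
def CondStarStar {ℓ : ℕ} (a : Fin ℓ → ℕ → ℕ) : Prop :=
  (∀ i, CondStar (a i)) ∧
  ∀ (i : ℕ) (h : i + 1 < ℓ),
    Tendsto (fun n => (a ⟨i + 1, h⟩ n : ℤ) - (a ⟨i, Nat.lt_of_succ_lt h⟩ n : ℤ))
      atTop atTop

/-- The measure-theoretic entropy `h_μ(T, {A, Aᶜ})` of the two-set partition `{A, Aᶜ}`:
the limit of `(1/n) H_μ(⋁_{i=0}^{n-1} T^{-i}{A, Aᶜ})`. -/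
noncomputable def partitionEntropy {X : Type*} [MeasurableSpace X]
    (μ : Measure X) (T : X → X) (A : Set X) : ℝ :=
  Filter.atTop.liminf fun n : ℕ =>
    (1 / n : ℝ) * ∑ s : Fin n → Bool,
      Real.negMulLog (μ (⋂ i : Fin n, T^[(i : ℕ)] ⁻¹' (if s i then A else Aᶜ))).toReal

/-- The Pinsker σ-algebra `P_μ(T) = {A ∈ ℬ : h_μ(T, {A, Aᶜ}) = 0}`. -/
def pinsker {X : Type*} [MeasurableSpace X] (μ : Measure X) (T : X → X) :
    MeasurableSpace X :=
  MeasurableSpace.generateFrom {A | MeasurableSet A ∧ partitionEntropy μ T A = 0}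

open scoped Classical in
/-- `F ⊆ ℕ` has density `1`: `#(F ∩ {1,…,n})/n → 1`. -/
def HasDensityOne (F : Set ℕ) : Prop :=
  Tendsto (fun n : ℕ => (((Finset.Icc 1 n).filter (· ∈ F)).card : ℝ) / n) atTop (𝓝 1)

namespace PinskerEntropy

open scoped Classical

/-! ### Entropy of finite families of measurable sets -/

/-- The measurable subsets of `X`, as a type. -/
abbrev MSet (X : Type*) [MeasurableSpace X] := {A : Set X // MeasurableSet A}

section Entropy

variable {X : Type*} [MeasurableSpace X]

/-- The atom containing `x` of the partition generated by the finite family `F`. -/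
def atom (F : Finset (MSet X)) (x : X) : Set X :=
  {y | ∀ A ∈ F, (y ∈ A.1 ↔ x ∈ A.1)}

/-- The Shannon entropy of the partition generated by the finite family `F`. -/
noncomputable def entropy (μ : Measure X) (F : Finset (MSet X)) : ℝ :=
  ∫ x, -Real.log (μ.real (atom F x)) ∂μ

/-- The itinerary of a point with respect to the finite family `F`. -/
noncomputable def code (F : Finset (MSet X)) (x : X) : F → Bool :=
  fun A => decide (x ∈ A.1.1)

lemma measurable_code (F : Finset (MSet X)) : Measurable (code F) := by
  refine measurable_pi_iff.2 fun A => measurable_to_bool ?_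
  convert A.1.2 using 1
  ext x
  simp [code]

lemma code_eq_iff (F : Finset (MSet X)) (x y : X) : code F y = code F x ↔ y ∈ atom F x := by
  simp only [code, atom, funext_iff, Subtype.forall, decide_eq_decide, mem_ofPred_eq]

lemma atom_eq_preimage (F : Finset (MSet X)) (x : X) :
    atom F x = code F ⁻¹' {code F x} := by
  ext y
  simp [code_eq_iff]

lemma measurableSet_atom (F : Finset (MSet X)) (x : X) : MeasurableSet (atom F x) := by
  rw [atom_eq_preimage]
  exact measurable_code F (measurableSet_singleton _)

section Integrals

variable (μ : Measure X) [IsProbabilityMeasure μ]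

/-- For a map to a finite type, almost every fibre has positive measure. -/
lemma ae_fiber_pos {S : Type*} [Finite S] [MeasurableSpace S] [MeasurableSingletonClass S]
    {f : X → S} (hf : Measurable f) : ∀ᵐ x ∂μ, 0 < μ.real (f ⁻¹' {f x}) := by
  have h : ∀ᵐ s ∂(μ.map f), (μ.map f) {s} ≠ 0 := by
    rw [ae_iff]
    have : {s | ¬ (μ.map f) {s} ≠ 0} = ⋃ s ∈ {s | (μ.map f) {s} = 0}, {s} := by
      ext s; simp
    rw [this, measure_biUnion_null_iff (Set.to_countable _)]
    simp
  filter_upwards [ae_of_ae_map hf.aemeasurable h] with x hx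
  rw [Measure.map_apply hf (measurableSet_singleton _)] at hx
  exact ENNReal.toReal_pos hx (measure_ne_top _ _)

lemma integrable_comp_finite {S : Type*} [Finite S] [MeasurableSpace S]
    [MeasurableSingletonClass S] {f : X → S} (hf : Measurable f) (φ : S → ℝ) :
    Integrable (fun x => φ (f x)) μ := by
  have : IsProbabilityMeasure (μ.map f) := Measure.isProbabilityMeasure_map hf.aemeasurable
  exact (Integrable.of_finite (μ := μ.map f) (f := φ)).comp_measurable hf

lemma integral_comp_finite {S : Type*} [Fintype S] [MeasurableSpace S]
    [MeasurableSingletonClass S] {f : X → S} (hf : Measurable f) (φ : S → ℝ) :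
    ∫ x, φ (f x) ∂μ = ∑ s, μ.real (f ⁻¹' {s}) * φ s := by
  have : IsProbabilityMeasure (μ.map f) := Measure.isProbabilityMeasure_map hf.aemeasurable
  have hφ : AEStronglyMeasurable φ (μ.map f) :=
    (Integrable.of_finite (μ := μ.map f) (f := φ)).aestronglyMeasurable
  rw [← integral_map hf.aemeasurable hφ, integral_fintype Integrable.of_finite]
  refine Finset.sum_congr rfl fun s _ => ?_
  rw [map_measureReal_apply hf (measurableSet_singleton _), smul_eq_mul]

end Integrals

/-- The combinatorial core of submodularity of Shannon entropy. -/
lemma sum_mul_log_le {S T U : Type*} [Fintype S] [Fintype T] [Fintype U]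
    (p : S → T → U → ℝ) (hp : ∀ s t u, 0 ≤ p s t u) :
    ∑ s, ∑ t, ∑ u, p s t u * (Real.log (∑ t', p s t' u) + Real.log (∑ s', p s' t u)
      - Real.log (p s t u) - Real.log (∑ s', ∑ t', p s' t' u)) ≤ 0 := by
  set Q : U → ℝ := fun u => ∑ s', ∑ t', p s' t' u with hQ
  have h1 : ∀ s t u, p s t u * (Real.log (∑ t', p s t' u) + Real.log (∑ s', p s' t u)
      - Real.log (p s t u) - Real.log (Q u)) ≤
      (∑ t', p s t' u) * (∑ s', p s' t u) / Q u - p s t u := by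
    intro s t u
    have hA : p s t u ≤ ∑ t', p s t' u :=
      Finset.single_le_sum (f := fun t' => p s t' u) (fun t' _ => hp s t' u) (Finset.mem_univ t)
    have hB : p s t u ≤ ∑ s', p s' t u :=
      Finset.single_le_sum (f := fun s' => p s' t u) (fun s' _ => hp s' t u) (Finset.mem_univ s)
    have hC : (∑ t', p s t' u) ≤ Q u :=
      Finset.single_le_sum (f := fun s' => ∑ t', p s' t' u)
        (fun s' _ => Finset.sum_nonneg fun t' _ => hp s' t' u) (Finset.mem_univ s)
    rcases (hp s t u).eq_or_lt with h0 | h0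
    · rw [← h0] at hA hB ⊢
      simp only [zero_mul, sub_zero]
      exact div_nonneg (mul_nonneg hA hB) (hA.trans hC)
    · have hA' := h0.trans_le hA
      have hB' := h0.trans_le hB
      have hC' := hA'.trans_le hC
      rw [← Real.log_mul hA'.ne' hB'.ne', ← Real.log_div (by positivity) h0.ne',
        ← Real.log_div (by positivity) hC'.ne']
      have := Real.log_le_sub_one_of_pos
        (x := (∑ t', p s t' u) * (∑ s', p s' t u) / p s t u / Q u) (by positivity)
      calc _ ≤ p s t u * ((∑ t', p s t' u) * (∑ s', p s' t u) / p s t u / Q u - 1) := by gcongr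
        _ = _ := by field_simp
  have h2 : ∑ s, ∑ t, ∑ u, ((∑ t', p s t' u) * (∑ s', p s' t u) / Q u - p s t u) = 0 := by
    have e : ∀ f : S → T → U → ℝ, ∑ s, ∑ t, ∑ u, f s t u = ∑ u, ∑ s, ∑ t, f s t u := by
      intro f
      rw [Finset.sum_comm' (s := Finset.univ) (t := fun _ => Finset.univ)
        (t' := Finset.univ) (s' := fun _ => Finset.univ) (by simp)]
      rw [Finset.sum_congr rfl fun t _ => Finset.sum_comm, Finset.sum_comm]
      exact Finset.sum_congr rfl fun u _ => Finset.sum_comm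
    rw [e]
    refine Finset.sum_eq_zero fun u _ => ?_
    simp only [Finset.sum_sub_distrib, ← Finset.sum_div, ← Finset.mul_sum, ← Finset.sum_mul]
    rw [Finset.sum_comm (f := fun t s' => p s' t u)]
    change Q u * Q u / Q u - Q u = 0
    rw [mul_self_div_self, sub_self]
  calc _ ≤ ∑ s, ∑ t, ∑ u, ((∑ t', p s t' u) * (∑ s', p s' t u) / Q u - p s t u) :=
        Finset.sum_le_sum fun s _ => Finset.sum_le_sum fun t _ => Finset.sum_le_sum fun u _ =>
          h1 s t u
    _ = 0 := h2

section Properties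

variable (μ : Measure X) [IsProbabilityMeasure μ]

lemma integrable_log_atom (F : Finset (MSet X)) :
    Integrable (fun x => Real.log (μ.real (atom F x))) μ := by
  simp only [atom_eq_preimage]
  exact integrable_comp_finite μ (measurable_code F) fun c => Real.log (μ.real (code F ⁻¹' {c}))

lemma entropy_nonneg (F : Finset (MSet X)) : 0 ≤ entropy μ F :=
  integral_nonneg fun _ => neg_nonneg.2 (Real.log_nonpos measureReal_nonneg measureReal_le_one)

@[simp] lemma entropy_empty : entropy μ (∅ : Finset (MSet X)) = 0 := by
  simp [entropy, atom]

/-- Entropy decreases under coarsening of partitions. -/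
lemma entropy_le_of_atom_subset {F G : Finset (MSet X)} (h : ∀ x, atom G x ⊆ atom F x) :
    entropy μ F ≤ entropy μ G := by
  refine integral_mono_ae (integrable_log_atom μ F).neg (integrable_log_atom μ G).neg ?_
  filter_upwards [ae_fiber_pos μ (measurable_code G)] with x hx
  rw [← atom_eq_preimage] at hx
  exact neg_le_neg (Real.log_le_log hx (measureReal_mono (h x)))

lemma entropy_mono {F G : Finset (MSet X)} (h : F ⊆ G) : entropy μ F ≤ entropy μ G :=
  entropy_le_of_atom_subset μ fun _ _ hy A hA => hy A (h hA)

lemma atom_union (F G : Finset (MSet X)) (x : X) : atom (F ∪ G) x = atom F x ∩ atom G x := by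
  ext y
  simp only [atom, Finset.mem_union, mem_ofPred_eq, mem_inter_iff]
  exact ⟨fun h => ⟨fun A hA => h A (.inl hA), fun A hA => h A (.inr hA)⟩,
    fun h A hA => hA.elim (h.1 A) (h.2 A)⟩

/-- Submodularity of entropy. -/
lemma entropy_submodular (F G K : Finset (MSet X)) :
    entropy μ (F ∪ G ∪ K) + entropy μ K ≤ entropy μ (F ∪ K) + entropy μ (G ∪ K) := by
  set f : X → (F → Bool) × (G → Bool) × (K → Bool) := fun x => (code F x, code G x, code K x)
    with hf
  have hfm : Measurable f :=
    (measurable_code F).prodMk ((measurable_code G).prodMk (measurable_code K))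
  set p : (F → Bool) → (G → Bool) → (K → Bool) → ℝ := fun s t u => μ.real (f ⁻¹' {(s, t, u)})
    with hp
  have hsum : ∀ {ι : Type _} [Fintype ι] (g : X → ι) (_ : ∀ i, MeasurableSet (g ⁻¹' {i}))
      (B : Set X) (_ : MeasurableSet B), ∑ i, μ.real (g ⁻¹' {i} ∩ B) = μ.real B := by
    intro ι _ g hg B hB
    rw [← measureReal_biUnion_finset]
    · congr 1; ext x; simp
    · intro i _ j _ hij
      exact (Set.disjoint_singleton.2 hij).preimage g |>.mono inter_subset_left inter_subset_left
    · exact fun i _ => (hg i).inter hB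
  have mF := fun s => measurable_code F (measurableSet_singleton s)
  have mG := fun s => measurable_code G (measurableSet_singleton s)
  have mK := fun s => measurable_code K (measurableSet_singleton s)
  have hpe : ∀ s t u, p s t u =
      μ.real (code F ⁻¹' {s} ∩ (code G ⁻¹' {t} ∩ code K ⁻¹' {u})) := by
    intro s t u
    simp only [hp, hf]
    congr 1
    ext x; simp
  have hFK : ∀ s u, ∑ t, p s t u = μ.real (code F ⁻¹' {s} ∩ code K ⁻¹' {u}) := by
    intro s u
    rw [← hsum (code G) mG _ ((mF s).inter (mK u))]
    refine Finset.sum_congr rfl fun t _ => ?_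
    rw [hpe, inter_left_comm]
  have hGK : ∀ t u, ∑ s, p s t u = μ.real (code G ⁻¹' {t} ∩ code K ⁻¹' {u}) := by
    intro t u
    rw [← hsum (code F) mF _ ((mG t).inter (mK u))]
    exact Finset.sum_congr rfl fun s _ => hpe s t u
  have hKK : ∀ u, ∑ s, ∑ t, p s t u = μ.real (code K ⁻¹' {u}) := by
    intro u
    rw [← hsum (code F) mF _ (mK u)]
    exact Finset.sum_congr rfl fun s _ => hFK s u
  have key := sum_mul_log_le p (fun _ _ _ => measureReal_nonneg)
  have e := integral_comp_finite μ hfm fun c =>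
    Real.log (∑ t', p c.1 t' c.2.2) + Real.log (∑ s', p s' c.2.1 c.2.2)
      - Real.log (p c.1 c.2.1 c.2.2) - Real.log (∑ s', ∑ t', p s' t' c.2.2)
  have key' : ∫ x, (Real.log (μ.real (atom (F ∪ K) x)) + Real.log (μ.real (atom (G ∪ K) x))
      - Real.log (μ.real (atom (F ∪ G ∪ K) x)) - Real.log (μ.real (atom K x))) ∂μ ≤ 0 := by
    refine le_of_eq_of_le ?_ (e.trans_le ?_)
    · refine integral_congr_ae (.of_forall fun x => ?_)
      simp only [hKK]
      simp only [hFK, hGK]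
      simp only [hpe, hf]
      simp only [← atom_eq_preimage, atom_union, inter_assoc]
    · simp only [Fintype.sum_prod_type]
      exact key
  rw [integral_sub, integral_sub, integral_add] at key'
  · simp only [entropy, integral_neg]
    linarith
  all_goals first
    | exact integrable_log_atom μ _
    | exact (integrable_log_atom μ _).add (integrable_log_atom μ _)
    | exact ((integrable_log_atom μ _).add (integrable_log_atom μ _)).sub (integrable_log_atom μ _)

lemma entropy_union_le (F G : Finset (MSet X)) :
    entropy μ (F ∪ G) ≤ entropy μ F + entropy μ G := by
  simpa using entropy_submodular μ F G ∅

/-- Conditioning on a larger family decreases conditional entropy. -/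
lemma entropy_union_sub_le {F K L : Finset (MSet X)} (h : K ⊆ L) :
    entropy μ (F ∪ L) - entropy μ L ≤ entropy μ (F ∪ K) - entropy μ K := by
  have := entropy_submodular μ F L K
  rw [Finset.union_assoc, Finset.union_eq_left.2 h] at this
  linarith

lemma entropy_singleton (A : MSet X) :
    entropy μ {A} = Real.negMulLog (μ.real A.1) + Real.negMulLog (μ.real A.1ᶜ) := by
  have h1 : ∀ x ∈ A.1, atom {A} x = A.1 := fun x hx => by
    ext y; simp only [atom, Finset.mem_singleton, forall_eq, mem_ofPred_eq, hx, iff_true]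
  have h2 : ∀ x ∈ A.1ᶜ, atom {A} x = A.1ᶜ := fun x hx => by
    ext y; simp only [atom, Finset.mem_singleton, forall_eq, mem_ofPred_eq,
      (mem_compl_iff _ _).1 hx, iff_false, mem_compl_iff]
  rw [entropy, integral_neg, ← integral_add_compl A.2 (integrable_log_atom μ _),
    setIntegral_congr_fun A.2 (g := fun _ => Real.log (μ.real A.1))
      (fun x hx => by simp only [h1 x hx]),
    setIntegral_congr_fun A.2.compl (g := fun _ => Real.log (μ.real A.1ᶜ))
      (fun x hx => by simp only [h2 x hx])]
  simp only [setIntegral_const, smul_eq_mul, Real.negMulLog]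
  ring

lemma exists_entropy_singleton_le {η : ℝ} (hη : 0 < η) :
    ∃ ρ > 0, ∀ A : MSet X, μ.real A.1 < ρ → entropy μ {A} ≤ η := by
  have hc : Continuous fun t : ℝ => Real.negMulLog t + Real.negMulLog (1 - t) :=
    Real.continuous_negMulLog.add (Real.continuous_negMulLog.comp (by fun_prop))
  have := hc.tendsto 0
  simp only [Real.negMulLog_zero, sub_zero, Real.negMulLog_one, add_zero] at this
  obtain ⟨ρ, hρ, h⟩ := Metric.eventually_nhds_iff.1 (this.eventually_lt_const hη)
  refine ⟨ρ, hρ, fun A hA => ?_⟩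
  rw [entropy_singleton, probReal_compl_eq_one_sub A.2]
  refine (h ?_).le
  rwa [Real.dist_eq, sub_zero, abs_of_nonneg measureReal_nonneg]

end Properties

end Entropy
section Dynamics

variable {X : Type*} [MeasurableSpace X]

/-- The preimage of a measurable set under the `k`-th iterate of `T`. -/
def pull (T : X ≃ᵐ X) (k : ℕ) (A : MSet X) : MSet X :=
  ⟨(⇑T)^[k] ⁻¹' A.1, (T.measurable.iterate k) A.2⟩

/-- The preimage of a finite family under the `k`-th iterate of `T`. -/
noncomputable def shift (T : X ≃ᵐ X) (k : ℕ) (F : Finset (MSet X)) : Finset (MSet X) :=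
  F.image (pull T k)

/-- The union of the first `N` preimages of a finite family. -/
noncomputable def seg (T : X ≃ᵐ X) (F : Finset (MSet X)) (N : ℕ) : Finset (MSet X) :=
  (Finset.range N).biUnion fun k => shift T k F

variable {T : X ≃ᵐ X}

lemma pull_pull (j k : ℕ) (A : MSet X) : pull T j (pull T k A) = pull T (j + k) A := by
  apply Subtype.ext
  simp only [pull, ← preimage_comp, ← Function.iterate_add, add_comm]

lemma mem_shift {k : ℕ} {F : Finset (MSet X)} {B : MSet X} :
    B ∈ shift T k F ↔ ∃ A ∈ F, pull T k A = B := by simp [shift]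

lemma mem_seg {N : ℕ} {F : Finset (MSet X)} {B : MSet X} :
    B ∈ seg T F N ↔ ∃ k < N, ∃ A ∈ F, pull T k A = B := by simp [seg, mem_shift]

lemma mem_shift_seg {j N : ℕ} {F : Finset (MSet X)} {B : MSet X} :
    B ∈ shift T j (seg T F N) ↔ ∃ k < N, ∃ A ∈ F, pull T (j + k) A = B := by
  simp only [mem_shift, mem_seg]
  constructor
  · rintro ⟨_, ⟨k, hk, A, hA, rfl⟩, rfl⟩
    exact ⟨k, hk, A, hA, (pull_pull _ _ _).symm⟩
  · rintro ⟨k, hk, A, hA, rfl⟩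
    exact ⟨_, ⟨k, hk, A, hA, rfl⟩, pull_pull _ _ _⟩

lemma shift_union (k : ℕ) (F G : Finset (MSet X)) :
    shift T k (F ∪ G) = shift T k F ∪ shift T k G := Finset.image_union _ _

lemma shift_mono (k : ℕ) {F G : Finset (MSet X)} (h : F ⊆ G) : shift T k F ⊆ shift T k G :=
  Finset.image_subset_image h

lemma shift_shift (j k : ℕ) (F : Finset (MSet X)) :
    shift T j (shift T k F) = shift T (j + k) F := by
  simp only [shift, Finset.image_image]
  exact Finset.image_congr fun A _ => pull_pull _ _ _

lemma seg_mono {N M : ℕ} (F : Finset (MSet X)) (h : N ≤ M) : seg T F N ⊆ seg T F M :=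
  Finset.biUnion_subset_biUnion_of_subset_left _ (Finset.range_mono h)

lemma seg_add (F : Finset (MSet X)) (N M : ℕ) :
    seg T F (N + M) = seg T F N ∪ shift T N (seg T F M) := by
  ext B
  simp only [Finset.mem_union, mem_seg, mem_shift_seg]
  constructor
  · rintro ⟨k, hk, A, hA, rfl⟩
    rcases lt_or_ge k N with h | h
    · exact .inl ⟨k, h, A, hA, rfl⟩
    · exact .inr ⟨k - N, by omega, A, hA, by rw [Nat.add_sub_cancel' h]⟩
  · rintro (⟨k, hk, A, hA, rfl⟩ | ⟨k, hk, A, hA, rfl⟩)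
    · exact ⟨k, by omega, A, hA, rfl⟩
    · exact ⟨N + k, by omega, A, hA, rfl⟩

lemma seg_shift (j : ℕ) (F : Finset (MSet X)) (N : ℕ) :
    seg T (shift T j F) N = shift T j (seg T F N) := by
  ext B
  rw [mem_seg, mem_shift_seg]
  simp only [mem_shift]
  constructor
  · rintro ⟨k, hk, _, ⟨A, hA, rfl⟩, rfl⟩
    exact ⟨k, hk, A, hA, by rw [pull_pull, add_comm]⟩
  · rintro ⟨k, hk, A, hA, rfl⟩
    exact ⟨k, hk, _, ⟨A, hA, rfl⟩, by rw [pull_pull, add_comm]⟩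

lemma seg_union (F G : Finset (MSet X)) (N : ℕ) :
    seg T (F ∪ G) N = seg T F N ∪ seg T G N := by
  ext B
  simp only [mem_seg, Finset.mem_union]
  constructor
  · rintro ⟨k, hk, A, hA | hA, rfl⟩
    · exact .inl ⟨k, hk, A, hA, rfl⟩
    · exact .inr ⟨k, hk, A, hA, rfl⟩
  · rintro (⟨k, hk, A, hA, rfl⟩ | ⟨k, hk, A, hA, rfl⟩)
    · exact ⟨k, hk, A, .inl hA, rfl⟩
    · exact ⟨k, hk, A, .inr hA, rfl⟩

lemma shift_subset_seg {k N : ℕ} (F : Finset (MSet X)) (h : k < N) :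
    shift T k F ⊆ seg T F N :=
  Finset.subset_biUnion_of_mem (fun k => shift T k F) (Finset.mem_range.2 h)

@[simp] lemma seg_zero (F : Finset (MSet X)) : seg T F 0 = ∅ := by simp [seg]

@[simp] lemma seg_one (F : Finset (MSet X)) : seg T F 1 = F := by
  rw [seg, Finset.range_one, Finset.singleton_biUnion]
  exact Finset.image_id

lemma shift_seg_succ (j : ℕ) (F : Finset (MSet X)) (N : ℕ) :
    shift T j (seg T F (N + 1)) = shift T j F ∪ shift T (j + 1) (seg T F N) := by
  rw [add_comm N 1, seg_add, shift_union, shift_shift]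
  rw [seg_one]

variable {μ : Measure X} [IsProbabilityMeasure μ] (hT : MeasurePreserving T μ μ)
include hT

lemma entropy_shift (k : ℕ) (F : Finset (MSet X)) :
    entropy μ (shift T k F) = entropy μ F := by
  have h : ∀ x, atom (shift T k F) x = (⇑T)^[k] ⁻¹' atom F ((⇑T)^[k] x) := fun x => by
    ext y
    simp only [atom, shift, Finset.forall_mem_image, mem_ofPred_eq]
    rfl
  have hk := hT.iterate k
  simp only [entropy, h, hk.measureReal_preimage (measurableSet_atom _ _).nullMeasurableSet]
  have := integral_map (μ := μ) hk.aemeasurable (f := fun x => -Real.log (μ.real (atom F x)))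
    (by rw [hk.map_eq]; exact (integrable_log_atom μ F).neg.aestronglyMeasurable)
  rw [hk.map_eq] at this
  exact this.symm

lemma subadditive_entropy_seg (F : Finset (MSet X)) :
    Subadditive fun N => entropy μ (seg T F N) := fun N M => by
  simp only [seg_add]
  exact (entropy_union_le μ _ _).trans_eq (by rw [entropy_shift hT])

omit hT in
lemma bddBelow_entropy_seg (F : Finset (MSet X)) :
    BddBelow (range fun N : ℕ => entropy μ (seg T F N) / N) :=
  ⟨0, by rintro _ ⟨N, rfl⟩; exact div_nonneg (entropy_nonneg μ _) (Nat.cast_nonneg _)⟩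

/-- The entropy rate of a finite family. -/
noncomputable def rate (F : Finset (MSet X)) : ℝ := (subadditive_entropy_seg hT F).lim

lemma tendsto_rate (F : Finset (MSet X)) :
    Tendsto (fun N : ℕ => entropy μ (seg T F N) / N) atTop (𝓝 (rate hT F)) :=
  (subadditive_entropy_seg hT F).tendsto_lim (bddBelow_entropy_seg F)

lemma mul_rate_le (F : Finset (MSet X)) (N : ℕ) : N * rate hT F ≤ entropy μ (seg T F N) := by
  rcases eq_or_ne N 0 with rfl | hN
  · simp
  · have := (subadditive_entropy_seg hT F).lim_le_div (bddBelow_entropy_seg F) hN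
    rw [mul_comm]
    exact (le_div_iff₀ (by positivity)).1 this

lemma rate_nonneg (F : Finset (MSet X)) : 0 ≤ rate hT F :=
  ge_of_tendsto' (tendsto_rate hT F) fun _ => div_nonneg (entropy_nonneg μ _) (Nat.cast_nonneg _)

lemma rate_shift (j : ℕ) (F : Finset (MSet X)) : rate hT (shift T j F) = rate hT F := by
  refine tendsto_nhds_unique (tendsto_rate hT _) ?_
  simpa only [seg_shift, entropy_shift hT] using tendsto_rate hT F

lemma rate_union_le (F G : Finset (MSet X)) : rate hT (F ∪ G) ≤ rate hT F + rate hT G := by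
  refine le_of_tendsto_of_tendsto' (tendsto_rate hT _)
    ((tendsto_rate hT F).add (tendsto_rate hT G)) fun N => ?_
  rw [seg_union, ← add_div]
  exact div_le_div_of_nonneg_right (entropy_union_le μ _ _) (Nat.cast_nonneg _)

lemma rate_eq_zero_of_forall {F : Finset (MSet X)} (h : ∀ A ∈ F, rate hT {A} = 0) :
    rate hT F = 0 := by
  induction F using Finset.induction_on with
  | empty =>
    refine tendsto_nhds_unique (tendsto_rate hT _) ?_
    have : ∀ N, seg T (∅ : Finset (MSet X)) N = ∅ := fun N => by ext; simp [mem_seg]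
    simp [this]
  | insert A F _ ih =>
    refine le_antisymm ?_ (rate_nonneg hT _)
    rw [Finset.insert_eq]
    refine (rate_union_le hT _ _).trans_eq ?_
    rw [h A (Finset.mem_insert_self _ _), ih fun B hB => h B (Finset.mem_insert_of_mem hB),
      add_zero]

omit hT in
/-- Passing to averages: an affine bound with sublinear error yields a bound of slopes. -/
lemma le_of_forall_mul_le {a b C : ℝ} {u : ℕ → ℝ} (hu : Tendsto (fun N : ℕ => u N / N) atTop (𝓝 b))
    (h : ∀ N : ℕ, N * a ≤ C + u N) : a ≤ b := by
  have hC : Tendsto (fun N : ℕ => C / N + u N / N) atTop (𝓝 (0 + b)) :=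
    (tendsto_const_div_atTop_nhds_zero_nat C).add hu
  rw [zero_add] at hC
  refine ge_of_tendsto hC ?_
  filter_upwards [eventually_gt_atTop 0] with N hN
  rw [← add_div, le_div_iff₀ (by positivity), mul_comm]
  exact h N

/-- Conditioning on a zero entropy family does not decrease the entropy rate. -/
lemma rate_le_cond_of_rate_eq_zero (F β : Finset (MSet X)) (hβ : rate hT β = 0) (m : ℕ) :
    rate hT F ≤ entropy μ (F ∪ (shift T 1 (seg T F m) ∪ β))
      - entropy μ (shift T 1 (seg T F m) ∪ β) := by
  set c := entropy μ (F ∪ (shift T 1 (seg T F m) ∪ β))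
      - entropy μ (shift T 1 (seg T F m) ∪ β) with hc
  have hbound : ∀ N : ℕ, N * rate hT F ≤
      entropy μ (seg T F m) + (N * c + entropy μ (seg T β N)) := by
    intro N
    have hstep : ∀ j ≤ N, entropy μ (seg T F (N + m) ∪ seg T β N) ≤
        j * c + entropy μ (shift T j (seg T F (N + m - j)) ∪ seg T β N) := by
      intro j
      induction j with
      | zero =>
        intro _
        have : shift T 0 (seg T F (N + m)) = seg T F (N + m) := by
          ext B; simp [mem_shift_seg, mem_seg]
        simp [this]
      | succ j ih =>
        intro hj
        refine (ih (by omega)).trans ?_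
        have e : N + m - j = (N + m - (j + 1)) + 1 := by omega
        have hsub : shift T j (shift T 1 (seg T F m) ∪ β) ⊆
            shift T (j + 1) (seg T F (N + m - (j + 1))) ∪ seg T β N := by
          rw [shift_union, shift_shift]
          exact Finset.union_subset_union (shift_mono _ (seg_mono _ (by omega)))
            (shift_subset_seg _ (by omega))
        have h1 := entropy_union_sub_le μ (F := shift T j F) hsub
        rw [← shift_union, entropy_shift hT, entropy_shift hT] at h1
        rw [e, shift_seg_succ, Finset.union_assoc]
        push_cast
        linarith
    have h0 := hstep N le_rfl
    have h1 := mul_rate_le hT F (N + m)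
    have h2 : entropy μ (seg T F (N + m)) ≤ entropy μ (seg T F (N + m) ∪ seg T β N) :=
      entropy_mono μ Finset.subset_union_left
    have h3 := entropy_union_le μ (shift T N (seg T F (N + m - N))) (seg T β N)
    rw [entropy_shift hT, Nat.add_sub_cancel_left] at h3
    rw [Nat.add_sub_cancel_left] at h0
    have h4 : 0 ≤ m * rate hT F := mul_nonneg (Nat.cast_nonneg _) (rate_nonneg hT F)
    push_cast at h1
    linarith
  refine le_of_forall_mul_le (u := fun N => N * c + entropy μ (seg T β N)) ?_ hbound
  have := (tendsto_rate hT β).const_add c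
  rw [hβ, add_zero] at this
  refine this.congr' ?_
  filter_upwards [eventually_gt_atTop 0] with N hN
  field_simp

/-- The entropy of the two-set partition `{A, Aᶜ}` is the entropy rate of `{A}`. -/
lemma partitionEntropy_eq_rate (A : MSet X) : partitionEntropy μ T A.1 = rate hT {A} := by
  have h : ∀ N : ℕ, ∑ s : Fin N → Bool, Real.negMulLog
      (μ (⋂ i : Fin N, (⇑T)^[(i : ℕ)] ⁻¹' (if s i then A.1 else A.1ᶜ))).toReal =
      entropy μ (seg T {A} N) := by
    intro N
    set f : X → Fin N → Bool := fun x i => decide ((⇑T)^[(i : ℕ)] x ∈ A.1) with hf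
    have hfm : Measurable f := by
      refine measurable_pi_iff.2 fun i => measurable_to_bool ?_
      convert (pull T i A).2 using 1
      ext x
      simp only [f, mem_preimage, mem_singleton_iff, decide_eq_true_eq, pull]
    have h1 : ∀ s : Fin N → Bool,
        (⋂ i : Fin N, (⇑T)^[(i : ℕ)] ⁻¹' (if s i then A.1 else A.1ᶜ)) = f ⁻¹' {s} := by
      intro s
      ext x
      simp only [mem_iInter, mem_preimage, mem_singleton_iff, funext_iff, f]
      refine forall_congr' fun i => ?_
      cases s i <;> simp only [Bool.false_eq_true, if_true, if_false, mem_compl_iff,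
        decide_eq_true_eq, decide_eq_false_iff_not]
    have h2 : ∀ x, atom (seg T {A} N) x = f ⁻¹' {f x} := by
      intro x
      ext y
      simp only [atom, mem_seg, Finset.mem_singleton, exists_eq_left, mem_ofPred_eq,
        mem_preimage, mem_singleton_iff, funext_iff, f, decide_eq_decide]
      exact ⟨fun h i => h _ ⟨i, i.2, rfl⟩, by rintro h _ ⟨k, hk, rfl⟩; exact h ⟨k, hk⟩⟩
    simp only [entropy, h2]
    rw [integral_comp_finite μ hfm fun s => -Real.log (μ.real (f ⁻¹' {s}))]
    refine Finset.sum_congr rfl fun s _ => ?_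
    rw [h1, Real.negMulLog, neg_mul, mul_neg, Measure.real]
  simp only [partitionEntropy, h]
  refine Tendsto.liminf_eq ((tendsto_rate hT {A}).congr fun N => ?_)
  rw [div_eq_mul_one_div, mul_comm]

/-- `Ξ` is determined up to arbitrarily small conditional entropy by finitely many sets of `S`. -/
def Approx (μ : Measure X) (S : Set (Set X)) (Ξ : Finset (MSet X)) : Prop :=
  ∀ η > 0, ∃ F : Finset (MSet X), (∀ A ∈ F, A.1 ∈ S) ∧ entropy μ (Ξ ∪ F) - entropy μ F ≤ η

omit hT in
lemma Approx.union {S : Set (Set X)} {Ξ Ξ' : Finset (MSet X)} (h : Approx μ S Ξ)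
    (h' : Approx μ S Ξ') : Approx μ S (Ξ ∪ Ξ') := by
  intro η hη
  obtain ⟨F, hF, hF'⟩ := h (η / 2) (half_pos hη)
  obtain ⟨G, hG, hG'⟩ := h' (η / 2) (half_pos hη)
  refine ⟨F ∪ G, fun A hA => (Finset.mem_union.1 hA).elim (hF A) (hG A), ?_⟩
  have h1 : entropy μ (Ξ ∪ (Ξ' ∪ (F ∪ G))) - entropy μ (Ξ' ∪ (F ∪ G)) ≤ _ :=
    entropy_union_sub_le μ (Finset.subset_union_left.trans Finset.subset_union_right)
  have h2 : entropy μ (Ξ' ∪ (F ∪ G)) - entropy μ (F ∪ G) ≤ _ :=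
    entropy_union_sub_le μ Finset.subset_union_right
  rw [Finset.union_assoc]
  linarith

omit hT in
lemma approx_of_forall {S : Set (Set X)} {Ξ : Finset (MSet X)}
    (h : ∀ C ∈ Ξ, Approx μ S {C}) : Approx μ S Ξ := by
  induction Ξ using Finset.induction_on with
  | empty => exact fun η hη => ⟨∅, by simp, by simpa using hη.le⟩
  | insert C Ξ _ ih =>
    rw [Finset.insert_eq]
    exact (h C (Finset.mem_insert_self _ _)).union
      (ih fun B hB => h B (Finset.mem_insert_of_mem hB))

omit hT in
lemma approx_of_measurableSet_generateFrom {S : Set (Set X)} (hS : ∀ A ∈ S, MeasurableSet A)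
    {C : MSet X} (hC : MeasurableSet[MeasurableSpace.generateFrom S] C.1) :
    Approx μ S {C} := by
  suffices ∀ s : Set X, MeasurableSet[MeasurableSpace.generateFrom S] s →
      ∃ hs : MeasurableSet s, Approx μ S {⟨s, hs⟩} from (this C.1 hC).2
  intro s hs
  induction s, hs using MeasurableSpace.generateFrom_induction with
  | hC t ht _ =>
    refine ⟨hS t ht, fun η hη => ⟨{⟨t, hS t ht⟩}, by simpa using ht, ?_⟩⟩
    simpa using hη.le
  | empty =>
    refine ⟨MeasurableSet.empty, fun η hη => ⟨∅, by simp, ?_⟩⟩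
    have := entropy_singleton μ (⟨∅, MeasurableSet.empty⟩ : MSet X)
    simp only [compl_empty, measureReal_empty, probReal_univ, Real.negMulLog_zero,
      Real.negMulLog_one, add_zero] at this
    rw [Finset.union_empty, entropy_empty, sub_zero, this]
    exact hη.le
  | compl t _ ih =>
    obtain ⟨ht, h⟩ := ih
    refine ⟨ht.compl, fun η hη => ?_⟩
    obtain ⟨F, hF, hF'⟩ := h η hη
    refine ⟨F, hF, le_trans (sub_le_sub_right (entropy_le_of_atom_subset μ fun x y hy => ?_) _) hF'⟩
    simp only [atom, Finset.mem_union, Finset.mem_singleton, mem_ofPred_eq] at hy ⊢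
    rintro A (rfl | hA)
    · exact not_congr (hy _ (.inl rfl))
    · exact hy A (.inr hA)
  | iUnion f _ ih =>
    choose hf h using ih
    have hU : MeasurableSet (⋃ n, f n) := MeasurableSet.iUnion hf
    refine ⟨hU, fun η hη => ?_⟩
    obtain ⟨ρ, hρ, hρ'⟩ := exists_entropy_singleton_le μ (half_pos hη)
    have hD : ∀ n, MeasurableSet ((⋃ n, f n) \ ⋃ i < n, f i) := fun n =>
      hU.diff (MeasurableSet.biUnion (Set.to_countable _) fun i _ => hf i)
    have hlim : Tendsto (fun n => μ ((⋃ n, f n) \ ⋃ i < n, f i)) atTop (𝓝 0) := by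
      have e : ⋂ n, ((⋃ n, f n) \ ⋃ i < n, f i) = ∅ := by
        ext x
        simp only [mem_iInter, Set.mem_sdiff, mem_iUnion, mem_empty_iff_false, iff_false,
          not_forall]
        by_cases hx : ∃ i, x ∈ f i
        · obtain ⟨i, hi⟩ := hx
          exact ⟨i + 1, fun h => h.2 ⟨i, Nat.lt_succ_self i, hi⟩⟩
        · exact ⟨0, fun h => hx h.1⟩
      have := tendsto_measure_iInter_atTop (μ := μ) (fun n => (hD n).nullMeasurableSet)
        (fun m n hmn => sdiff_subset_sdiff_right
          (biUnion_subset_biUnion_left fun i (hi : i < m) => lt_of_lt_of_le hi hmn))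
        ⟨0, measure_ne_top _ _⟩
      rwa [e, measure_empty] at this
    obtain ⟨n, hn⟩ := (((ENNReal.tendsto_toReal ENNReal.zero_ne_top).comp hlim).eventually_lt_const
      (u := ρ) (by simpa using hρ)).exists
    have hent := hρ' ⟨_, hD n⟩ hn
    obtain ⟨F, hF, hF'⟩ := approx_of_forall (μ := μ) (S := S)
      (Ξ := (Finset.range n).image fun i => ⟨f i, hf i⟩)
      (by simp only [Finset.forall_mem_image]; exact fun i _ => h i) (η / 2) (half_pos hη)
    refine ⟨F, hF, ?_⟩
    have h1 : entropy μ ({⟨_, hU⟩} ∪ F) ≤ entropy μ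
        ({⟨_, hD n⟩} ∪ ((Finset.range n).image (fun i => (⟨f i, hf i⟩ : MSet X)) ∪ F)) := by
      refine entropy_le_of_atom_subset μ fun x y hy => ?_
      have hyD := hy ⟨_, hD n⟩ (by simp)
      have hyf : ∀ i < n, (y ∈ f i ↔ x ∈ f i) := fun i hi => hy ⟨f i, hf i⟩
        (Finset.mem_union_right _ (Finset.mem_union_left _
          (Finset.mem_image_of_mem _ (Finset.mem_range.2 hi))))
      have hsplit : ∀ z, z ∈ (⋃ n, f n) ↔
          (z ∈ (⋃ n, f n) \ ⋃ i < n, f i) ∨ ∃ i < n, z ∈ f i := by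
        intro z
        simp only [Set.mem_sdiff, mem_iUnion, exists_prop]
        constructor
        · intro hz
          by_cases h : ∃ i < n, z ∈ f i
          · exact .inr h
          · exact .inl ⟨hz, h⟩
        · rintro (h | ⟨i, _, hi⟩)
          · exact h.1
          · exact ⟨i, hi⟩
      intro A hA
      rcases Finset.mem_union.1 hA with hA | hA
      · rw [Finset.mem_singleton.1 hA]
        change y ∈ (⋃ n, f n) ↔ x ∈ (⋃ n, f n)
        rw [hsplit, hsplit]
        exact or_congr hyD (exists_congr fun i => and_congr_right fun hi => hyf i hi)
      · exact hy A (Finset.mem_union_right _ (Finset.mem_union_right _ hA))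
    have h2 := entropy_union_le μ {⟨_, hD n⟩}
      ((Finset.range n).image (fun i => (⟨f i, hf i⟩ : MSet X)) ∪ F)
    linarith

/-- Generators of the join of the Pinsker algebra with the future `≥ n` of the family `F`. -/
def tailGens (μ : Measure X) (T : X ≃ᵐ X) (F : Finset (MSet X)) (n : ℕ) : Set (Set X) :=
  {A | MeasurableSet A ∧ partitionEntropy μ T A = 0} ∪
    {B | ∃ k, n ≤ k ∧ ∃ A ∈ F, (pull T k A).1 = B}

/-- The join of the Pinsker algebra with the future `≥ n` of the family `F`. -/
abbrev tailAlg (μ : Measure X) (T : X ≃ᵐ X) (F : Finset (MSet X)) (n : ℕ) : MeasurableSpace X :=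
  MeasurableSpace.generateFrom (tailGens μ T F n)

omit [IsProbabilityMeasure μ] hT in
lemma measurableSet_of_mem_tailGens {F : Finset (MSet X)} {n : ℕ} :
    ∀ A ∈ tailGens μ T F n, MeasurableSet A := by
  rintro A (hA | ⟨k, -, A, -, rfl⟩)
  · exact hA.1
  · exact (pull T k A).2

lemma partitionEntropy_preimage {A : Set X} (hA : MeasurableSet A) (j : ℕ) :
    partitionEntropy μ T ((⇑T)^[j] ⁻¹' A) = partitionEntropy μ T A := by
  have h1 := partitionEntropy_eq_rate hT ⟨A, hA⟩
  have h2 := partitionEntropy_eq_rate hT (pull T j ⟨A, hA⟩)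
  have h3 : shift T j {⟨A, hA⟩} = {pull T j ⟨A, hA⟩} := Finset.image_singleton _ _
  rw [← h3, rate_shift, ← h1] at h2
  exact h2

lemma measurableSet_tailAlg_pull {F : Finset (MSet X)} {n : ℕ} {C : MSet X}
    (hC : MeasurableSet[tailAlg μ T F n] C.1) (j : ℕ) :
    MeasurableSet[tailAlg μ T F n] (pull T j C).1 := by
  have : Measurable[tailAlg μ T F n, tailAlg μ T F n] (⇑T)^[j] := by
    refine @measurable_generateFrom _ _ (tailAlg μ T F n) _ _ ?_
    rintro A (hA | ⟨k, hk, A, hA, rfl⟩)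
    · refine MeasurableSpace.measurableSet_generateFrom (.inl ⟨(T.measurable.iterate j) hA.1, ?_⟩)
      rw [partitionEntropy_preimage hT hA.1, hA.2]
    · refine MeasurableSpace.measurableSet_generateFrom (.inr ⟨j + k, by omega, A, hA, ?_⟩)
      rw [← pull_pull]
      rfl
  exact this hC

lemma exists_subset_of_subset_tailGens {F G : Finset (MSet X)} {n : ℕ}
    (hG : ∀ A ∈ G, A.1 ∈ tailGens μ T F n) (m₀ : ℕ) :
    ∃ m ≥ m₀, ∃ β : Finset (MSet X), rate hT β = 0 ∧ G ⊆ shift T n (seg T F m) ∪ β := by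
  suffices ∃ m ≥ m₀, ∃ β : Finset (MSet X), (∀ A ∈ β, rate hT {A} = 0) ∧
      G ⊆ shift T n (seg T F m) ∪ β by
    obtain ⟨m, hm, β, hβ, h⟩ := this
    exact ⟨m, hm, β, rate_eq_zero_of_forall hT hβ, h⟩
  induction G using Finset.induction_on with
  | empty => exact ⟨m₀, le_rfl, ∅, by simp, by simp⟩
  | insert B G _ ih =>
    obtain ⟨m, hm, β, hβ, h⟩ := ih fun A hA => hG A (Finset.mem_insert_of_mem hA)
    rcases hG B (Finset.mem_insert_self _ _) with hB | ⟨k, hk, A, hA, hAB⟩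
    · refine ⟨m, hm, insert B β, ?_, ?_⟩
      · intro A hA
        rcases Finset.mem_insert.1 hA with rfl | hA
        · rw [← partitionEntropy_eq_rate hT, hB.2]
        · exact hβ A hA
      · rw [Finset.union_insert]
        exact Finset.insert_subset_insert _ h
    · refine ⟨max m (k - n + 1), hm.trans (le_max_left _ _), β, hβ, ?_⟩
      refine Finset.insert_subset (Finset.mem_union_left _ ?_)
        (h.trans (Finset.union_subset_union_left (shift_mono _ (seg_mono _ (le_max_left _ _)))))
      rw [mem_shift_seg]
      refine ⟨k - n, lt_of_lt_of_le (Nat.lt_succ_self _) (le_max_right _ _), A, hA, ?_⟩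
      rw [Nat.add_sub_cancel' hk]
      exact Subtype.ext hAB

lemma rate_le_cond_of_tail {F Ξ : Finset (MSet X)} (j M : ℕ)
    (hΞ : ∀ C ∈ Ξ, MeasurableSet[tailAlg μ T F (j + 1)] C.1) :
    rate hT F ≤ entropy μ (shift T j F ∪ (shift T (j + 1) (seg T F M) ∪ Ξ))
      - entropy μ (shift T (j + 1) (seg T F M) ∪ Ξ) := by
  refine le_of_forall_pos_le_add fun η hη => ?_
  obtain ⟨G, hG, hG'⟩ := approx_of_forall (μ := μ) (S := tailGens μ T F (j + 1)) (Ξ := Ξ)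
    (fun C hC => approx_of_measurableSet_generateFrom measurableSet_of_mem_tailGens (hΞ C hC)) η hη
  obtain ⟨m, hm, β, hβ, hsub⟩ := exists_subset_of_subset_tailGens hT hG M
  set K := shift T (j + 1) (seg T F m) ∪ β with hK
  have h1 := rate_le_cond_of_rate_eq_zero hT (shift T j F) β hβ m
  rw [rate_shift, seg_shift, shift_shift, add_comm 1 j, ← hK] at h1
  have h2 : entropy μ (shift T j F ∪ (K ∪ Ξ)) - entropy μ (K ∪ Ξ) ≤ _ :=
    entropy_union_sub_le μ (K := shift T (j + 1) (seg T F M) ∪ Ξ)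
      (Finset.union_subset_union_left
        ((shift_mono _ (seg_mono _ hm)).trans Finset.subset_union_left))
  have h3 : entropy μ (Ξ ∪ K) - entropy μ K ≤ _ := entropy_union_sub_le μ hsub
  rw [Finset.union_comm Ξ K] at h3
  have h4 : entropy μ (shift T j F ∪ K) ≤ entropy μ (shift T j F ∪ (K ∪ Ξ)) :=
    entropy_mono μ (Finset.union_subset_union_right Finset.subset_union_left)
  linarith

/-- Sets in the tail of `F` joined with the Pinsker algebra have zero entropy. -/
theorem rate_eq_zero_of_tail {F : Finset (MSet X)} {C : MSet X}
    (hC : ∀ n, MeasurableSet[tailAlg μ T F n] C.1) : rate hT {C} = 0 := by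
  refine le_antisymm (le_of_forall_pos_le_add fun η hη => ?_) (rate_nonneg hT _)
  rw [zero_add]
  have hlower : ∀ N : ℕ, N * rate hT F + entropy μ (seg T {C} N) ≤
      entropy μ (seg T F N ∪ seg T {C} N) := by
    intro N
    have hstep : ∀ j ≤ N, j * rate hT F +
        entropy μ (shift T j (seg T F (N - j)) ∪ seg T {C} N) ≤
          entropy μ (seg T F N ∪ seg T {C} N) := by
      intro j
      induction j with
      | zero =>
        intro _
        have : shift T 0 (seg T F N) = seg T F N := by
          ext B; rw [mem_shift_seg, mem_seg]; simp only [zero_add]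
        simp [this]
      | succ j ih =>
        intro hj
        refine le_trans ?_ (ih (by omega))
        have h1 := rate_le_cond_of_tail hT (F := F) (Ξ := seg T {C} N) j (N - (j + 1)) (by
          intro B hB
          obtain ⟨k, -, A, hA, rfl⟩ := mem_seg.1 hB
          rw [Finset.mem_singleton.1 hA]
          exact measurableSet_tailAlg_pull hT (hC _) k)
        rw [show N - j = N - (j + 1) + 1 by omega, shift_seg_succ, Finset.union_assoc]
        push_cast
        linarith
    have := hstep N le_rfl
    have h' : entropy μ (seg T {C} N) ≤
      entropy μ (shift T N (seg T F (N - N)) ∪ seg T {C} N) :=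
      entropy_mono μ Finset.subset_union_right
    linarith
  obtain ⟨G, hG, hG'⟩ :=
    approx_of_measurableSet_generateFrom (μ := μ) measurableSet_of_mem_tailGens (hC 0) η hη
  obtain ⟨m, -, β, hβ, hsub⟩ := exists_subset_of_subset_tailGens hT hG 0
  have hcond : entropy μ ({C} ∪ (seg T F m ∪ β)) - entropy μ (seg T F m ∪ β) ≤ η := by
    refine (entropy_union_sub_le μ (hsub.trans ?_)).trans hG'
    refine Finset.union_subset_union_left fun B hB => ?_
    rw [mem_shift_seg] at hB
    simpa only [mem_seg, zero_add] using hB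
  have hupper : ∀ N : ℕ, entropy μ (seg T F N ∪ seg T {C} N) ≤
      N * η + entropy μ (seg T F N) + entropy μ (seg T F m) + entropy μ (seg T β N) := by
    intro N
    have hstep : ∀ j ≤ N, entropy μ (seg T {C} j ∪ (seg T F (N + m) ∪ seg T β N)) ≤
        j * η + entropy μ (seg T F (N + m) ∪ seg T β N) := by
      intro j
      induction j with
      | zero => simp
      | succ j ih =>
        intro hj
        have h1 := ih (by omega)
        have hs : shift T j (seg T F m ∪ β) ⊆
            seg T {C} j ∪ (seg T F (N + m) ∪ seg T β N) := by
          rw [shift_union]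
          refine (Finset.union_subset_union ?_ (shift_subset_seg _ (by omega))).trans
            Finset.subset_union_right
          refine (Finset.subset_union_right (s₁ := seg T F j)).trans ?_
          rw [← seg_add]
          exact seg_mono _ (by omega)
        have h2 := entropy_union_sub_le μ (F := shift T j {C}) hs
        rw [← shift_union, entropy_shift hT, entropy_shift hT] at h2
        rw [seg_add, seg_one, Finset.union_comm (seg T {C} j), Finset.union_assoc]
        push_cast
        linarith
    have h1 : entropy μ (seg T F N ∪ seg T {C} N) ≤
        entropy μ (seg T {C} N ∪ (seg T F (N + m) ∪ seg T β N)) := by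
      rw [Finset.union_comm]
      exact entropy_mono μ (Finset.union_subset_union_right
        ((seg_mono _ (by omega)).trans Finset.subset_union_left))
    have h2 := hstep N le_rfl
    have h3 := entropy_union_le μ (seg T F (N + m)) (seg T β N)
    have h4 := subadditive_entropy_seg hT F N m
    simp only at h4
    linarith
  have hfin : rate hT F + rate hT {C} - η ≤ rate hT F + 0 := by
    refine le_of_forall_mul_le (u := fun N => entropy μ (seg T F N) + entropy μ (seg T β N))
      (C := entropy μ (seg T F m)) ?_ fun N => ?_
    · simp only [add_div]
      have := (tendsto_rate hT F).add (tendsto_rate hT β)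
      rwa [hβ] at this
    · have h1 := hlower N
      have h2 := hupper N
      have h3 := mul_rate_le hT {C} N
      linarith
  linarith

lemma measurableSet_pinsker_of_tail {F : Finset (MSet X)} {C : Set X}
    (hC : ∀ n, MeasurableSet[tailAlg μ T F n] C) : MeasurableSet[pinsker μ T] C := by
  have hm : MeasurableSet C :=
    MeasurableSpace.generateFrom_le measurableSet_of_mem_tailGens C (hC 0)
  refine MeasurableSpace.measurableSet_generateFrom ⟨hm, ?_⟩
  rw [partitionEntropy_eq_rate hT ⟨C, hm⟩]
  exact rate_eq_zero_of_tail hT hC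

end Dynamics

section ReverseMartingale

/-- Orthogonal projections onto a decreasing sequence of closed subspaces converge strongly to the
projection onto the intersection. -/
lemma starProjection_tendsto_iInf {E : Type*} [NormedAddCommGroup E] [InnerProductSpace ℝ E]
    [CompleteSpace E] (K : ℕ → Submodule ℝ E) [∀ n, (K n).HasOrthogonalProjection]
    (L : Submodule ℝ E) [L.HasOrthogonalProjection] (hK : Antitone K) (hL : ⨅ n, K n = L) (x : E) :
    Tendsto (fun n => (K n).starProjection x) atTop (𝓝 (L.starProjection x)) := by
  have hmono : Monotone fun n => (K n)ᗮ := fun m n h => Submodule.orthogonal_le (hK h)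
  have hcl : (⨆ n, (K n)ᗮ).topologicalClosure = Lᗮ := by
    rw [← Submodule.orthogonal_orthogonal_eq_closure, ← Submodule.iInf_orthogonal, ← hL]
    simp only [Submodule.orthogonal_orthogonal]
  have h := Submodule.starProjection_tendsto_closure_iSup (fun n => (K n)ᗮ) hmono x
  simp only [hcl, Submodule.starProjection_orthogonal'] at h
  simpa using h.const_sub x

variable {X : Type*} {m : MeasurableSpace X} [mX : MeasurableSpace X] {μ : Measure X}

lemma aestronglyMeasurable_of_antitone {G : ℕ → MeasurableSpace X}
    (hG : Antitone G) (hm : ∀ C : Set X, (∀ n, MeasurableSet[G n] C) → MeasurableSet[m] C)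
    {g : X → ℝ} (hg : ∀ n, AEStronglyMeasurable[G n] g μ) : AEStronglyMeasurable[m] g μ := by
  set h : ℕ → X → ℝ := fun n => (hg n).mk g with hh
  have hhm : ∀ n, Measurable[G n] (h n) := fun n => (hg n).stronglyMeasurable_mk.measurable
  have hlim : ∀ k, Measurable[G k] fun x => limsup (fun n => h n x) atTop := by
    intro k
    have h1 : (fun x => limsup (fun n => h n x) atTop) =
        fun x => limsup (fun n => h (n + k) x) atTop :=
      funext fun x => (limsup_nat_add (fun n => h n x) k).symm
    rw [h1]
    exact Measurable.limsup
      fun n => (hhm (n + k)).mono (hG (Nat.le_add_left k n)) le_rfl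
  refine ⟨fun x => limsup (fun n => h n x) atTop, ?_, ?_⟩
  · refine Measurable.stronglyMeasurable ?_
    exact fun s hs => hm _ fun n => hlim n hs
  · have : ∀ᵐ x ∂μ, ∀ n, g x = h n x := ae_all_iff.2 fun n => (hg n).ae_eq_mk
    filter_upwards [this] with x hx
    simp only [← hx, limsup_const]

/-- Reverse martingale convergence in `L¹` for square-integrable functions. -/
lemma tendsto_integral_abs_condExp_sub [IsProbabilityMeasure μ]
    {G : ℕ → MeasurableSpace X} (hG : Antitone G) (hGX : ∀ n, G n ≤ mX) (hmG : ∀ n, m ≤ G n)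
    (hm : ∀ C : Set X, (∀ n, MeasurableSet[G n] C) → MeasurableSet[m] C)
    {f : X → ℝ} (hf : MemLp f 2 μ) :
    Tendsto (fun n => ∫ x, |(μ[f | G n]) x - (μ[f | m]) x| ∂μ) atTop (𝓝 0) := by
  have hmX : m ≤ mX := (hmG 0).trans (hGX 0)
  have : ∀ n, Fact (G n ≤ mX) := fun n => ⟨hGX n⟩
  have : Fact (m ≤ mX) := ⟨hmX⟩
  have hK : Antitone fun n => lpMeas ℝ ℝ (G n) 2 μ := fun k n hkn f hf => by
    rw [mem_lpMeas_iff_aestronglyMeasurable] at hf ⊢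
    exact hf.mono (hG hkn)
  have hL : ⨅ n, lpMeas ℝ ℝ (G n) 2 μ = lpMeas ℝ ℝ m 2 μ := by
    ext g
    simp only [Submodule.mem_iInf, mem_lpMeas_iff_aestronglyMeasurable]
    exact ⟨aestronglyMeasurable_of_antitone hG hm, fun h n => h.mono (hmG n)⟩
  have h := starProjection_tendsto_iInf (fun n => lpMeas ℝ ℝ (G n) 2 μ) _ hK hL hf.toLp
  have hnorm := (tendsto_iff_norm_sub_tendsto_zero.1 h)
  refine squeeze_zero (fun n => integral_nonneg fun x => abs_nonneg _) (fun n => ?_) hnorm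
  set u := (lpMeas ℝ ℝ (G n) 2 μ).starProjection hf.toLp with hu
  set v := (lpMeas ℝ ℝ m 2 μ).starProjection hf.toLp with hv
  have hu' : u =ᵐ[μ] μ[f | G n] := hf.condExpL2_ae_eq_condExp (𝕜 := ℝ) (hGX n)
  have hv' : v =ᵐ[μ] μ[f | m] := hf.condExpL2_ae_eq_condExp (𝕜 := ℝ) hmX
  have h1 : ∫ x, |(μ[f | G n]) x - (μ[f | m]) x| ∂μ = ∫ x, ‖(u - v : Lp ℝ 2 μ) x‖ ∂μ := by
    refine integral_congr_ae ?_
    filter_upwards [hu', hv', Lp.coeFn_sub u v] with x h1 h2 h3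
    rw [h3, Pi.sub_apply, h1, h2, Real.norm_eq_abs]
  rw [h1, Lp.norm_def, integral_norm_eq_lintegral_enorm (Lp.aestronglyMeasurable _),
    ← eLpNorm_one_eq_lintegral_enorm]
  refine ENNReal.toReal_mono (Lp.eLpNorm_ne_top _) ?_
  exact eLpNorm_le_eLpNorm_of_exponent_le one_le_two (Lp.aestronglyMeasurable _)

end ReverseMartingale

section Decoupling

variable {X : Type*} {m m' : MeasurableSpace X} [mX : MeasurableSpace X] {μ : Measure X}
  [IsProbabilityMeasure μ]

/-- If `B` belongs to an intermediate σ-algebra `m'`, the failure of `A` and `B` to be conditionally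
independent given `m` is controlled by the distance between the conditional expectations of `A`. -/
lemma integral_abs_condExp_inter_sub_le (hm : m ≤ m') (hm' : m' ≤ mX) {A B : Set X}
    (hA : MeasurableSet A) (hB : MeasurableSet[m'] B) :
    ∫ x, |(μ[(A ∩ B).indicator (fun _ => (1 : ℝ)) | m]) x -
        (μ[A.indicator (fun _ => (1 : ℝ)) | m]) x * (μ[B.indicator (fun _ => (1 : ℝ)) | m]) x| ∂μ ≤
      ∫ x, |(μ[A.indicator (fun _ => (1 : ℝ)) | m']) x -
        (μ[A.indicator (fun _ => (1 : ℝ)) | m]) x| ∂μ := by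
  set a : X → ℝ := A.indicator fun _ => (1 : ℝ) with ha
  set b : X → ℝ := B.indicator fun _ => (1 : ℝ) with hb
  have hai : Integrable a μ := (integrable_const 1).indicator hA
  have hbi : Integrable b μ := (integrable_const 1).indicator (hm' _ hB)
  have hab : (A ∩ B).indicator (fun _ => (1 : ℝ)) = B.indicator a := by
    rw [ha, indicator_indicator, inter_comm]
  have hmul : ∀ u : X → ℝ, B.indicator u = u * b := fun u => by
    funext x
    by_cases hx : x ∈ B <;> simp [hb, hx]
  set g := μ[a | m'] with hg
  set p := μ[a | m] with hp
  have hpi : Integrable p μ := integrable_condExp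
  have hgi : Integrable g μ := integrable_condExp
  have hpb : Integrable (p * b) μ := by
    rw [← hmul]
    exact hpi.indicator (hm' _ hB)
  have hgb : Integrable (g * b) μ := by
    rw [← hmul]
    exact hgi.indicator (hm' _ hB)
  have h1 : μ[(A ∩ B).indicator (fun _ => (1 : ℝ)) | m] =ᵐ[μ] μ[g * b | m] := by
    rw [hab]
    have h := condExp_indicator hai hB
    rw [hmul (μ[a | m'])] at h
    exact (condExp_condExp_of_le hm hm').symm.trans (condExp_congr_ae h)
  have h2 : μ[p * b | m] =ᵐ[μ] p * μ[b | m] :=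
    condExp_mul_of_stronglyMeasurable_left stronglyMeasurable_condExp hpb hbi
  have h3 : μ[g * b - p * b | m] =ᵐ[μ] μ[g * b | m] - μ[p * b | m] := condExp_sub hgb hpb m
  calc _ = ∫ x, |(μ[g * b - p * b | m]) x| ∂μ := by
        refine integral_congr_ae ?_
        filter_upwards [h1, h2, h3] with x h1 h2 h3
        rw [h3, Pi.sub_apply, h2, h1, Pi.mul_apply]
    _ ≤ ∫ x, |(g * b - p * b) x| ∂μ := integral_abs_condExp_le _
    _ ≤ _ := by
        refine integral_mono (hgb.sub hpb).abs (hgi.sub hpi).abs fun x => ?_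
        by_cases hx : x ∈ B <;> simp [hb, hx]

/-- Conditional expectation commutes with a measure preserving map which preserves the conditioning
σ-algebra in both directions. -/
lemma condExp_comp_of_measurePreserving (hm : m ≤ mX) {S : X → X} (hS : MeasurePreserving S μ μ)
    (hSm : Measurable[m, m] S)
    (hSm' : ∀ C : Set X, MeasurableSet[m] C → ∃ D, MeasurableSet[m] D ∧ S ⁻¹' D = C)
    {f : X → ℝ} (hf : Integrable f μ) : (μ[f | m]) ∘ S =ᵐ[μ] μ[f ∘ S | m] := by
  refine ae_eq_condExp_of_forall_setIntegral_eq hm (hS.integrable_comp_of_integrable hf)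
    (fun s _ _ => (hS.integrable_comp_of_integrable integrable_condExp).integrableOn)
    (fun s hs _ => ?_) (stronglyMeasurable_condExp.comp_measurable hSm).aestronglyMeasurable
  obtain ⟨D, hD, rfl⟩ := hSm' s hs
  have h : ∀ u : X → ℝ, Integrable u μ → ∫ x in S ⁻¹' D, (u ∘ S) x ∂μ = ∫ x in D, u x ∂μ := by
    intro u hu
    conv_rhs => rw [← hS.map_eq]
    rw [setIntegral_map (hm _ hD) (by rw [hS.map_eq]; exact hu.1) hS.measurable.aemeasurable]
    rfl
  rw [h _ integrable_condExp, h _ hf, setIntegral_condExp hm hf hD]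

end Decoupling

section Pinsker

variable {X : Type*} [MeasurableSpace X] {T : X ≃ᵐ X} {μ : Measure X} [IsProbabilityMeasure μ]

omit [IsProbabilityMeasure μ] in
lemma tailAlg_le (F : Finset (MSet X)) (n : ℕ) : tailAlg μ T F n ≤ ‹MeasurableSpace X› :=
  MeasurableSpace.generateFrom_le measurableSet_of_mem_tailGens

omit [IsProbabilityMeasure μ] in
lemma pinsker_le_tailAlg (F : Finset (MSet X)) (n : ℕ) : pinsker μ T ≤ tailAlg μ T F n :=
  MeasurableSpace.generateFrom_mono subset_union_left

omit [IsProbabilityMeasure μ] in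
lemma antitone_tailAlg (F : Finset (MSet X)) : Antitone (tailAlg μ T F) := fun _ _ hkn =>
  MeasurableSpace.generateFrom_mono (union_subset_union_right _
    fun _ ⟨j, hj, h⟩ => ⟨j, hkn.trans hj, h⟩)

lemma measurable_iterate_pinsker (hT : MeasurePreserving T μ μ) (k : ℕ) :
    Measurable[pinsker μ T, pinsker μ T] (⇑T)^[k] := by
  refine @measurable_generateFrom _ _ (pinsker μ T) _ _ ?_
  rintro A hA
  refine MeasurableSpace.measurableSet_generateFrom ⟨(T.measurable.iterate k) hA.1, ?_⟩
  rw [partitionEntropy_preimage hT hA.1, hA.2]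

lemma exists_preimage_iterate_pinsker (hT : MeasurePreserving T μ μ) (k : ℕ) (C : Set X)
    (hC : MeasurableSet[pinsker μ T] C) :
    ∃ D, MeasurableSet[pinsker μ T] D ∧ (⇑T)^[k] ⁻¹' D = C := by
  have h : Measurable[pinsker μ T, pinsker μ T] T.symm := by
    refine @measurable_generateFrom _ _ (pinsker μ T) _ _ ?_
    rintro A hA
    have hA' := T.symm.measurable hA.1
    refine MeasurableSpace.measurableSet_generateFrom ⟨hA', ?_⟩
    rw [← partitionEntropy_preimage hT hA' 1, Function.iterate_one, ← preimage_comp,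
      T.symm_comp_self, preimage_id, hA.2]
  refine ⟨(⇑T.symm)^[k] ⁻¹' C, ?_, ?_⟩
  · exact @Measurable.iterate _ (pinsker μ T) _ h k _ hC
  · rw [← preimage_comp]
    ext x
    have hx : (⇑T.symm)^[k] ((⇑T)^[k] x) = x := T.left_inv.iterate k x
    rw [mem_preimage, Function.comp_apply, hx]

/-- The future of `F` becomes conditionally independent of each measurable set given the Pinsker
algebra. -/
lemma tendsto_integral_abs_condExp_tailAlg_sub (hT : MeasurePreserving T μ μ)
    (F : Finset (MSet X)) {A : Set X} (hA : MeasurableSet A) :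
    Tendsto (fun n => ∫ x, |(μ[A.indicator (fun _ => (1 : ℝ)) | tailAlg μ T F n]) x -
      (μ[A.indicator (fun _ => (1 : ℝ)) | pinsker μ T]) x| ∂μ) atTop (𝓝 0) :=
  tendsto_integral_abs_condExp_sub (antitone_tailAlg F) (tailAlg_le F) (pinsker_le_tailAlg F)
    (fun _ hC => measurableSet_pinsker_of_tail hT hC)
    ((memLp_const (1 : ℝ)).indicator hA)

variable {μd : X → Measure X} [hprob : ∀ z, IsProbabilityMeasure (μd z)]

lemma integrable_real (hmeas : Measurable μd) {A : Set X}
    (hA : MeasurableSet A) : Integrable (fun z => (μd z).real A) μ :=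
  Integrable.of_bound (((Measure.measurable_coe hA).comp hmeas).ennreal_toReal.aestronglyMeasurable)
    1 (ae_of_all _ fun z => by
      rw [Real.norm_eq_abs, abs_of_nonneg measureReal_nonneg]; exact measureReal_le_one)

variable (hdis : ∀ f : X → ℝ, Integrable f μ → μ[f | pinsker μ ⇑T] =ᵐ[μ] fun z => ∫ y, f y ∂(μd z))

include hdis

omit hprob in
lemma condExp_indicator_ae_eq_real {A : Set X} (hA : MeasurableSet A) :
    μ[A.indicator (fun _ => (1 : ℝ)) | pinsker μ T] =ᵐ[μ] fun z => (μd z).real A := by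
  refine (hdis _ ((integrable_const 1).indicator hA)).trans (ae_of_all _ fun z => ?_)
  simp only
  rw [integral_indicator_const _ hA, smul_eq_mul, mul_one]

omit hprob in
lemma real_iterate_preimage_ae_eq (hT : MeasurePreserving T μ μ) (k : ℕ) {A : Set X}
    (hA : MeasurableSet A) :
    (fun z => (μd z).real ((⇑T)^[k] ⁻¹' A)) =ᵐ[μ] fun z => (μd ((⇑T)^[k] z)).real A := by
  have hTk := hT.iterate k
  have h1 := condExp_indicator_ae_eq_real hdis (hTk.measurable hA)
  have h2 := hTk.quasiMeasurePreserving.ae_eq_comp (condExp_indicator_ae_eq_real hdis hA)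
  have h3 := condExp_comp_of_measurePreserving ((pinsker_le_tailAlg ∅ 0).trans (tailAlg_le ∅ 0)) hTk
    (measurable_iterate_pinsker hT k) (exists_preimage_iterate_pinsker hT k)
    (f := A.indicator fun _ => (1 : ℝ)) ((integrable_const 1).indicator hA)
  exact h1.symm.trans (h3.symm.trans h2)

omit hprob in
lemma integral_abs_real_iterate_preimage (hT : MeasurePreserving T μ μ) (k : ℕ) {A B : Set X}
    (hA : MeasurableSet A) (hB : MeasurableSet B) (hmeas : Measurable μd) :
    ∫ z, |(μd z).real ((⇑T)^[k] ⁻¹' (A ∩ B)) -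
        (μd z).real ((⇑T)^[k] ⁻¹' A) * (μd z).real ((⇑T)^[k] ⁻¹' B)| ∂μ =
      ∫ z, |(μd z).real (A ∩ B) - (μd z).real A * (μd z).real B| ∂μ := by
  have hq : ∀ {C : Set X}, MeasurableSet C → Measurable fun z => (μd z).real C := fun hC =>
    ((Measure.measurable_coe hC).comp hmeas).ennreal_toReal
  have hTk := hT.iterate k
  have hm : Measurable fun z => |(μd z).real (A ∩ B) - (μd z).real A * (μd z).real B| :=
    ((hq (hA.inter hB)).sub ((hq hA).mul (hq hB))).abs
  conv_rhs => rw [← hTk.map_eq]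
  rw [integral_map hTk.measurable.aemeasurable hm.aestronglyMeasurable]
  refine integral_congr_ae ?_
  filter_upwards [real_iterate_preimage_ae_eq hdis hT k (hA.inter hB),
    real_iterate_preimage_ae_eq hdis hT k hA, real_iterate_preimage_ae_eq hdis hT k hB]
    with z h1 h2 h3
  rw [h1, h2, h3]

omit hprob in
lemma integral_abs_real_inter_sub_le {F : Finset (MSet X)} {K : ℕ} {A B : Set X}
    (hA : MeasurableSet A) (hB : MeasurableSet[tailAlg μ T F K] B) :
    ∫ z, |(μd z).real (A ∩ B) - (μd z).real A * (μd z).real B| ∂μ ≤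
      ∫ x, |(μ[A.indicator (fun _ => (1 : ℝ)) | tailAlg μ T F K]) x -
        (μ[A.indicator (fun _ => (1 : ℝ)) | pinsker μ T]) x| ∂μ := by
  refine le_trans (le_of_eq ?_) (integral_abs_condExp_inter_sub_le (pinsker_le_tailAlg F K)
    (tailAlg_le F K) hA hB)
  have hB' := tailAlg_le F K _ hB
  refine integral_congr_ae ?_
  filter_upwards [condExp_indicator_ae_eq_real hdis (hA.inter hB'),
    condExp_indicator_ae_eq_real hdis hA, condExp_indicator_ae_eq_real hdis hB'] with z h1 h2 h3
  rw [h1, h2, h3]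

/-- Telescoping: asymptotic conditional independence of sets pulled back along a sparse sequence of
times. -/
lemma integral_abs_real_iInter_sub_prod_le (hT : MeasurePreserving T μ μ) (hmeas : Measurable μd)
    {F : Finset (MSet X)} {K : ℕ} {ρ : ℝ} {ℓ : ℕ} (A : Fin ℓ → MSet X) (hAF : ∀ i, A i ∈ F)
    (A0 : Set X) (hA0 : MeasurableSet A0)
    (hρ0 : ∫ x, |(μ[A0.indicator (fun _ => (1 : ℝ)) | tailAlg μ T F K]) x -
        (μ[A0.indicator (fun _ => (1 : ℝ)) | pinsker μ T]) x| ∂μ ≤ ρ)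
    (hρ : ∀ i, ∫ x, |(μ[(A i).1.indicator (fun _ => (1 : ℝ)) | tailAlg μ T F K]) x -
        (μ[(A i).1.indicator (fun _ => (1 : ℝ)) | pinsker μ T]) x| ∂μ ≤ ρ)
    (k : ℕ) (b : Fin ℓ → ℕ) (hk : ∀ i, k + K ≤ b i) (hb : ∀ i j, i < j → b i + K ≤ b j) :
    ∫ z, |(μd z).real ((⇑T)^[k] ⁻¹' A0 ∩ ⋂ i, (⇑T)^[b i] ⁻¹' (A i).1) -
      (μd z).real ((⇑T)^[k] ⁻¹' A0) * ∏ i, (μd z).real ((⇑T)^[b i] ⁻¹' (A i).1)| ∂μ ≤ ℓ * ρ := by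
  induction ℓ generalizing A0 k with
  | zero => simp
  | succ ℓ ih =>
    have hpm : ∀ (j : ℕ) {C : Set X}, MeasurableSet C → MeasurableSet ((⇑T)^[j] ⁻¹' C) :=
      fun j _ hC => (T.measurable.iterate j) hC
    set B' : Set X := ⋂ i, (⇑T)^[b i - k] ⁻¹' (A i).1 with hB'
    have hB'm : MeasurableSet[tailAlg μ T F K] B' := by
      refine MeasurableSet.iInter fun i => MeasurableSpace.measurableSet_generateFrom
        (.inr ⟨b i - k, ?_, A i, hAF i, rfl⟩)
      have := hk i
      omega
    have hBeq : ⋂ i, (⇑T)^[b i] ⁻¹' (A i).1 = (⇑T)^[k] ⁻¹' B' := by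
      rw [hB', preimage_iInter]
      refine iInter_congr fun i => ?_
      rw [← preimage_comp, ← Function.iterate_add, Nat.sub_add_cancel]
      have := hk i
      omega
    have hBm : MeasurableSet B' := tailAlg_le F K _ hB'm
    have h1 := (integral_abs_real_iterate_preimage hdis hT k hA0 hBm hmeas).le.trans
      ((integral_abs_real_inter_sub_le hdis hA0 hB'm).trans hρ0)
    rw [preimage_inter, ← hBeq] at h1
    have h2 := ih (fun i => A i.succ) (fun i => hAF _) (A 0).1 (A 0).2 (hρ 0) (fun i => hρ _) (b 0)
      (fun i => b i.succ) (fun i => hb _ _ (Fin.succ_pos i))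
      (fun i j hij => hb _ _ (Fin.succ_lt_succ_iff.2 hij))
    have hsplit : ⋂ i, (⇑T)^[b i] ⁻¹' (A i).1 =
        (⇑T)^[b 0] ⁻¹' (A 0).1 ∩ ⋂ i : Fin ℓ, (⇑T)^[b i.succ] ⁻¹' (A i.succ).1 := by
      ext x
      simp only [mem_iInter, mem_inter_iff, Fin.forall_fin_succ]
    have hB : MeasurableSet (⋂ i, (⇑T)^[b i] ⁻¹' (A i).1) :=
      MeasurableSet.iInter fun i => hpm _ (A i).2
    rw [← hsplit] at h2
    have hmq : ∀ {C : Set X}, MeasurableSet C → Measurable fun z => (μd z).real C := fun hC =>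
      ((Measure.measurable_coe hC).comp hmeas).ennreal_toReal
    have hprod : ∀ z, (μd z).real ((⇑T)^[b 0] ⁻¹' (A 0).1) *
        ∏ i : Fin ℓ, (μd z).real ((⇑T)^[b i.succ] ⁻¹' (A i.succ).1) =
          ∏ i, (μd z).real ((⇑T)^[b i] ⁻¹' (A i).1) := fun z =>
      (Fin.prod_univ_succ fun i => (μd z).real ((⇑T)^[b i] ⁻¹' (A i).1)).symm
    simp only [hprod] at h2
    have hP : Measurable fun z => ∏ i, (μd z).real ((⇑T)^[b i] ⁻¹' (A i).1) :=
      Finset.measurable_fun_prod _ fun i _ => hmq (hpm _ (A i).2)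
    have hP1 : ∀ z, ∏ i, (μd z).real ((⇑T)^[b i] ⁻¹' (A i).1) ≤ 1 := fun z =>
      Finset.prod_le_one (fun _ _ => measureReal_nonneg) fun _ _ => measureReal_le_one
    have hP0 : ∀ z, 0 ≤ ∏ i, (μd z).real ((⇑T)^[b i] ⁻¹' (A i).1) := fun z =>
      Finset.prod_nonneg fun _ _ => measureReal_nonneg
    have hPi : Integrable (fun z => ∏ i, (μd z).real ((⇑T)^[b i] ⁻¹' (A i).1)) μ :=
      Integrable.of_bound hP.aestronglyMeasurable 1 (ae_of_all _ fun z => by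
        rw [Real.norm_eq_abs, abs_of_nonneg (hP0 z)]; exact hP1 z)
    have hmul : ∀ {u : X → ℝ}, Integrable u μ →
        Integrable (fun z => (μd z).real ((⇑T)^[k] ⁻¹' A0) * u z) μ := fun hu =>
      hu.bdd_mul (c := 1) (hmq (hpm k hA0)).aestronglyMeasurable (ae_of_all _ fun z => by
        rw [Real.norm_eq_abs, abs_of_nonneg measureReal_nonneg]; exact measureReal_le_one)
    have hi1 := ((integrable_real (μ := μ) hmeas ((hpm k hA0).inter hB)).sub
      (hmul (integrable_real hmeas hB))).abs
    have hi2 := ((integrable_real (μ := μ) hmeas hB).sub hPi).abs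
    simp only [Pi.sub_apply] at hi1 hi2
    refine (integral_mono_of_nonneg (ae_of_all _ fun z => abs_nonneg _) (hi1.add hi2)
      (ae_of_all _ fun z => ?_)).trans ?_
    · simp only [Pi.add_apply]
      have h : ∀ a p q r : ℝ, 0 ≤ p → p ≤ 1 → |a - p * r| ≤ |a - p * q| + |q - r| := by
        intro a p q r hp hp1
        have : |p * (q - r)| ≤ |q - r| := by
          rw [abs_mul, abs_of_nonneg hp]
          exact mul_le_of_le_one_left (abs_nonneg _) hp1
        calc |a - p * r| = |(a - p * q) + p * (q - r)| := by ring_nf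
          _ ≤ _ := (abs_add_le _ _).trans (by linarith)
      exact h _ _ _ _ measureReal_nonneg measureReal_le_one
    · simp only [Pi.add_apply]
      rw [integral_add hi1 hi2]
      push_cast
      linarith

end Pinsker

section Density

lemma CondStar.tendsto_card_lt {a : ℕ → ℕ} (ha : CondStar a) (K : ℕ) :
    Tendsto (fun N : ℕ => (((Finset.Icc 1 N).filter fun n => a n < K).card : ℝ) / N)
      atTop (𝓝 0) := by
  have h := (ha (K + 1) K.succ_pos).sqrt
  rw [Real.sqrt_zero] at h
  refine squeeze_zero (fun N => by positivity) (fun N => Real.le_sqrt_of_sq_le ?_) h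
  rw [div_pow]
  gcongr
  rw [sq, ← Nat.cast_mul, ← Finset.card_product]
  refine Nat.cast_le.2 (Finset.card_le_card fun p hp => ?_)
  simp only [Finset.mem_product, Finset.mem_filter] at hp ⊢
  exact ⟨⟨hp.1.1, hp.2.1⟩, abs_le.2 ⟨by omega, by omega⟩⟩

lemma CondStar.hasDensityOne {a : ℕ → ℕ} (ha : CondStar a) {F : Set ℕ} (K N₀ : ℕ)
    (hF : ∀ n ≥ N₀, K ≤ a n → n ∈ F) : HasDensityOne F := by
  have h0 : Tendsto (fun N : ℕ => (1 : ℝ) - (N₀ : ℝ) / N -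
      (((Finset.Icc 1 N).filter fun n => a n < K).card : ℝ) / N) atTop (𝓝 1) := by
    simpa using ((tendsto_const_div_atTop_nhds_zero_nat (N₀ : ℝ)).const_sub 1).sub
      (CondStar.tendsto_card_lt ha K)
  refine tendsto_of_tendsto_of_tendsto_of_le_of_le' h0 tendsto_const_nhds ?_ ?_
  · filter_upwards [eventually_gt_atTop 0] with N hN
    have hN' : (0 : ℝ) < N := Nat.cast_pos.2 hN
    have hsub : Finset.Icc 1 N ⊆ (Finset.Icc 1 N).filter (· ∈ F) ∪
        (Finset.range N₀ ∪ (Finset.Icc 1 N).filter fun n => a n < K) := by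
      intro n hn
      simp only [Finset.mem_union, Finset.mem_filter, Finset.mem_range, hn, true_and]
      by_contra! h
      exact h.1 (hF n h.2.1 h.2.2)
    have hcard := (Finset.card_le_card hsub).trans ((Finset.card_union_le _ _).trans
      (Nat.add_le_add_left (Finset.card_union_le _ _) _))
    rw [Nat.card_Icc, Nat.add_sub_cancel, Finset.card_range] at hcard
    have hcard' := (Nat.cast_le (α := ℝ)).2 hcard
    push_cast at hcard'
    rw [le_div_iff₀ hN', sub_mul, sub_mul, div_mul_cancel₀ _ hN'.ne', div_mul_cancel₀ _ hN'.ne']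
    linarith
  · refine Eventually.of_forall fun N => div_le_one_of_le₀ ?_ N.cast_nonneg
    have := Finset.card_filter_le (Finset.Icc 1 N) (· ∈ F)
    rw [Nat.card_Icc, Nat.add_sub_cancel] at this
    exact_mod_cast this

lemma CondStarStar.eventually_gap {ℓ : ℕ} {a : Fin ℓ → ℕ → ℕ} (ha : CondStarStar a) (K : ℕ) :
    ∀ᶠ n in atTop, ∀ i j, i < j → a i n + K ≤ a j n := by
  have h : ∀ᶠ n in atTop, ∀ i : Fin ℓ, ∀ h : (i : ℕ) + 1 < ℓ, a i n + K ≤ a ⟨i + 1, h⟩ n := by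
    refine eventually_all.2 fun i => ?_
    by_cases h : (i : ℕ) + 1 < ℓ
    · filter_upwards [(ha.2 i h).eventually_ge_atTop (K : ℤ)] with n hn _
      simp only [Fin.eta] at hn
      omega
    · exact Eventually.of_forall fun _ h' => absurd h' h
  filter_upwards [h] with n hn
  rintro ⟨i, hi⟩ ⟨j, hj⟩ hij
  rw [Fin.mk_lt_mk] at hij
  induction j, hij using Nat.le_induction with
  | base => exact hn ⟨i, hi⟩ hj
  | succ j hij ih =>
    have h1 := ih (Nat.lt_of_succ_lt hj)
    have h2 := hn ⟨j, Nat.lt_of_succ_lt hj⟩ hj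
    simp only at h2
    omega

end Density

/-- A quantitative Markov inequality for the complement of a deviation event. -/
lemma one_sub_lt_measure_abs_lt {X : Type*} [MeasurableSpace X] {μ : Measure X}
    [IsProbabilityMeasure μ] {f : X → ℝ} (hf : Measurable f) (hfi : Integrable f μ) {ε δ : ℝ}
    (hε : 0 < ε) (h : ∫ x, |f x| ∂μ < ε * δ) : 1 - δ < (μ {x | |f x| < ε}).toReal := by
  have hM := mul_meas_ge_le_integral_of_nonneg (ae_of_all μ fun x => abs_nonneg (f x)) hfi.abs ε
  have hset : {x | ε ≤ |f x|} = {x | |f x| < ε}ᶜ := by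
    ext x
    simp
  rw [hset, probReal_compl_eq_one_sub (measurableSet_lt hf.abs measurable_const)] at hM
  have := lt_of_mul_lt_mul_left (hM.trans_lt h) hε.le
  rw [Measure.real] at this
  linarith

end PinskerEntropy

/-- Theorem: if `Λ` satisfies Condition (**), `μ = ∫ μ_z dμ(z)` is the disintegration of `μ`
over the Pinsker σ-algebra, then for any measurable `A_0, A_1, …, A_ℓ` and `ε, δ > 0`, there
is a set `F ⊆ ℕ` of density one such that for all `n ∈ F`,
`μ{z : |μ_z(A₀ ∩ ⋂ᵢ T^{-aᵢ(n)}Aᵢ) − μ_z(A₀)·∏ᵢ μ_z(T^{-aᵢ(n)}Aᵢ)| < ε} > 1 − δ`. -/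
theorem pinsker_disintegration_density_one
    {ℓ : ℕ} (hℓ : 1 ≤ ℓ) (a : Fin ℓ → ℕ → ℕ) (hpos : ∀ i n, 0 < a i n)
    (hΛ : CondStarStar a)
    {X : Type*} [MeasurableSpace X] [StandardBorelSpace X]
    (μ : Measure X) [IsProbabilityMeasure μ]
    (T : X ≃ᵐ X) (hT : MeasurePreserving T μ μ)
    (μd : X → Measure X) (hmeas : Measurable μd)
    (hprob : ∀ z, IsProbabilityMeasure (μd z))
    (hdis : ∀ f : X → ℝ, Integrable f μ →
      (μ[f | pinsker μ ⇑T]) =ᵐ[μ] fun z => ∫ y, f y ∂(μd z))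
    (A0 : Set X) (hA0 : MeasurableSet A0)
    (A : Fin ℓ → Set X) (hA : ∀ i, MeasurableSet (A i))
    (ε δ : ℝ) (hε : 0 < ε) (hδ : 0 < δ) :
    ∃ F : Set ℕ, HasDensityOne F ∧ ∀ n ∈ F,
      1 - δ < (μ {z : X |
        |(μd z (A0 ∩ ⋂ i, (⇑T)^[a i n] ⁻¹' A i)).toReal -
          (μd z A0).toReal * ∏ i, (μd z ((⇑T)^[a i n] ⁻¹' A i)).toReal| < ε}).toReal := by
  classical
  set F : Finset (PinskerEntropy.MSet X) :=
    Finset.univ.image fun i => (⟨A i, hA i⟩ : PinskerEntropy.MSet X) with hF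
  set ρ : ℝ := ε * δ / (ℓ + 1) with hρ
  have hεδ : 0 < ε * δ := mul_pos hε hδ
  have hρpos : 0 < ρ := by positivity
  have hev := fun {B : Set X} (hB : MeasurableSet B) =>
    (PinskerEntropy.tendsto_integral_abs_condExp_tailAlg_sub hT F hB).eventually_le_const hρpos
  obtain ⟨K, hK0, hK⟩ := ((hev hA0).and (eventually_all.2 fun i => hev (hA i))).exists
  obtain ⟨N₀, hN₀⟩ := eventually_atTop.1 (PinskerEntropy.CondStarStar.eventually_gap hΛ K)
  refine ⟨{n | K ≤ a ⟨0, hℓ⟩ n ∧ ∀ i j, i < j → a i n + K ≤ a j n},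
    PinskerEntropy.CondStar.hasDensityOne (hΛ.1 ⟨0, hℓ⟩) K N₀ fun n hn h => ⟨h, hN₀ n hn⟩, ?_⟩
  rintro n ⟨hn0, hn⟩
  have hk : ∀ i, 0 + K ≤ a i n := by
    intro i
    rcases (show (⟨0, hℓ⟩ : Fin ℓ) ≤ i from Nat.zero_le _).eq_or_lt with h | h
    · rw [← h]; omega
    · have := hn _ _ h
      omega
  have key := PinskerEntropy.integral_abs_real_iInter_sub_prod_le hdis hT hmeas
    (fun i => ⟨A i, hA i⟩) (fun i => Finset.mem_image_of_mem _ (Finset.mem_univ i)) A0 hA0 hK0 hK 0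
    (fun i => a i n) hk hn
  simp only [Function.iterate_zero, preimage_id] at key
  have hAm : ∀ i, MeasurableSet ((⇑T)^[a i n] ⁻¹' A i) := fun i => (T.measurable.iterate _) (hA i)
  have hmq : ∀ {C : Set X}, MeasurableSet C → Measurable fun z => (μd z).real C := fun hC =>
    ((Measure.measurable_coe hC).comp hmeas).ennreal_toReal
  have hfm : Measurable fun z => (μd z).real (A0 ∩ ⋂ i, (⇑T)^[a i n] ⁻¹' A i) -
      (μd z).real A0 * ∏ i, (μd z).real ((⇑T)^[a i n] ⁻¹' A i) :=
    (hmq (hA0.inter (MeasurableSet.iInter hAm))).sub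
      ((hmq hA0).mul (Finset.measurable_fun_prod _ fun i _ => hmq (hAm i)))
  refine PinskerEntropy.one_sub_lt_measure_abs_lt hfm ?_ hε (key.trans_lt ?_)
  · refine Integrable.of_bound hfm.aestronglyMeasurable 1 (ae_of_all _ fun z => ?_)
    have h1 : (μd z).real A0 * ∏ i, (μd z).real ((⇑T)^[a i n] ⁻¹' A i) ≤ 1 :=
      mul_le_one₀ measureReal_le_one (Finset.prod_nonneg fun _ _ => measureReal_nonneg)
        (Finset.prod_le_one (fun _ _ => measureReal_nonneg) fun _ _ => measureReal_le_one)
    have h2 : 0 ≤ (μd z).real A0 * ∏ i, (μd z).real ((⇑T)^[a i n] ⁻¹' A i) :=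
      mul_nonneg measureReal_nonneg (Finset.prod_nonneg fun _ _ => measureReal_nonneg)
    have h3 : (μd z).real (A0 ∩ ⋂ i, (⇑T)^[a i n] ⁻¹' A i) ≤ 1 := measureReal_le_one
    have h4 : 0 ≤ (μd z).real (A0 ∩ ⋂ i, (⇑T)^[a i n] ⁻¹' A i) := measureReal_nonneg
    exact abs_le.2 ⟨by linarith, by linarith⟩
  · rw [hρ, mul_div_assoc', div_lt_iff₀ (by positivity)]
    linarith
end

section
/- Let Λ = {a_1,…,a_ℓ} be a collection of sequences of positive integers that is good for liminf-ℓ-recurrence and satisfies Condition (**). Let (X,ℬ,μ,T) be an invertible measure preserving system on a standard Borel probability space, P_μ(T) its Pinsker σ-algebra, and μ = ∫ μ_z dμ(z) the disintegration of μ over P_μ(T). For every M ∈ ℕ, if U_1,…,U_M ∈ ℬ are non-empty sets such that μ({z ∈ X : μ_z(U_i) > 0 for all i = 1,…,M}) > 0, then there exist L ∈ ℕ and c > 0 such that μ({z ∈ X : μ_z(U_s^L) > c for all s ∈ {1,…,M}^{ℓ+1}}) > 0, where U_s^L = U_{s(1)} ∩ T^{−a_1(L)}U_{s(2)} ∩ ⋯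 ∩ T^{−a_ℓ(L)}U_{s(ℓ+1)} for each s ∈ {1,…,M}^{ℓ+1}. -/
open MeasureTheory Filter Topology Set
open scoped ENNReal

/-- The collection `a` of sequences is good for liminf-ℓ-recurrence. -/
def GoodLiminfRecurrence {ℓ : ℕ} (a : Fin ℓ → ℕ → ℕ) : Prop :=
  ∀ (Y : Type) [MeasurableSpace Y] [StandardBorelSpace Y]
    (ν : Measure Y) [IsProbabilityMeasure ν] (S : Y ≃ᵐ Y),
    MeasurePreserving S ν ν → ∀ A : Set Y, MeasurableSet A → 0 < ν A →
    0 < Filter.atTop.liminf (fun N : ℕ =>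
      (1 / N : ℝ) * ∑ n ∈ Finset.Icc 1 N,
        (ν (A ∩ ⋂ i : Fin ℓ, (⇑S)^[a i n] ⁻¹' A)).toReal)

section CondEnt

variable {X : Type*} {G G' : MeasurableSpace X} {m0 : MeasurableSpace X} {μ : Measure X}

/-- The conditional probability of `A` given the σ-algebra `G`. -/
noncomputable def cprob (μ : Measure X) (G : MeasurableSpace X) (A : Set X) : X → ℝ :=
  μ[A.indicator (fun _ => (1 : ℝ)) | G]

/-- The conditional entropy of the partition `{A, Aᶜ}` given the σ-algebra `G`. -/
noncomputable def condEnt (μ : Measure X) (G : MeasurableSpace X) (A : Set X) : ℝ :=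
  ∫ z, Real.binEntropy (cprob μ G A z) ∂μ

lemma integrable_ind [IsFiniteMeasure μ] {A : Set X} (hA : MeasurableSet A) :
    Integrable (A.indicator (fun _ => (1 : ℝ))) μ :=
  (integrable_const 1).indicator hA

lemma stronglyMeasurable_cprob {A : Set X} :
    StronglyMeasurable[G] (cprob μ G A) :=
  stronglyMeasurable_condExp

lemma integrable_cprob {A : Set X} : Integrable (cprob μ G A) μ :=
  integrable_condExp

lemma cprob_mem [IsFiniteMeasure μ] {A : Set X} :
    ∀ᵐ z ∂μ, cprob μ G A z ∈ Icc (0 : ℝ) 1 := by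
  have h0 : ∀ᵐ z ∂μ, 0 ≤ cprob μ G A z :=
    condExp_nonneg (ae_of_all _ fun z => indicator_nonneg (fun _ _ => zero_le_one) z)
  have h1 : ∀ᵐ z ∂μ, cprob μ G A z ≤ 1 :=
    condExp_le_nonneg_const zero_le_one
      (ae_of_all _ fun z => indicator_le_self' (fun _ _ => zero_le_one) z)
  filter_upwards [h0, h1] with z a b using ⟨a, b⟩

lemma integrable_binEntropy [IsFiniteMeasure μ] {f : X → ℝ} (hf : AEStronglyMeasurable f μ)
    (h : ∀ᵐ z ∂μ, f z ∈ Icc (0 : ℝ) 1) : Integrable (fun z => Real.binEntropy (f z)) μ := by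
  refine Integrable.of_bound (Real.binEntropy_continuous.comp_aestronglyMeasurable hf)
    (Real.log 2) ?_
  filter_upwards [h] with z hz
  rw [Real.norm_of_nonneg (Real.binEntropy_nonneg hz.1 hz.2)]
  exact Real.binEntropy_le_log_two

lemma aestronglyMeasurable_cprob {A : Set X} :
    AEStronglyMeasurable (cprob μ G A) μ :=
  integrable_cprob.aestronglyMeasurable

lemma integrable_binEntropy_cprob [IsFiniteMeasure μ] {A : Set X} :
    Integrable (fun z => Real.binEntropy (cprob μ G A z)) μ :=
  integrable_binEntropy aestronglyMeasurable_cprob cprob_mem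

lemma condEnt_nonneg [IsFiniteMeasure μ] {A : Set X} : 0 ≤ condEnt μ G A := by
  refine integral_nonneg_of_ae ?_
  filter_upwards [cprob_mem (μ := μ) (G := G) (A := A)] with z hz
  exact Real.binEntropy_nonneg hz.1 hz.2

lemma concaveOn_binEntropy_add_sq :
    ConcaveOn ℝ (Icc (0 : ℝ) 1) (fun p => Real.binEntropy p + p ^ 2) := by
  have hd : ∀ p ∈ Ioo (0 : ℝ) 1, HasDerivAt (fun p => Real.binEntropy p + p ^ 2)
      (Real.log (1 - p) - Real.log p + 2 * p) p := by
    intro p hp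
    simpa using! (Real.hasDerivAt_binEntropy hp.1.ne' hp.2.ne).add (hasDerivAt_pow 2 p)
  refine concaveOn_of_hasDerivWithinAt2_nonpos (convex_Icc 0 1)
    (f' := fun p => Real.log (1 - p) - Real.log p + 2 * p)
    (f'' := fun p => - (1 - p)⁻¹ - p⁻¹ + 2) ?_ ?_ ?_ ?_
  · exact (Real.binEntropy_continuous.add (continuous_pow 2)).continuousOn
  · intro p hp
    rw [interior_Icc] at hp
    exact (hd p hp).hasDerivWithinAt
  · intro p hp
    rw [interior_Icc] at hp
    have h1 : HasDerivAt (fun p : ℝ => Real.log (1 - p)) (- (1 - p)⁻¹) p := by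
      have := (Real.hasDerivAt_log (x := 1 - p) (by linarith [hp.2])).comp p
        ((hasDerivAt_id p).const_sub 1)
      simpa using! this
    have h2 := Real.hasDerivAt_log hp.1.ne'
    have h3 : HasDerivAt (fun p : ℝ => 2 * p) 2 p := by
      simpa using (hasDerivAt_id p).const_mul 2
    exact ((h1.sub h2).add h3).hasDerivWithinAt
  · intro p hp
    rw [interior_Icc] at hp
    have h1 : 1 ≤ p⁻¹ := (one_le_inv₀ hp.1).2 hp.2.le
    have h2 : 1 ≤ (1 - p)⁻¹ := (one_le_inv₀ (by linarith [hp.2])).2 (by linarith [hp.1])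
    linarith

lemma cprob_cprob [IsFiniteMeasure μ] (h : G ≤ G') (h' : G' ≤ m0)
    {A : Set X} : μ[cprob μ G' A | G] =ᵐ[μ] cprob μ G A :=
  condExp_condExp_of_le h h'

lemma integrable_mul_of_mem [IsFiniteMeasure μ] {f g : X → ℝ} (hf : AEStronglyMeasurable f μ)
    (hf' : ∀ᵐ z ∂μ, f z ∈ Icc (0 : ℝ) 1) (hg : Integrable g μ) :
    Integrable (fun z => f z * g z) μ := by
  refine hg.bdd_mul (c := 1) hf ?_
  filter_upwards [hf'] with z hz
  rw [Real.norm_of_nonneg hz.1]; exact hz.2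

lemma condEnt_add_le [IsFiniteMeasure μ] (h : G ≤ G') (h' : G' ≤ m0)
    {A : Set X} :
    condEnt μ G' A + ∫ z, (cprob μ G' A z - cprob μ G A z) ^ 2 ∂μ ≤ condEnt μ G A := by
  set p := cprob μ G' A with hp
  set q := cprob μ G A with hq
  have hpm := cprob_mem (μ := μ) (G := G') (A := A)
  have hqm := cprob_mem (μ := μ) (G := G) (A := A)
  have ip2 : Integrable (fun z => p z * p z) μ :=
    integrable_mul_of_mem aestronglyMeasurable_cprob hpm integrable_cprob
  have iq2 : Integrable (fun z => q z * q z) μ :=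
    integrable_mul_of_mem aestronglyMeasurable_cprob hqm integrable_cprob
  have iqp : Integrable (fun z => q z * p z) μ :=
    integrable_mul_of_mem aestronglyMeasurable_cprob hqm integrable_cprob
  have ibp := integrable_binEntropy_cprob (μ := μ) (G := G') (A := A)
  have ibq := integrable_binEntropy_cprob (μ := μ) (G := G) (A := A)
  have ic : Integrable ((fun p => Real.binEntropy p + p ^ 2) ∘ p) μ := by
    simpa [sq] using! ibp.add ip2
  have J := concaveOn_binEntropy_add_sq.condExp_map_le (μ := μ) (f := p) (h.trans h')
    (Real.binEntropy_continuous.add (continuous_pow 2)).continuousOn.upperSemicontinuousOn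
    hpm isClosed_Icc integrable_cprob ic
  have J2 : ∫ z, (Real.binEntropy (p z) + p z * p z) ∂μ
      ≤ ∫ z, (Real.binEntropy (q z) + q z * q z) ∂μ := by
    calc _ = ∫ z, (μ[(fun p => Real.binEntropy p + p ^ 2) ∘ p | G]) z ∂μ := by
          rw [integral_condExp (h.trans h')]
          simp [sq]
      _ ≤ _ := by
          refine integral_mono_ae integrable_condExp (ibq.add iq2) ?_
          filter_upwards [J, cprob_cprob (μ := μ) h h' (A := A)] with z hz hz'
          simp only [Function.comp_apply] at hz
          rw [hz'] at hz
          simpa [sq] using hz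
  have J3 : ∫ z, q z * p z ∂μ = ∫ z, q z * q z ∂μ := by
    have := condExp_mul_of_stronglyMeasurable_left (μ := μ) (m := G) (f := q) (g := p)
      stronglyMeasurable_cprob iqp integrable_cprob
    calc _ = ∫ z, (μ[q * p | G]) z ∂μ := (integral_condExp (h.trans h')).symm
      _ = _ := by
        refine integral_congr_ae ?_
        filter_upwards [this, cprob_cprob (μ := μ) h h' (A := A)] with z hz hz'
        rw [hz, Pi.mul_apply, hz']
  have J4 : ∫ z, (p z - q z) ^ 2 ∂μ
      = ∫ z, p z * p z ∂μ - 2 * ∫ z, q z * p z ∂μ + ∫ z, q z * q z ∂μ := by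
    rw [← integral_const_mul, ← integral_sub ip2 (iqp.const_mul 2),
      ← integral_add (by exact ip2.sub (iqp.const_mul 2)) iq2]
    congr 1; ext z; ring
  rw [integral_add ibp ip2, integral_add ibq iq2] at J2
  unfold condEnt
  linarith

lemma condEnt_anti [IsFiniteMeasure μ] (h : G ≤ G') (h' : G' ≤ m0)
    {A : Set X} : condEnt μ G' A ≤ condEnt μ G A := by
  have := condEnt_add_le (μ := μ) h h' (A := A)
  have h2 : 0 ≤ ∫ z, (cprob μ G' A z - cprob μ G A z) ^ 2 ∂μ :=
    integral_nonneg fun z => sq_nonneg _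
  linarith

lemma cprob_ae_eq_of_condEnt_le [IsFiniteMeasure μ] (h : G ≤ G')
    (h' : G' ≤ m0) {A : Set X} (hle : condEnt μ G A ≤ condEnt μ G' A) :
    cprob μ G' A =ᵐ[μ] cprob μ G A := by
  have h1 := condEnt_add_le (μ := μ) h h' (A := A)
  have h2 : 0 ≤ ∫ z, (cprob μ G' A z - cprob μ G A z) ^ 2 ∂μ :=
    integral_nonneg fun z => sq_nonneg _
  have h3 : ∫ z, (cprob μ G' A z - cprob μ G A z) ^ 2 ∂μ = 0 := by linarith
  rw [integral_eq_zero_iff_of_nonneg (fun z => sq_nonneg _)] at h3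
  · filter_upwards [h3] with z hz
    have : cprob μ G' A z - cprob μ G A z = 0 := by simpa using hz
    linarith
  · refine Integrable.of_bound ((aestronglyMeasurable_cprob.sub aestronglyMeasurable_cprob).pow 2)
      1 ?_
    filter_upwards [cprob_mem (μ := μ) (G := G) (A := A),
      cprob_mem (μ := μ) (G := G') (A := A)] with z hz hz'
    simp only [norm_pow, Real.norm_eq_abs, sq_abs]
    have : |cprob μ G' A z - cprob μ G A z| ≤ 1 := by
      rw [abs_le]; constructor <;> linarith [hz.1, hz.2, hz'.1, hz'.2]
    exact (sq_le_one_iff_abs_le_one _).2 this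

lemma condEnt_eq_zero [IsFiniteMeasure μ] (hG : G ≤ m0) {A : Set X}
    (hA : MeasurableSet A)
    (h : AEStronglyMeasurable[G] (A.indicator (fun _ => (1 : ℝ))) μ) : condEnt μ G A = 0 := by
  have := condExp_of_aestronglyMeasurable' hG h (integrable_ind (μ := μ) hA)
  unfold condEnt
  refine integral_eq_zero_of_ae ?_
  filter_upwards [this] with z hz
  rw [cprob, hz]
  by_cases hz : z ∈ A <;> simp [hz]

lemma tendsto_condEnt [IsFiniteMeasure μ] {G : ℕ → MeasurableSpace X} (hG : Monotone G)
    (hle : ∀ n, G n ≤ m0) {A : Set X} :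
    Tendsto (fun n => condEnt μ (G n) A) atTop (𝓝 (condEnt μ (⨆ n, G n) A)) := by
  let ℱ : Filtration ℕ m0 := ⟨G, hG, hle⟩
  have h := MeasureTheory.tendsto_ae_condExp (μ := μ) (ℱ := ℱ) (A.indicator (fun _ => (1 : ℝ)))
  refine tendsto_integral_of_dominated_convergence (fun _ => Real.log 2)
    (fun n => integrable_binEntropy_cprob.aestronglyMeasurable) (integrable_const _) ?_ ?_
  · intro n
    filter_upwards [cprob_mem (μ := μ) (G := G n) (A := A)] with z hz
    rw [Real.norm_of_nonneg (Real.binEntropy_nonneg hz.1 hz.2)]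
    exact Real.binEntropy_le_log_two
  · filter_upwards [h] with z hz
    exact (Real.binEntropy_continuous.tendsto _).comp hz

/-- Splitting every cell of a finite partition along `A` increases the entropy by the conditional
entropy of `{A, Aᶜ}`. -/
lemma sum_negMulLog_split [IsFiniteMeasure μ] (hG : G ≤ m0)
    {κ : Type*} (K : Finset κ) (D : κ → Set X) (hD : ∀ k ∈ K, MeasurableSet[G] (D k))
    (hdisj : (K : Set κ).PairwiseDisjoint D) (hcov : ⋃ k ∈ K, D k = univ)
    (hatom : ∀ t, MeasurableSet[G] t → ∀ k ∈ K, D k ⊆ t ∨ Disjoint (D k) t)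
    {A : Set X} (hA : MeasurableSet A) :
    ∑ k ∈ K, (Real.negMulLog (μ.real (D k ∩ A)) + Real.negMulLog (μ.real (D k \ A)))
      = ∑ k ∈ K, Real.negMulLog (μ.real (D k)) + condEnt μ G A := by
  set f := cprob μ G A with hf
  have hconst : ∀ k ∈ K, ∀ z ∈ D k, ∀ w ∈ D k, f w = f z := by
    intro k hk z hz w hw
    have hm : MeasurableSet[G] (f ⁻¹' {f z}) :=
      stronglyMeasurable_cprob.measurable (measurableSet_singleton _)
    rcases hatom _ hm k hk with h | h
    · exact h hw
    · exact absurd rfl (fun e => (Set.disjoint_left.1 h hz) e)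
  have hint : condEnt μ G A = ∑ k ∈ K, ∫ z in D k, Real.binEntropy (f z) ∂μ := by
    unfold condEnt
    rw [← setIntegral_univ, ← hcov, integral_biUnion_finset K (fun k hk => hG _ (hD k hk)) hdisj]
    exact fun k _ => integrable_binEntropy_cprob.integrableOn
  rw [hint, ← Finset.sum_add_distrib]
  refine Finset.sum_congr rfl fun k hk => ?_
  rcases (D k).eq_empty_or_nonempty with h0 | ⟨z, hz⟩
  · simp [h0]
  have e1 : ∫ w in D k, Real.binEntropy (f w) ∂μ = μ.real (D k) * Real.binEntropy (f z) := by
    rw [setIntegral_congr_fun (hG _ (hD k hk)) (g := fun _ => Real.binEntropy (f z))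
      (fun w hw => by rw [hconst k hk z hz w hw])]
    simp
  have e2 : μ.real (D k ∩ A) = μ.real (D k) * f z := by
    have := setIntegral_condExp hG (integrable_ind (μ := μ) hA) (hD k hk)
    rw [setIntegral_congr_fun (f := μ[A.indicator (fun _ => (1 : ℝ)) | G]) (hG _ (hD k hk))
      (g := fun _ => f z) (fun w hw => hconst k hk z hz w hw), setIntegral_indicator hA] at this
    simpa using! this.symm
  have e3 : μ.real (D k \ A) = μ.real (D k) * (1 - f z) := by
    have := measureReal_inter_add_sdiff (μ := μ) (s := D k) hA
    linarith
  rw [e1, e2, e3, Real.negMulLog_mul, Real.negMulLog_mul,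
    Real.binEntropy_eq_negMulLog_add_negMulLog_one_sub]
  ring

end CondEnt

section Ent

/-- Measurable sets, as a type. -/
abbrev MSet (X : Type*) [MeasurableSpace X] := {s : Set X // MeasurableSet s}

lemma mem_iff_of_measurableSet_generateFrom {X : Type*} {S : Set (Set X)} {z w : X}
    (h : ∀ s ∈ S, z ∈ s ↔ w ∈ s) {t : Set X}
    (ht : MeasurableSet[MeasurableSpace.generateFrom S] t) : z ∈ t ↔ w ∈ t := by
  induction ht with
  | basic u hu => exact h u hu
  | empty => simp
  | compl t _ ih => simp [ih]
  | iUnion f _ ih => simp [ih]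

variable {X : Type*} [m0 : MeasurableSpace X] {μ : Measure X}

/-- The σ-algebra generated by a finite family of measurable sets. -/
@[reducible] def gen (J : Finset (MSet X)) : MeasurableSpace X :=
  MeasurableSpace.generateFrom ((fun a : MSet X => a.1) '' (J : Set (MSet X)))

/-- The cell of the partition generated by `J` consisting of the points which, among the members
of `J`, lie exactly in those belonging to `s`. -/
def cell (J s : Finset (MSet X)) : Set X := {z | ∀ a ∈ J, z ∈ a.1 ↔ a ∈ s}

/-- The Shannon entropy of the partition generated by a finite family of measurable sets. -/
noncomputable def ent (μ : Measure X) (J : Finset (MSet X)) : ℝ :=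
  ∑ s ∈ J.powerset, Real.negMulLog (μ.real (cell J s))

lemma gen_le (J : Finset (MSet X)) : gen J ≤ m0 := by
  refine MeasurableSpace.generateFrom_le ?_
  rintro _ ⟨a, -, rfl⟩
  exact a.2

lemma measurableSet_gen {J : Finset (MSet X)} {a : MSet X} (h : a ∈ J) :
    MeasurableSet[gen J] a.1 :=
  MeasurableSpace.measurableSet_generateFrom ⟨a, h, rfl⟩

lemma gen_mono {J K : Finset (MSet X)} (h : J ⊆ K) : gen J ≤ gen K :=
  MeasurableSpace.generateFrom_mono (image_mono (by exact_mod_cast h))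

/-- Splitting the members of a partition into cells of a finitely generated σ-algebra. -/
lemma sum_negMulLog_split_gen [IsFiniteMeasure μ] (J : Finset (MSet X)) {κ : Type*}
    (K : Finset κ) (D : κ → Set X) (hDm : ∀ k ∈ K, MeasurableSet[gen J] (D k))
    (hsat : ∀ k ∈ K, ∀ z ∈ D k, ∀ w ∈ D k, ∀ a ∈ J, z ∈ a.1 ↔ w ∈ a.1)
    (hdisj : (K : Set κ).PairwiseDisjoint D) (hcov : ∀ z, ∃ k ∈ K, z ∈ D k) (A : MSet X) :
    ∑ k ∈ K, (Real.negMulLog (μ.real (D k ∩ A.1)) + Real.negMulLog (μ.real (D k \ A.1)))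
      = ∑ k ∈ K, Real.negMulLog (μ.real (D k)) + condEnt μ (gen J) A.1 := by
  refine sum_negMulLog_split (gen_le J) K D hDm hdisj ?_ ?_ A.2
  · exact eq_univ_of_forall fun z => by simpa using hcov z
  · intro t ht k hk
    by_cases hne : (D k ∩ t).Nonempty
    · left
      obtain ⟨z, hz, hzt⟩ := hne
      intro w hw
      refine (mem_iff_of_measurableSet_generateFrom ?_ ht).1 hzt
      rintro _ ⟨a, ha, rfl⟩
      exact hsat k hk z hz w hw a ha
    · right
      exact Set.disjoint_iff_inter_eq_empty.2 (Set.not_nonempty_iff_eq_empty.1 hne)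

lemma measurableSet_cell (J s : Finset (MSet X)) : MeasurableSet[gen J] (cell J s) := by
  have : cell J s = ⋂ a ∈ J, {z | z ∈ a.1 ↔ a ∈ s} := by ext z; simp [cell]
  rw [this]
  refine MeasurableSet.biInter J.countable_toSet fun a ha => ?_
  by_cases hs : a ∈ s
  · have : {z | z ∈ a.1 ↔ a ∈ s} = a.1 := by ext z; simp [hs]
    rw [this]; exact measurableSet_gen ha
  · have : {z | z ∈ a.1 ↔ a ∈ s} = a.1ᶜ := by ext z; simp [hs]
    rw [this]; exact (measurableSet_gen ha).compl

open scoped Classical in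
lemma ent_insert [IsFiniteMeasure μ] (J : Finset (MSet X)) (A : MSet X) :
    ent μ (insert A J) = ent μ J + condEnt μ (gen J) A.1 := by
  by_cases hA : A ∈ J
  · have h1 : condEnt μ (gen J) A.1 = 0 := by
      refine condEnt_eq_zero (gen_le J) A.2 ?_
      exact (stronglyMeasurable_const.indicator (measurableSet_gen hA)).aestronglyMeasurable
    rw [Finset.insert_eq_of_mem hA, h1, add_zero]
  have key := sum_negMulLog_split_gen (μ := μ) J J.powerset (cell J)
    (fun s _ => measurableSet_cell J s)
    (fun s _ z hz w hw a ha => (hz a ha).trans (hw a ha).symm) ?_ ?_ A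
  · unfold ent
    rw [← key, Finset.sum_powerset_insert hA, Finset.sum_add_distrib, add_comm]
    have hs : ∀ s ∈ J.powerset, A ∉ s := fun s hs h => hA (Finset.mem_powerset.1 hs h)
    congr 1
    · refine Finset.sum_congr rfl fun s hs' => ?_
      congr 2
      ext z
      simp only [cell, Finset.mem_insert, Set.mem_ofPred_eq, forall_eq_or_imp, true_or, iff_true,
        mem_inter_iff]
      rw [and_comm]
      refine and_congr_left fun _ => forall₂_congr fun a ha => ?_
      have : a ≠ A := fun e => hA (e ▸ ha)
      simp [this]
    · refine Finset.sum_congr rfl fun s hs' => ?_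
      congr 2
      ext z
      simp only [cell, Finset.mem_insert, Set.mem_ofPred_eq, forall_eq_or_imp, Set.mem_sdiff]
      rw [and_comm]
      simp [hs s hs']
  · intro s hs t ht hst
    refine Set.disjoint_left.2 fun z hz hz' => hst ?_
    ext a
    by_cases ha : a ∈ J
    · rw [← hz a ha, ← hz' a ha]
    · exact ⟨fun h => absurd (Finset.mem_powerset.1 hs h) ha,
        fun h => absurd (Finset.mem_powerset.1 ht h) ha⟩
  · intro z
    refine ⟨J.filter (fun a => z ∈ a.1), by simp, ?_⟩
    intro a ha
    simp [ha]

open scoped Classical in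
lemma sum_negMulLog_signs_eq_ent [IsProbabilityMeasure μ] (B : ℕ → MSet X) (n : ℕ) :
    ∑ s : Fin n → Bool, Real.negMulLog
      (μ.real (⋂ i : Fin n, (if s i then (B i).1 else (B i).1ᶜ)))
      = ent μ ((Finset.range n).image B) := by
  induction n with
  | zero => simp [ent, cell]
  | succ n ih =>
    rw [Finset.range_add_one, Finset.image_insert, ent_insert, ← ih,
      ← (Fin.snocEquiv (fun _ => Bool)).sum_comp, Fintype.sum_prod_type, Fintype.sum_bool,
      ← Finset.sum_add_distrib]
    have hmem : ∀ (s : Fin n → Bool) (z : X),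
        z ∈ ⋂ i : Fin n, (if s i then (B i).1 else (B i).1ᶜ) ↔ ∀ i : Fin n, z ∈ (B i).1 ↔ s i := by
      intro s z
      simp only [mem_iInter]
      refine forall_congr' fun i => ?_
      by_cases h : s i <;> simp [h]
    have hmem' : ∀ (b : Bool) (s : Fin n → Bool) (z : X),
        z ∈ ⋂ i : Fin (n + 1), (if (Fin.snocEquiv (fun _ => Bool)) (b, s) i then (B i).1
          else (B i).1ᶜ) ↔ (∀ i : Fin n, z ∈ (B i).1 ↔ s i) ∧ (z ∈ (B n).1 ↔ b) := by
      intro b s z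
      simp only [mem_iInter, Fin.forall_fin_succ', Fin.snocEquiv_apply, Fin.snoc_castSucc,
        Fin.snoc_last, Fin.val_castSucc, Fin.val_last]
      refine and_congr (forall_congr' fun i => ?_) ?_
      · by_cases h : s i <;> simp [h]
      · cases b <;> simp
    rw [← sum_negMulLog_split_gen (μ := μ) ((Finset.range n).image B) Finset.univ
      (fun s : Fin n → Bool => ⋂ i : Fin n, (if s i then (B i).1 else (B i).1ᶜ))]
    · refine Finset.sum_congr rfl fun s _ => ?_
      congr 3 <;> ext z
      · rw [hmem', mem_inter_iff, hmem]; simp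
      · rw [hmem', Set.mem_sdiff, hmem]; simp
    · intro s _
      refine MeasurableSet.iInter fun i => ?_
      have hi : MeasurableSet[gen ((Finset.range n).image B)] (B i).1 :=
        measurableSet_gen (Finset.mem_image_of_mem _ (Finset.mem_range.2 i.2))
      split_ifs
      · exact hi
      · exact hi.compl
    · intro s _ z hz w hw a ha
      obtain ⟨i, hi, rfl⟩ := Finset.mem_image.1 ha
      have hi' := Finset.mem_range.1 hi
      exact ((hmem s z).1 hz ⟨i, hi'⟩).trans ((hmem s w).1 hw ⟨i, hi'⟩).symm
    · intro s _ t _ hst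
      refine Set.disjoint_left.2 fun z hz hz' => hst (funext fun i => ?_)
      exact Bool.eq_iff_iff.2 (((hmem s z).1 hz i).symm.trans ((hmem t z).1 hz' i))
    · intro z
      exact ⟨fun i => decide (z ∈ (B i).1), Finset.mem_univ _, (hmem _ z).2 fun i => by simp⟩

end Ent

section Orbits

section Comap

variable {X : Type*} {G : MeasurableSpace X} [m0 : MeasurableSpace X] {μ : Measure X}

lemma integral_comp_eq {f : X → X} (hf : MeasurePreserving f μ μ) {h : X → ℝ}
    (hh : AEStronglyMeasurable h μ) : ∫ x, h (f x) ∂μ = ∫ x, h x ∂μ := by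
  have hm : AEStronglyMeasurable h (Measure.map f μ) := by rwa [hf.map_eq]
  rw [← integral_map hf.measurable.aemeasurable hm, hf.map_eq]

lemma condExp_comp_comap [IsFiniteMeasure μ] {f : X → X} (hf : MeasurePreserving f μ μ)
    (hG : G ≤ m0) {g : X → ℝ} (hg : Integrable g μ) :
    μ[g ∘ f | G.comap f] =ᵐ[μ] (μ[g | G]) ∘ f := by
  have hle : G.comap f ≤ m0 := by
    rintro _ ⟨s, hs, rfl⟩
    exact hf.measurable (hG s hs)
  have hi : Integrable ((μ[g | G]) ∘ f) μ :=
    hf.integrable_comp_of_integrable integrable_condExp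
  symm
  refine ae_eq_condExp_of_forall_setIntegral_eq hle (hf.integrable_comp_of_integrable hg)
    (fun _ _ _ => hi.integrableOn) ?_ ?_
  · rintro _ ⟨s, hs, rfl⟩ -
    have key : ∀ h : X → ℝ, Integrable h μ →
        ∫ x in f ⁻¹' s, (h ∘ f) x ∂μ = ∫ x in s, h x ∂μ := by
      intro h hh
      rw [← integral_indicator (hf.measurable (hG s hs)), ← integral_indicator (hG s hs)]
      have e : (f ⁻¹' s).indicator (h ∘ f) = (s.indicator h) ∘ f := by
        ext z; by_cases hz : f z ∈ s <;> simp [hz]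
      rw [e]
      exact integral_comp_eq hf (hh.indicator (hG s hs)).aestronglyMeasurable
    rw [key _ integrable_condExp, key _ hg, setIntegral_condExp hG hg hs]
  · exact (stronglyMeasurable_condExp.comp_measurable
      (comap_measurable f)).aestronglyMeasurable

lemma cprob_comap [IsFiniteMeasure μ] {f : X → X} (hf : MeasurePreserving f μ μ)
    (hG : G ≤ m0) {A : Set X} (hA : MeasurableSet A) :
    cprob μ (G.comap f) (f ⁻¹' A) =ᵐ[μ] cprob μ G A ∘ f :=
  condExp_comp_comap hf hG (integrable_ind hA)

lemma condEnt_comap [IsFiniteMeasure μ] {f : X → X} (hf : MeasurePreserving f μ μ)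
    (hG : G ≤ m0) {A : Set X} (hA : MeasurableSet A) :
    condEnt μ (G.comap f) (f ⁻¹' A) = condEnt μ G A := by
  have h1 : condEnt μ (G.comap f) (f ⁻¹' A) = ∫ z, Real.binEntropy (cprob μ G A (f z)) ∂μ := by
    refine integral_congr_ae ?_
    filter_upwards [cprob_comap hf hG hA] with z hz
    rw [hz]; rfl
  rw [h1, condEnt, integral_comp_eq hf integrable_binEntropy_cprob.aestronglyMeasurable]

end Comap

open scoped Classical

variable {X : Type*} [m0 : MeasurableSpace X] {μ : Measure X} [IsProbabilityMeasure μ]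

lemma ent_empty : ent μ (∅ : Finset (MSet X)) = 0 := by
  simp [ent, cell]

lemma ent_mono {J K : Finset (MSet X)} (h : J ⊆ K) : ent μ J ≤ ent μ K := by
  have key : ∀ L : Finset (MSet X), ent μ J ≤ ent μ (L ∪ J) := by
    intro L
    induction L using Finset.induction_on with
    | empty => simp
    | insert A L hA ih =>
      rw [Finset.insert_union, ent_insert]
      have := condEnt_nonneg (μ := μ) (G := gen (L ∪ J)) (A := A.1)
      linarith
  simpa [Finset.union_eq_left.2 h] using key K

lemma ent_union_le (J K : Finset (MSet X)) :
    ent μ (K ∪ J) ≤ ent μ J + ∑ A ∈ K, condEnt μ (gen J) A.1 := by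
  induction K using Finset.induction_on with
  | empty => simp
  | insert A K hA ih =>
    rw [Finset.insert_union, ent_insert, Finset.sum_insert hA]
    have := condEnt_anti (μ := μ) (gen_mono (Finset.subset_union_right (s₁ := K) (s₂ := J)))
      (gen_le _) (A := A.1)
    linarith

lemma ent_union_sub_le {J J' : Finset (MSet X)} (h : J ⊆ J') (K : Finset (MSet X)) :
    ent μ (K ∪ J') - ent μ J' ≤ ent μ (K ∪ J) - ent μ J := by
  induction K using Finset.induction_on with
  | empty => simp
  | insert A K hA ih =>
    rw [Finset.insert_union, Finset.insert_union, ent_insert, ent_insert]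
    have := condEnt_anti (μ := μ) (gen_mono (Finset.union_subset_union (Finset.Subset.refl K) h))
      (gen_le _) (A := A.1)
    linarith

lemma ent_union_le_add (J K : Finset (MSet X)) : ent μ (K ∪ J) ≤ ent μ K + ent μ J := by
  have := ent_union_sub_le (μ := μ) (Finset.empty_subset J) K
  rw [ent_empty, Finset.union_empty] at this
  linarith

lemma ent_le_of_measurable {J K : Finset (MSet X)}
    (h : ∀ A ∈ K, MeasurableSet[gen J] A.1) : ent μ K ≤ ent μ J := by
  have h1 := ent_union_le (μ := μ) J K
  rw [Finset.sum_eq_zero, add_zero] at h1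
  · exact (ent_mono Finset.subset_union_left).trans h1
  · intro A hA
    exact condEnt_eq_zero (gen_le J) A.2
      (stronglyMeasurable_const.indicator (h A hA)).aestronglyMeasurable

lemma ent_nonneg (J : Finset (MSet X)) : 0 ≤ ent μ J := by
  rw [← ent_empty (μ := μ)]
  exact ent_mono (Finset.empty_subset J)

/-- The preimage of a measurable set under an iterate. -/
def pre (T : X ≃ᵐ X) (k : ℕ) (A : MSet X) : MSet X :=
  ⟨(⇑T)^[k] ⁻¹' A.1, (T.measurable.iterate k) A.2⟩

variable {T : X ≃ᵐ X}

lemma pre_pre (T : X ≃ᵐ X) (j k : ℕ) (A : MSet X) : pre T j (pre T k A) = pre T (j + k) A := by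
  ext z
  simp [pre, add_comm j k, Function.iterate_add_apply]

lemma gen_image_pre (T : X ≃ᵐ X) (k : ℕ) (J : Finset (MSet X)) :
    gen (J.image (pre T k)) = (gen J).comap (⇑T)^[k] := by
  unfold gen
  rw [MeasurableSpace.comap_generateFrom]
  congr 1
  rw [Finset.coe_image, image_image, image_image]
  rfl

lemma ent_image_pre (hT : MeasurePreserving T μ μ) (k : ℕ) (J : Finset (MSet X)) :
    ent μ (J.image (pre T k)) = ent μ J := by
  induction J using Finset.induction_on with
  | empty => simp
  | insert A J hA ih =>
    rw [Finset.image_insert, ent_insert, ent_insert, ih, gen_image_pre]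
    congr 1
    exact condEnt_comap (hT.iterate k) (gen_le J) A.2

/-- The union of the preimages of the members of `V` at times in `[i, j)`. -/
noncomputable def orb (T : X ≃ᵐ X) (V : Finset (MSet X)) (i j : ℕ) : Finset (MSet X) :=
  (Finset.Ico i j).biUnion fun k => V.image (pre T k)

lemma orb_mono {V : Finset (MSet X)} {i j i' j' : ℕ} (h : i' ≤ i) (h' : j ≤ j') :
    orb T V i j ⊆ orb T V i' j' :=
  Finset.biUnion_subset_biUnion_of_subset_left _ (Finset.Ico_subset_Ico h h')

lemma orb_union {V : Finset (MSet X)} {i j k : ℕ} (h : i ≤ j) (h' : j ≤ k) :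
    orb T V i j ∪ orb T V j k = orb T V i k := by
  unfold orb
  rw [← Finset.Ico_union_Ico_eq_Ico h h', Finset.union_biUnion]

lemma image_orb (V : Finset (MSet X)) (K i j : ℕ) :
    (orb T V i j).image (pre T K) = orb T V (K + i) (K + j) := by
  unfold orb
  rw [Finset.biUnion_image, ← Finset.image_add_left_Ico, Finset.image_biUnion]
  refine Finset.biUnion_congr rfl fun k _ => ?_
  rw [Finset.image_image]
  refine Finset.image_congr fun A _ => ?_
  exact pre_pre T K k A

lemma ent_orb (hT : MeasurePreserving T μ μ) (V : Finset (MSet X)) (K n : ℕ) :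
    ent μ (orb T V K (K + n)) = ent μ (orb T V 0 n) := by
  rw [← ent_image_pre hT K (orb T V 0 n), image_orb, add_zero]

lemma mem_orb {V : Finset (MSet X)} {i j k : ℕ} (h : i ≤ k) (h' : k < j) {A : MSet X}
    (hA : A ∈ V) : pre T k A ∈ orb T V i j :=
  Finset.mem_biUnion.2 ⟨k, Finset.mem_Ico.2 ⟨h, h'⟩, Finset.mem_image_of_mem _ hA⟩

/-- The sets generating a two-set partition of zero entropy. -/
def ZeroEnt (μ : Measure X) (T : X ≃ᵐ X) (A : MSet X) : Prop :=
  Tendsto (fun n : ℕ => ent μ (orb T {A} 0 n) / n) atTop (𝓝 0)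

lemma subadditive_ent (hT : MeasurePreserving T μ μ) (V : Finset (MSet X)) :
    Subadditive fun n => ent μ (orb T V 0 n) := by
  intro m n
  have := ent_union_le_add (μ := μ) (orb T V m (m + n)) (orb T V 0 m)
  rw [orb_union (Nat.zero_le m) (Nat.le_add_right m n), ent_orb hT] at this
  exact this

lemma bddBelow_ent (T : X ≃ᵐ X) (V : Finset (MSet X)) :
    BddBelow (range fun n : ℕ => ent μ (orb T V 0 n) / n) := by
  refine ⟨0, ?_⟩
  rintro _ ⟨n, rfl⟩
  exact div_nonneg (ent_nonneg _) (Nat.cast_nonneg n)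

lemma partitionEntropy_eq (A : MSet X) : partitionEntropy μ T A.1
    = Filter.atTop.liminf fun n : ℕ => ent μ (orb T {A} 0 n) / n := by
  unfold partitionEntropy
  congr 1
  ext n
  have h := sum_negMulLog_signs_eq_ent (μ := μ) (fun k => pre T k A) n
  have h2 : (Finset.range n).image (fun k => pre T k A) = orb T {A} 0 n := by
    unfold orb
    rw [← Finset.range_eq_Ico]
    ext B; simp [eq_comm]
  rw [h2] at h
  rw [← h, one_div, div_eq_inv_mul]
  congr 1
  refine Finset.sum_congr rfl fun s _ => ?_
  rw [Measure.real]
  congr 4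
  ext i
  by_cases hs : s i <;> simp [hs, pre]

lemma partitionEntropy_eq_zero_iff (hT : MeasurePreserving T μ μ) (A : MSet X) :
    partitionEntropy μ T A.1 = 0 ↔ ZeroEnt μ T A := by
  rw [partitionEntropy_eq]
  constructor
  · intro h
    have := (subadditive_ent hT {A}).tendsto_lim (bddBelow_ent T {A})
    rw [this.liminf_eq] at h
    rw [h] at this
    exact this
  · intro h
    exact Tendsto.liminf_eq h

end Orbits

section ZeroEntropy

open scoped Classical

variable {X : Type*} [m0 : MeasurableSpace X] {μ : Measure X} [IsProbabilityMeasure μ]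
  {T : X ≃ᵐ X}

lemma ZeroEnt.of_measurable {A B C : MSet X} (hA : ZeroEnt μ T A) (hB : ZeroEnt μ T B)
    (hC : MeasurableSet[gen {A, B}] C.1) : ZeroEnt μ T C := by
  have key : ∀ n, ent μ (orb T {C} 0 n) ≤ ent μ (orb T {A} 0 n) + ent μ (orb T {B} 0 n) := by
    intro n
    refine le_trans (ent_le_of_measurable ?_) (ent_union_le_add (orb T {B} 0 n) (orb T {A} 0 n))
    intro D hD
    obtain ⟨k, hk, hD⟩ := Finset.mem_biUnion.1 hD
    obtain rfl : D = pre T k C := by simpa using hD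
    have hk := Finset.mem_Ico.1 hk
    have h1 : MeasurableSet[(gen {A, B}).comap (⇑T)^[k]] (pre T k C).1 := ⟨C.1, hC, rfl⟩
    rw [← gen_image_pre] at h1
    refine gen_mono ?_ _ h1
    intro D hD
    obtain ⟨E, hE, rfl⟩ := Finset.mem_image.1 hD
    rcases Finset.mem_insert.1 hE with rfl | hE
    · exact Finset.mem_union_left _ (mem_orb hk.1 hk.2 (Finset.mem_singleton_self _))
    · exact Finset.mem_union_right _ (mem_orb hk.1 hk.2 hE)
  refine squeeze_zero (fun n => div_nonneg (ent_nonneg _) (Nat.cast_nonneg n)) (fun n => ?_)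
    (by simpa using Tendsto.add hA hB)
  rw [← add_div]
  exact div_le_div_of_nonneg_right (key n) (Nat.cast_nonneg n)

lemma zeroEnt_pre_iff (hT : MeasurePreserving T μ μ) (k : ℕ) (A : MSet X) :
    ZeroEnt μ T (pre T k A) ↔ ZeroEnt μ T A := by
  have : ∀ n, ent μ (orb T {pre T k A} 0 n) = ent μ (orb T {A} 0 n) := by
    intro n
    rw [← ent_image_pre hT k (orb T {A} 0 n)]
    congr 1
    unfold orb
    rw [Finset.biUnion_image]
    refine Finset.biUnion_congr rfl fun j _ => ?_
    simp [pre_pre, add_comm]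
  simp [ZeroEnt, this]

lemma pinsker_eq (hT : MeasurePreserving T μ μ) : pinsker μ T =
    MeasurableSpace.generateFrom ((fun A : MSet X => A.1) '' {A | ZeroEnt μ T A}) := by
  unfold pinsker
  congr 1
  ext A
  constructor
  · rintro ⟨hA, h⟩
    exact ⟨⟨A, hA⟩, (partitionEntropy_eq_zero_iff hT ⟨A, hA⟩).1 h, rfl⟩
  · rintro ⟨A, h, rfl⟩
    exact ⟨A.2, (partitionEntropy_eq_zero_iff hT A).2 h⟩

omit [IsProbabilityMeasure μ] in
lemma pinsker_le : pinsker μ T ≤ m0 :=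
  MeasurableSpace.generateFrom_le fun _ h => h.1

lemma ZeroEnt.measurableSet (hT : MeasurePreserving T μ μ) {A : MSet X} (h : ZeroEnt μ T A) :
    MeasurableSet[pinsker μ T] A.1 := by
  rw [pinsker_eq hT]
  exact MeasurableSpace.measurableSet_generateFrom ⟨A, h, rfl⟩

lemma comap_pinsker (hT : MeasurePreserving T μ μ) (k : ℕ) :
    (pinsker μ T).comap (⇑T)^[k] = pinsker μ T := by
  apply le_antisymm
  · conv_lhs => rw [pinsker_eq hT, MeasurableSpace.comap_generateFrom]
    refine MeasurableSpace.generateFrom_le ?_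
    rintro _ ⟨_, ⟨A, hA, rfl⟩, rfl⟩
    exact ((zeroEnt_pre_iff hT k A).2 hA).measurableSet hT
  · conv_lhs => rw [pinsker_eq hT]
    refine MeasurableSpace.generateFrom_le ?_
    rintro _ ⟨A, hA, rfl⟩
    have hinv : ∀ z, (⇑T.symm)^[k] ((⇑T)^[k] z) = z :=
      Function.LeftInverse.iterate T.symm_apply_apply k
    let B : MSet X := ⟨(⇑T.symm)^[k] ⁻¹' A.1, (T.symm.measurable.iterate k) A.2⟩
    have hB : pre T k B = A := by
      ext z
      simp [pre, B, hinv]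
    refine ⟨B.1, ((zeroEnt_pre_iff hT k B).1 (hB ▸ hA)).measurableSet hT, ?_⟩
    exact congrArg Subtype.val hB

lemma zeroEnt_univ : ZeroEnt μ T ⟨univ, MeasurableSet.univ⟩ := by
  have : ∀ n, ent μ (orb T {(⟨univ, MeasurableSet.univ⟩ : MSet X)} 0 n) = 0 := by
    intro n
    refine le_antisymm ?_ (ent_nonneg _)
    rw [← ent_empty (μ := μ)]
    refine ent_le_of_measurable ?_
    intro D hD
    obtain ⟨k, hk, hD⟩ := Finset.mem_biUnion.1 hD
    obtain rfl : D = pre T k ⟨univ, MeasurableSet.univ⟩ := by simpa using hD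
    exact MeasurableSet.univ
  simp [ZeroEnt, this]

lemma condEnt_sub_le {J J' W : Finset (MSet X)} (h : J ⊆ J') {U : MSet X} (hU : U ∈ W) :
    condEnt μ (gen J) U.1 - condEnt μ (gen J') U.1 ≤
      (ent μ (W ∪ J) - ent μ J) - (ent μ (W ∪ J') - ent μ J') := by
  have h1 : ∀ L : Finset (MSet X), W ∪ L = W ∪ insert U L := by
    intro L
    rw [Finset.union_insert, ← Finset.insert_union, Finset.insert_eq_of_mem hU]
  have h2 := ent_union_sub_le (μ := μ) (Finset.insert_subset_insert U h) W
  rw [← h1, ← h1, ent_insert, ent_insert] at h2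
  linarith

lemma condEnt_sub_le_diff (hT : MeasurePreserving T μ μ) {V : Finset (MSet X)} {U : MSet X}
    (hU : U ∈ V) (C : MSet X) {K : ℕ} (hK : 0 < K) (n : ℕ) :
    condEnt μ (gen (orb T V K (K + n))) U.1 -
      condEnt μ (gen (orb T V K (K + n) ∪ orb T {C} 0 (K + n))) U.1 ≤
    (ent μ (orb T V 0 (K + n)) - ent μ (orb T V 0 (K + n) ∪ orb T {C} 0 (K + n))
      + ent μ (orb T {C} 0 (K + n))) -
    (ent μ (orb T V 0 n) - ent μ (orb T V 0 n ∪ orb T {C} 0 n) + ent μ (orb T {C} 0 n)) := by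
  have hU' : U ∈ orb T V 0 K := by
    have := mem_orb (T := T) (le_refl 0) hK hU
    have e : pre T 0 U = U := by ext; simp [pre]
    rwa [e] at this
  have h1 := condEnt_sub_le (μ := μ) (J := orb T V K (K + n))
    (J' := orb T V K (K + n) ∪ orb T {C} 0 (K + n)) (Finset.subset_union_left) hU'
  rw [← Finset.union_assoc, orb_union (Nat.zero_le K) (Nat.le_add_right K n), ent_orb hT] at h1
  have h2 := ent_union_sub_le (μ := μ) (orb_mono (T := T) (V := {C}) (Nat.zero_le K)
    (le_refl (K + n))) (orb T V K (K + n))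
  have h3 : orb T V K (K + n) ∪ orb T {C} K (K + n)
      = (orb T V 0 n ∪ orb T {C} 0 n).image (pre T K) := by
    rw [Finset.image_union, image_orb, image_orb, add_zero]
  rw [h3, ent_image_pre hT, ent_orb hT] at h2
  linarith

/-- The σ-algebra generated by the preimages of the members of `V` at times `≥ K`. -/
noncomputable def tailAlg (T : X ≃ᵐ X) (V : Finset (MSet X)) (K : ℕ) : MeasurableSpace X :=
  ⨆ m, gen (orb T V K (K + m))

/-- The σ-algebra generated by the preimages of the members of `V` at times `≥ K` and of `C` at
all times. -/
noncomputable def jointAlg (T : X ≃ᵐ X) (V : Finset (MSet X)) (C : MSet X) (K : ℕ) :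
    MeasurableSpace X :=
  ⨆ m, gen (orb T V K (K + m) ∪ orb T {C} 0 (K + m))

lemma tailAlg_le (V : Finset (MSet X)) (K : ℕ) : tailAlg T V K ≤ m0 :=
  iSup_le fun _ => gen_le _

lemma monotone_gen_orb (V : Finset (MSet X)) (K : ℕ) :
    Monotone fun m => gen (orb T V K (K + m)) := fun _ _ h =>
  gen_mono (orb_mono le_rfl (by omega))

lemma cprob_sup_gen (hT : MeasurePreserving T μ μ) {V : Finset (MSet X)} {U : MSet X}
    (hU : U ∈ V) {C : MSet X} (hC : ZeroEnt μ T C) {K : ℕ} (hK : 0 < K) :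
    cprob μ (jointAlg T V C K) U.1
      =ᵐ[μ] cprob μ (tailAlg T V K) U.1 := by
  have hmono : Monotone fun m => gen (orb T V K (K + m) ∪ orb T {C} 0 (K + m)) := fun _ _ h =>
    gen_mono (Finset.union_subset_union (orb_mono le_rfl (by omega)) (orb_mono le_rfl (by omega)))
  refine cprob_ae_eq_of_condEnt_le
    (iSup_mono fun m => gen_mono Finset.subset_union_left) (iSup_le fun _ => gen_le _) ?_
  have t1 := tendsto_condEnt (μ := μ) (monotone_gen_orb (T := T) V K) (fun _ => gen_le _)
    (A := U.1)
  have t2 := tendsto_condEnt (μ := μ) hmono (fun _ => gen_le _) (A := U.1)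
  have t3 := t1.sub t2
  have tK : Tendsto (fun j : ℕ => j * K) atTop atTop :=
    tendsto_id.atTop_mul_const' hK
  have t4 := (t3.comp tK).cesaro
  have t5 : Tendsto (fun m : ℕ => (K : ℝ) * (ent μ (orb T {C} 0 (m * K)) / ((m * K : ℕ) : ℝ)))
      atTop (𝓝 (K * 0)) := (Tendsto.comp hC tK).const_mul _
  rw [mul_zero] at t5
  have := le_of_tendsto_of_tendsto' t4 t5 ?_
  · linarith
  intro m
  set E : ℕ → ℝ := fun n => ent μ (orb T V 0 n) - ent μ (orb T V 0 n ∪ orb T {C} 0 n)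
    + ent μ (orb T {C} 0 n) with hE
  have hsum : ∑ j ∈ Finset.range m, ((fun n => condEnt μ (gen (orb T V K (K + n))) U.1 -
      condEnt μ (gen (orb T V K (K + n) ∪ orb T {C} 0 (K + n))) U.1) ∘ fun j => j * K) j
      ≤ ent μ (orb T {C} 0 (m * K)) := by
    calc _ ≤ ∑ j ∈ Finset.range m, (E ((j + 1) * K) - E (j * K)) := by
          refine Finset.sum_le_sum fun j _ => ?_
          have := condEnt_sub_le_diff hT hU C hK (j * K)
          have e : (j + 1) * K = K + j * K := by ring
          simp only [Function.comp, hE, e]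
          exact this
      _ = E (m * K) - E (0 * K) := Finset.sum_range_sub (fun j => E (j * K)) m
      _ ≤ ent μ (orb T {C} 0 (m * K)) := by
          have h1 := ent_mono (μ := μ) (Finset.subset_union_left (s₁ := orb T V 0 (m * K))
            (s₂ := orb T {C} 0 (m * K)))
          have h2 := ent_union_le_add (μ := μ) (orb T {C} 0 (0 * K)) (orb T V 0 (0 * K))
          simp only [hE]
          linarith
  rcases Nat.eq_zero_or_pos m with rfl | hm
  · simp
  have hm' : (0 : ℝ) < m := by exact_mod_cast hm
  have hK' : (0 : ℝ) < K := by exact_mod_cast hK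
  calc _ ≤ (m : ℝ)⁻¹ * ent μ (orb T {C} 0 (m * K)) :=
        mul_le_mul_of_nonneg_left hsum (by positivity)
    _ = _ := by push_cast; field_simp

lemma cprob_sup_pinsker (hT : MeasurePreserving T μ μ) {V : Finset (MSet X)} {U : MSet X}
    (hU : U ∈ V) {K : ℕ} (hK : 0 < K) :
    cprob μ (tailAlg T V K ⊔ pinsker μ T) U.1 =ᵐ[μ] cprob μ (tailAlg T V K) U.1 := by
  have hle : tailAlg T V K ⊔ pinsker μ T ≤ m0 := sup_le (tailAlg_le V K) pinsker_le
  have hmeas : AEStronglyMeasurable[tailAlg T V K ⊔ pinsker μ T]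
      (cprob μ (tailAlg T V K) U.1) μ :=
    (stronglyMeasurable_cprob.mono
      (le_sup_left (a := tailAlg T V K) (b := pinsker μ T))).aestronglyMeasurable
  symm
  refine ae_eq_condExp_of_forall_setIntegral_eq hle (integrable_ind U.2)
    (fun _ _ _ => integrable_cprob.integrableOn) ?_
    hmeas
  let S : Set (Set X) := {t | ∃ s, MeasurableSet[tailAlg T V K] s ∧ ∃ C : MSet X, ZeroEnt μ T C ∧
    t = s ∩ C.1}
  have hS : tailAlg T V K ⊔ pinsker μ T = MeasurableSpace.generateFrom S := by
    apply le_antisymm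
    · refine sup_le ?_ ?_
      · intro s hs
        exact MeasurableSpace.measurableSet_generateFrom ⟨s, hs, _, zeroEnt_univ, by simp⟩
      · rw [pinsker_eq hT]
        refine MeasurableSpace.generateFrom_mono ?_
        rintro _ ⟨A, hA, rfl⟩
        exact ⟨univ, MeasurableSet.univ, A, hA, by simp⟩
    · refine MeasurableSpace.generateFrom_le ?_
      rintro _ ⟨s, hs, C, hC, rfl⟩
      exact MeasurableSet.inter (le_sup_left (a := tailAlg T V K) (b := pinsker μ T) s hs)
        (le_sup_right (a := tailAlg T V K) (b := pinsker μ T) _ (hC.measurableSet hT))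
  have hpi : IsPiSystem S := by
    rintro _ ⟨s, hs, C, hC, rfl⟩ _ ⟨s', hs', C', hC', rfl⟩ -
    refine ⟨s ∩ s', hs.inter hs', ⟨C.1 ∩ C'.1, C.2.inter C'.2⟩, ?_, inter_inter_inter_comm _ _ _ _⟩
    refine ZeroEnt.of_measurable hC hC' ?_
    exact MeasurableSet.inter (measurableSet_gen (J := {C, C'}) (by simp))
      (measurableSet_gen (J := {C, C'}) (by simp))
  have base : ∀ t ∈ S, ∫ x in t, cprob μ (tailAlg T V K) U.1 x ∂μ
      = ∫ x in t, U.1.indicator (fun _ => (1 : ℝ)) x ∂μ := by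
    rintro _ ⟨s, hs, C, hC, rfl⟩
    have hG'le : jointAlg T V C K ≤ m0 := iSup_le fun _ => gen_le _
    have hFG : tailAlg T V K ≤ jointAlg T V C K :=
      iSup_mono fun m => gen_mono Finset.subset_union_left
    have hCm : MeasurableSet[jointAlg T V C K] C.1 := by
      have h0 : C ∈ orb T V K (K + 0) ∪ orb T {C} 0 (K + 0) := by
        refine Finset.mem_union_right _ ?_
        have := mem_orb (T := T) (le_refl 0) (show 0 < K + 0 from hK) (Finset.mem_singleton_self C)
        have e : pre T 0 C = C := by ext; simp [pre]
        rwa [e] at this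
      exact le_iSup (fun m => gen (orb T V K (K + m) ∪ orb T {C} 0 (K + m))) 0 _
        (measurableSet_gen h0)
    have hm : MeasurableSet[jointAlg T V C K] (s ∩ C.1) := MeasurableSet.inter (hFG s hs) hCm
    rw [← setIntegral_condExp hG'le (integrable_ind U.2) hm]
    refine setIntegral_congr_ae (hG'le _ hm) ?_
    filter_upwards [cprob_sup_gen hT hU hC hK] with z hz _
    exact hz.symm
  have huniv : ∫ x, cprob μ (tailAlg T V K) U.1 x ∂μ
      = ∫ x, U.1.indicator (fun _ => (1 : ℝ)) x ∂μ := integral_condExp (tailAlg_le V K)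
  intro t ht _
  refine MeasurableSpace.induction_on_inter
    (C := fun t _ => ∫ x in t, cprob μ (tailAlg T V K) U.1 x ∂μ
      = ∫ x in t, U.1.indicator (fun _ => (1 : ℝ)) x ∂μ) hS hpi (by simp) base ?_ ?_ t ht
  · intro t ht ih
    have h1 := integral_add_compl (hle t ht)
      (integrable_cprob (μ := μ) (G := tailAlg T V K) (A := U.1))
    have h2 := integral_add_compl (hle t ht) (integrable_ind (μ := μ) U.2)
    linarith
  · intro f hd hf ih
    rw [integral_iUnion (fun i => hle _ (hf i)) hd integrable_cprob.integrableOn,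
      integral_iUnion (fun i => hle _ (hf i)) hd (integrable_ind U.2).integrableOn]
    exact tsum_congr ih

end ZeroEntropy

section TailZeroEntropy

open scoped Classical

variable {X : Type*} [m0 : MeasurableSpace X] {μ : Measure X} {T : X ≃ᵐ X}

lemma comap_tailAlg (V : Finset (MSet X)) (K k : ℕ) :
    (tailAlg T V K).comap (⇑T)^[k] = tailAlg T V (k + K) := by
  unfold tailAlg
  rw [MeasurableSpace.comap_iSup]
  refine iSup_congr fun m => ?_
  rw [← gen_image_pre, image_orb, add_assoc]

lemma tailAlg_anti (V : Finset (MSet X)) {K L : ℕ} (h : K ≤ L) :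
    tailAlg T V L ≤ tailAlg T V K := by
  refine iSup_le fun m => ?_
  refine le_trans (gen_mono ?_) (le_iSup (fun m => gen (orb T V K (K + m))) (L - K + m))
  exact orb_mono h (by omega)

variable [IsProbabilityMeasure μ]

lemma ent_orb_singleton_union_le (A : MSet X) (J : Finset (MSet X)) (n : ℕ) :
    ent μ (orb T {A} 0 n ∪ J) ≤
      ent μ J + ∑ k ∈ Finset.range n, condEnt μ (gen J) (pre T k A).1 := by
  induction n with
  | zero => simp [orb]
  | succ n ih =>
    have e : orb T {A} 0 (n + 1) = insert (pre T n A) (orb T {A} 0 n) := by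
      rw [← orb_union (Nat.zero_le n) (Nat.le_succ n), Finset.insert_eq, Finset.union_comm]
      congr 1
      simp [orb]
    rw [e, Finset.insert_union, ent_insert, Finset.sum_range_succ]
    have := condEnt_anti (μ := μ) (gen_mono (Finset.subset_union_right (s₁ := orb T {A} 0 n)
      (s₂ := J))) (gen_le _) (A := (pre T n A).1)
    linarith

lemma ent_le_of_tail (hT : MeasurePreserving T μ μ) (V : Finset (MSet X)) (A : MSet X)
    (n N : ℕ) :
    ent μ (orb T {A} 0 n) + (ent μ (orb T V 0 (N + n)) - ent μ (orb T V 0 N)) ≤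
      ent μ (orb T V 0 n) +
      ∑ j ∈ Finset.range n, condEnt μ (gen (orb T V 0 (j + 1))) A.1 +
      ∑ k ∈ Finset.range n, condEnt μ (gen (orb T V n (n + N))) (pre T k A).1 := by
  set P := orb T V 0 n
  set Q := orb T V n (n + N) with hQ
  set R := orb T {A} 0 n
  have h1 : ent μ (R ∪ P) ≤ ent μ P + ∑ j ∈ Finset.range n,
      condEnt μ (gen (orb T V 0 (j + 1))) A.1 := by
    refine (ent_orb_singleton_union_le A P n).trans ?_
    rw [← Finset.sum_range_reflect (fun j => condEnt μ (gen (orb T V 0 (j + 1))) A.1)]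
    gcongr with k hk
    have hk := Finset.mem_range.1 hk
    have e := condEnt_comap (hT.iterate k) (gen_le (orb T V 0 (n - 1 - k + 1))) A.2
    rw [← e, ← gen_image_pre, image_orb]
    exact condEnt_anti (gen_mono (orb_mono (Nat.zero_le _) (by omega))) (gen_le _)
  have h2 : ent μ (P ∪ Q) = ent μ (orb T V 0 (N + n)) := by
    rw [orb_union (Nat.zero_le n) (Nat.le_add_right n N), add_comm]
  have h3 := ent_orb_singleton_union_le (μ := μ) (T := T) A Q n
  have h4 : ent μ Q = ent μ (orb T V 0 N) := ent_orb hT V n N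
  have h5 := ent_union_sub_le (μ := μ) (Finset.subset_union_left (s₁ := R) (s₂ := Q)) P
  have h6 : ent μ (P ∪ Q) ≤ ent μ (P ∪ (R ∪ Q)) :=
    ent_mono (Finset.union_subset_union (Finset.Subset.refl P) Finset.subset_union_right)
  rw [Finset.union_comm P R] at h5
  linarith

lemma zeroEnt_of_tail (hT : MeasurePreserving T μ μ) (V : Finset (MSet X)) (A : MSet X)
    (h : ∀ K, AEStronglyMeasurable[tailAlg T V K] (A.1.indicator (fun _ => (1 : ℝ))) μ) :
    ZeroEnt μ T A := by
  set a : ℕ → ℝ := fun n => ent μ (orb T V 0 n) with ha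
  set inc : ℕ → ℝ := fun n => a (n + 1) - a n with hinc
  have hinc_eq : ∀ n, inc n = ent μ (orb T V 0 1 ∪ orb T V 1 (1 + n)) -
      ent μ (orb T V 1 (1 + n)) := by
    intro n
    rw [ent_orb hT, orb_union (Nat.zero_le 1) (Nat.le_add_right 1 n), add_comm 1 n]
  have hanti : Antitone inc := by
    intro n m hnm
    rw [hinc_eq, hinc_eq]
    exact ent_union_sub_le (orb_mono le_rfl (by omega)) _
  have hbdd : BddBelow (range inc) := by
    refine ⟨0, ?_⟩
    rintro _ ⟨n, rfl⟩
    exact sub_nonneg.2 (ent_mono (orb_mono le_rfl (Nat.le_succ n)))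
  obtain ⟨e, he⟩ : ∃ e, Tendsto inc atTop (𝓝 e) := ⟨_, tendsto_atTop_ciInf hanti hbdd⟩
  have hsum : ∀ n, ∑ i ∈ Finset.range n, inc i = a n := by
    intro n
    rw [hinc, Finset.sum_range_sub]
    simp [ha, orb, ent_empty]
  have hρ : Tendsto (fun j => condEnt μ (gen (orb T V 0 (j + 1))) A.1) atTop (𝓝 0) := by
    have t := tendsto_condEnt (μ := μ) (monotone_gen_orb (T := T) V 0) (fun _ => gen_le _)
      (A := A.1)
    have z : condEnt μ (⨆ m, gen (orb T V 0 (0 + m))) A.1 = 0 :=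
      condEnt_eq_zero (tailAlg_le V 0) A.2 (h 0)
    rw [z] at t
    simpa using (tendsto_add_atTop_iff_nat 1).2 t
  have hmain : ∀ n : ℕ, ent μ (orb T {A} 0 n) ≤
      a n - n * e + ∑ j ∈ Finset.range n, condEnt μ (gen (orb T V 0 (j + 1))) A.1 := by
    intro n
    have t1 : Tendsto (fun N => a (N + n) - a N) atTop (𝓝 (n * e)) := by
      have e1 : ∀ N, a (N + n) - a N = ∑ i ∈ Finset.range n, inc (N + i) := by
        intro N
        have := Finset.sum_range_sub (fun i => a (N + i)) n
        simpa [hinc, add_assoc] using this.symm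
      simp_rw [e1]
      have := tendsto_finsetSum (Finset.range n) (f := fun i N => inc (N + i)) (a := fun _ => e)
        (x := atTop) (fun i _ => (tendsto_add_atTop_iff_nat i).2 he)
      simpa using this
    have t2 : Tendsto (fun N => ∑ k ∈ Finset.range n,
        condEnt μ (gen (orb T V n (n + N))) (pre T k A).1) atTop (𝓝 0) := by
      rw [← Finset.sum_const_zero (s := Finset.range n)]
      refine tendsto_finsetSum _ fun k _ => ?_
      have t := tendsto_condEnt (μ := μ) (monotone_gen_orb (T := T) V n) (fun _ => gen_le _)
        (A := (pre T k A).1)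
      have z : condEnt μ (tailAlg T V n) (pre T k A).1 = 0 := by
        refine le_antisymm ?_ condEnt_nonneg
        have z1 := condEnt_comap (hT.iterate k) (tailAlg_le (T := T) V n) A.2
        rw [condEnt_eq_zero (tailAlg_le V n) A.2 (h n), comap_tailAlg] at z1
        rw [← z1]
        exact condEnt_anti (tailAlg_anti V (Nat.le_add_left n k)) (tailAlg_le V n)
      rw [← z]
      exact t
    have t3 := (tendsto_const_nhds (x := ent μ (orb T {A} 0 n))).add t1
    have t4 := (tendsto_const_nhds (x := ent μ (orb T V 0 n) +
      ∑ j ∈ Finset.range n, condEnt μ (gen (orb T V 0 (j + 1))) A.1)).add t2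
    have := le_of_tendsto_of_tendsto' t3 t4 fun N => ent_le_of_tail hT V A n N
    simp only [ha]
    linarith
  have t5 := (he.cesaro.sub (tendsto_const_nhds (x := e))).add hρ.cesaro
  rw [sub_self, zero_add] at t5
  refine squeeze_zero' (Eventually.of_forall fun n =>
    div_nonneg (ent_nonneg _) (Nat.cast_nonneg n)) ?_ t5
  filter_upwards [eventually_gt_atTop 0] with n hn
  have hn' : (0 : ℝ) < n := by exact_mod_cast hn
  rw [hsum, div_le_iff₀ hn']
  refine (hmain n).trans (le_of_eq ?_)
  field_simp

end TailZeroEntropy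

section TailLimit

open scoped Classical

variable {X : Type*} [m0 : MeasurableSpace X] {μ : Measure X} [IsProbabilityMeasure μ]
  {T : X ≃ᵐ X}

lemma sq_integral_abs_le {f : X → ℝ} (hf : Integrable f μ)
    (hf2 : Integrable (fun z => f z ^ 2) μ) : (∫ z, |f z| ∂μ) ^ 2 ≤ ∫ z, f z ^ 2 ∂μ := by
  set m := ∫ z, |f z| ∂μ with hm
  have h : 0 ≤ ∫ z, (|f z| - m) ^ 2 ∂μ := integral_nonneg fun z => sq_nonneg _
  have e : ∀ z, (|f z| - m) ^ 2 = f z ^ 2 - 2 * m * |f z| + m ^ 2 := by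
    intro z; rw [sub_sq, sq_abs]; ring
  simp_rw [e] at h
  have hi : Integrable (fun z => f z ^ 2 - 2 * m * |f z|) μ := hf2.sub (hf.abs.const_mul _)
  rw [integral_add hi (integrable_const _),
    integral_sub hf2 (hf.abs.const_mul _), integral_const_mul, ← hm] at h
  simp at h
  nlinarith

lemma integrable_sq_cprob_sub {G G' : MeasurableSpace X} {A : Set X} :
    Integrable (fun z => (cprob μ G A z - cprob μ G' A z) ^ 2) μ := by
  refine Integrable.of_bound (C := 1) ?_ ?_
  · exact ((integrable_cprob (m0 := m0)).sub
      (integrable_cprob (m0 := m0))).aestronglyMeasurable.pow 2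
  · filter_upwards [cprob_mem (m0 := m0) (μ := μ) (G := G) (A := A),
      cprob_mem (m0 := m0) (μ := μ) (G := G') (A := A)] with z h1 h2
    rw [Real.norm_of_nonneg (sq_nonneg _), sq_le_one_iff_abs_le_one, abs_le]
    constructor <;> linarith [h1.1, h1.2, h2.1, h2.2]

/-- The `L¹` limit of the conditional probabilities given the decreasing σ-algebras. -/
lemma exists_limit_cprob_tail (V : Finset (MSet X)) (U : MSet X) :
    ∃ g : X → ℝ, StronglyMeasurable g ∧ Integrable g μ ∧
      (∀ K, AEStronglyMeasurable[tailAlg T V K] g μ) ∧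
      Tendsto (fun K => ∫ z, |cprob μ (tailAlg T V K) U.1 z - g z| ∂μ) atTop (𝓝 0) := by
  set h : ℕ → ℝ := fun K => condEnt μ (tailAlg T V K) U.1 with hh
  have hmono : Monotone h := fun K L hKL => condEnt_anti (tailAlg_anti V hKL) (tailAlg_le V K)
  have hbdd : BddAbove (range h) := by
    refine ⟨Real.log 2, ?_⟩
    rintro _ ⟨K, rfl⟩
    refine (integral_mono integrable_binEntropy_cprob (integrable_const (Real.log 2))
      fun z => Real.binEntropy_le_log_two).trans ?_
    simp
  have hcau : CauchySeq h := (tendsto_atTop_ciSup hmono hbdd).cauchySeq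
  have hip : ∀ K, Integrable (cprob μ (tailAlg T V K) U.1) μ := fun K => integrable_cprob
  set p : ℕ → X →₁[μ] ℝ := fun K => (hip K).toL1 _ with hp
  have hdist : ∀ K L, K ≤ L → dist (p K) (p L) ≤ √(dist (h K) (h L)) := by
    intro K L hKL
    have h1 := condEnt_add_le (μ := μ) (tailAlg_anti (T := T) V hKL) (tailAlg_le V K) (A := U.1)
    have h2 := sq_integral_abs_le ((hip K).sub (hip L)) integrable_sq_cprob_sub
    rw [dist_eq_norm, hp, ← Integrable.toL1_sub, L1.norm_of_fun_eq_integral_norm]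
    refine Real.le_sqrt_of_sq_le ?_
    rw [Real.dist_eq, abs_sub_comm, abs_of_nonneg (sub_nonneg.2 (hmono hKL))]
    simp only [Real.norm_eq_abs]
    refine h2.trans ?_
    simp only [Pi.sub_apply, hh]
    linarith
  have hpc : CauchySeq p := by
    rw [Metric.cauchySeq_iff'] at hcau ⊢
    intro ε hε
    obtain ⟨N, hN⟩ := hcau (ε ^ 2) (by positivity)
    refine ⟨N, fun n hn => ?_⟩
    rw [dist_comm]
    refine (hdist N n hn).trans_lt ?_
    rw [Real.sqrt_lt' hε, dist_comm]
    exact hN n hn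
  obtain ⟨g, hg⟩ := cauchySeq_tendsto_of_complete hpc
  have hgi : Integrable g μ := L1.integrable_coeFn g
  refine ⟨g, Lp.stronglyMeasurable g, hgi, ?_, ?_⟩
  · intro K
    have hcl := isClosed_aestronglyMeasurable (F := ℝ) (p := 1) (μ := μ) (tailAlg_le (T := T) V K)
    refine hcl.mem_of_tendsto hg ?_
    filter_upwards [eventually_ge_atTop K] with L hL
    have h1 : AEStronglyMeasurable[tailAlg T V K] (cprob μ (tailAlg T V L) U.1) μ :=
      (stronglyMeasurable_cprob.mono (tailAlg_anti V hL)).aestronglyMeasurable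
    exact h1.congr (Integrable.coeFn_toL1 (hip L)).symm
  · have := tendsto_iff_dist_tendsto_zero.1 hg
    refine this.congr fun K => ?_
    rw [dist_eq_norm, L1.norm_eq_integral_norm]
    refine integral_congr_ae ?_
    filter_upwards [Lp.coeFn_sub (p K) g, Integrable.coeFn_toL1 (hip K)] with z h1 h2
    rw [h1, Pi.sub_apply, Real.norm_eq_abs, hp, h2]

lemma tendsto_cprob_tail (hT : MeasurePreserving T μ μ) {V : Finset (MSet X)} {U : MSet X}
    (hU : U ∈ V) :
    Tendsto (fun K => ∫ z, |cprob μ (tailAlg T V K ⊔ pinsker μ T) U.1 z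
      - cprob μ (pinsker μ T) U.1 z| ∂μ) atTop (𝓝 0) := by
  obtain ⟨g, hgm, hgi, hgt, hglim⟩ := exists_limit_cprob_tail (μ := μ) (T := T) V U
  have hgP : StronglyMeasurable[pinsker μ T] g := by
    refine Measurable.stronglyMeasurable ?_
    refine measurable_of_Ioi fun c => ?_
    let A : MSet X := ⟨g ⁻¹' Ioi c, hgm.measurable measurableSet_Ioi⟩
    refine (zeroEnt_of_tail hT V A fun K => ?_).measurableSet hT (A := A)
    obtain ⟨g', hg', hgg'⟩ := hgt K
    refine ⟨(g' ⁻¹' Ioi c).indicator (fun _ => (1 : ℝ)),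
      stronglyMeasurable_const.indicator (hg'.measurable measurableSet_Ioi), ?_⟩
    filter_upwards [hgg'] with z hz
    simp only [indicator, A, mem_preimage, hz]
  have hgU : g =ᵐ[μ] cprob μ (pinsker μ T) U.1 := by
    refine ae_eq_condExp_of_forall_setIntegral_eq pinsker_le (integrable_ind U.2)
      (fun _ _ _ => hgi.integrableOn) ?_ hgP.aestronglyMeasurable
    intro t ht _
    have ht' : MeasurableSet t := pinsker_le _ ht
    have h1 : Tendsto (fun K => ∫ z in t, cprob μ (tailAlg T V K) U.1 z ∂μ) atTop
        (𝓝 (∫ z in t, g z ∂μ)) := by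
      rw [tendsto_iff_dist_tendsto_zero]
      refine squeeze_zero (fun _ => dist_nonneg) (fun K => ?_) hglim
      rw [Real.dist_eq, ← integral_sub integrable_cprob.integrableOn hgi.integrableOn]
      refine abs_integral_le_integral_abs.trans ?_
      exact setIntegral_le_integral ((integrable_cprob.sub hgi).abs)
        (ae_of_all _ fun z => abs_nonneg _)
    refine tendsto_nhds_unique h1 ?_
    refine tendsto_const_nhds.congr' ?_
    filter_upwards [eventually_gt_atTop 0] with K hK
    have ht2 : MeasurableSet[tailAlg T V K ⊔ pinsker μ T] t :=
      le_sup_right (a := tailAlg T V K) (b := pinsker μ T) t ht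
    rw [← setIntegral_condExp (sup_le (tailAlg_le V K) pinsker_le) (integrable_ind U.2) ht2]
    refine setIntegral_congr_ae ht' ?_
    filter_upwards [cprob_sup_pinsker hT hU hK] with z hz _
    exact hz
  refine hglim.congr' ?_
  filter_upwards [eventually_gt_atTop 0] with K hK
  refine integral_congr_ae ?_
  filter_upwards [cprob_sup_pinsker hT hU hK, hgU] with z h1 h2
  rw [h1, h2]

end TailLimit

section Independence

section General

variable {X : Type*} {G G' : MeasurableSpace X} {m0 : MeasurableSpace X} {μ : Measure X}
  [IsProbabilityMeasure μ]

lemma integral_abs_cprob_inter_sub_le (h : G ≤ G') (h' : G' ≤ m0) {A R : Set X}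
    (hA : MeasurableSet A) (hR : MeasurableSet[G'] R) :
    ∫ z, |cprob μ G (A ∩ R) z - cprob μ G A z * cprob μ G R z| ∂μ ≤
      ∫ z, |cprob μ G' A z - cprob μ G A z| ∂μ := by
  have hR0 : MeasurableSet R := h' _ hR
  have iq : Integrable (cprob μ G' A) μ := integrable_cprob
  have ip : Integrable (cprob μ G A) μ := integrable_cprob
  have e1 : (A ∩ R).indicator (fun _ => (1 : ℝ)) = R.indicator (A.indicator fun _ => (1 : ℝ)) := by
    rw [indicator_indicator, inter_comm]
  have h1 : cprob μ G (A ∩ R) =ᵐ[μ] μ[R.indicator (cprob μ G' A) | G] := by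
    have a1 : μ[R.indicator (A.indicator fun _ => (1 : ℝ)) | G'] =ᵐ[μ]
        R.indicator (cprob μ G' A) := condExp_indicator (integrable_ind hA) hR
    have a2 := condExp_congr_ae (m := G) a1
    rw [cprob, e1]
    exact (condExp_condExp_of_le h h').symm.trans a2
  have h2 : μ[R.indicator (cprob μ G A) | G] =ᵐ[μ] cprob μ G A * cprob μ G R := by
    have e2 : R.indicator (cprob μ G A) = cprob μ G A * R.indicator (fun _ => (1 : ℝ)) := by
      ext z; by_cases hz : z ∈ R <;> simp [hz]
    rw [e2]
    refine condExp_mul_of_stronglyMeasurable_left stronglyMeasurable_cprob ?_ (integrable_ind hR0)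
    rw [← e2]; exact ip.indicator hR0
  have h3 := condExp_sub (iq.indicator hR0) (ip.indicator hR0) G
  have h4 : (fun z => |cprob μ G (A ∩ R) z - cprob μ G A z * cprob μ G R z|) =ᵐ[μ]
      fun z => |(μ[R.indicator (cprob μ G' A) - R.indicator (cprob μ G A) | G]) z| := by
    filter_upwards [h1, h2, h3] with z z1 z2 z3
    rw [z3, Pi.sub_apply, z1, z2, Pi.mul_apply]
  rw [integral_congr_ae h4]
  refine (integral_abs_condExp_le _).trans ?_
  refine integral_mono_of_nonneg (ae_of_all _ fun z => abs_nonneg _) (iq.sub ip).abs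
    (ae_of_all _ fun z => ?_)
  by_cases hz : z ∈ R <;> simp [hz]

end General

open scoped Classical

variable {X : Type*} [m0 : MeasurableSpace X] {μ : Measure X} [IsProbabilityMeasure μ]
  {T : X ≃ᵐ X}

lemma cprob_pinsker_pre (hT : MeasurePreserving T μ μ) (k : ℕ) (A : MSet X) :
    cprob μ (pinsker μ T) (pre T k A).1 =ᵐ[μ] cprob μ (pinsker μ T) A.1 ∘ (⇑T)^[k] := by
  have := cprob_comap (hT.iterate k) (pinsker_le (μ := μ) (T := T)) A.2
  rwa [comap_pinsker hT] at this

lemma integrable_prod_cprob {ι : Type*} [Fintype ι] (hT : MeasurePreserving T μ μ)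
    (W : ι → MSet X) (n : ι → ℕ) :
    Integrable (fun z => ∏ i, cprob μ (pinsker μ T) (W i).1 ((⇑T)^[n i] z)) μ := by
  refine Integrable.of_bound (C := 1) ?_ ?_
  · refine Finset.aestronglyMeasurable_fun_prod _ fun i _ => ?_
    exact aestronglyMeasurable_cprob.comp_measurePreserving (hT.iterate (n i))
  · have : ∀ᵐ z ∂μ, ∀ i, cprob μ (pinsker μ T) (W i).1 ((⇑T)^[n i] z) ∈ Icc (0 : ℝ) 1 :=
      ae_all_iff.2 fun i => (hT.iterate (n i)).quasiMeasurePreserving.ae cprob_mem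
    filter_upwards [this] with z hz
    rw [Real.norm_of_nonneg (Finset.prod_nonneg fun i _ => (hz i).1)]
    exact Finset.prod_le_one (fun i _ => (hz i).1) fun i _ => (hz i).2

lemma integral_abs_cprob_iInter_sub_le (hT : MeasurePreserving T μ μ) (V : Finset (MSet X))
    (K l : ℕ) (W : Fin (l + 1) → MSet X) (hW : ∀ i, W i ∈ V) (n : Fin (l + 1) → ℕ)
    (hn : ∀ i j, i < j → n i + K ≤ n j) :
    ∫ z, |cprob μ (pinsker μ T) (⋂ i, (pre T (n i) (W i)).1) z
      - ∏ i, cprob μ (pinsker μ T) (W i).1 ((⇑T)^[n i] z)| ∂μ ≤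
    ∑ i, ∫ z, |cprob μ (tailAlg T V K ⊔ pinsker μ T) (W i).1 z
      - cprob μ (pinsker μ T) (W i).1 z| ∂μ := by
  induction l with
  | zero =>
    have e : (fun z => |cprob μ (pinsker μ T) (⋂ i, (pre T (n i) (W i)).1) z
        - ∏ i, cprob μ (pinsker μ T) (W i).1 ((⇑T)^[n i] z)|) =ᵐ[μ] 0 := by
      have e2 : (⋂ i, (pre T (n i) (W i)).1) = (pre T (n 0) (W 0)).1 := by
        ext z; simp [Fin.forall_fin_one]
      rw [e2]
      filter_upwards [cprob_pinsker_pre hT (n 0) (W 0)] with z hz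
      simp [hz]
    rw [integral_congr_ae e]
    simp only [Pi.zero_apply, integral_zero]
    exact Finset.sum_nonneg fun i _ => integral_nonneg fun z => abs_nonneg _
  | succ l ih =>
    have ih := ih (fun i => W i.succ) (fun i => hW _) (fun i => n i.succ)
      (fun i j hij => hn _ _ (Fin.succ_lt_succ_iff.2 hij))
    set R : Set X := ⋂ i : Fin (l + 1), (pre T (n i.succ) (W i.succ)).1 with hRdef
    set A : MSet X := pre T (n 0) (W 0) with hA
    have hsplit : (⋂ i, (pre T (n i) (W i)).1) = A.1 ∩ R := by
      ext z; simp [Fin.forall_fin_succ, hA, hRdef]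
    have hRm : MeasurableSet[tailAlg T V (n 0 + K)] R := by
      refine MeasurableSet.iInter fun i => ?_
      have hi : n 0 + K ≤ n i.succ := hn 0 i.succ (Fin.succ_pos i)
      exact le_iSup (fun m => gen (orb T V (n 0 + K) (n 0 + K + m))) (n i.succ + 1) _
        (measurableSet_gen (mem_orb hi (by omega) (hW _)))
    have hcomap : (tailAlg T V K ⊔ (pinsker μ T)).comap (⇑T)^[n 0] =
        tailAlg T V (n 0 + K) ⊔ (pinsker μ T) := by
      rw [MeasurableSpace.comap_sup, comap_tailAlg, comap_pinsker hT]
    have s1 := integral_abs_cprob_inter_sub_le (μ := μ)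
      (le_sup_right (a := tailAlg T V (n 0 + K)) (b := (pinsker μ T)))
      (sup_le (tailAlg_le V _) pinsker_le) A.2
      (le_sup_left (a := tailAlg T V (n 0 + K)) (b := (pinsker μ T)) R hRm)
    have s2 : ∫ z, |cprob μ (tailAlg T V (n 0 + K) ⊔ (pinsker μ T)) A.1 z
          - cprob μ (pinsker μ T) A.1 z| ∂μ =
        ∫ z, |cprob μ (tailAlg T V K ⊔ (pinsker μ T)) (W 0).1 z
          - cprob μ (pinsker μ T) (W 0).1 z| ∂μ := by
      have hi : Integrable (fun z => |cprob μ (tailAlg T V K ⊔ (pinsker μ T)) (W 0).1 z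
          - cprob μ (pinsker μ T) (W 0).1 z|) μ :=
        ((integrable_cprob (m0 := m0)).sub (integrable_cprob (m0 := m0))).abs
      rw [← integral_comp_eq (hT.iterate (n 0)) hi.aestronglyMeasurable]
      refine integral_congr_ae ?_
      have c1 := cprob_comap (hT.iterate (n 0))
        (sup_le (tailAlg_le (T := T) V K) (pinsker_le (μ := μ) (T := T))) (W 0).2
      rw [hcomap] at c1
      filter_upwards [c1, cprob_pinsker_pre hT (n 0) (W 0)] with z z1 z2
      rw [show A.1 = (⇑T)^[n 0] ⁻¹' (W 0).1 from rfl, z1]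
      rw [show (⇑T)^[n 0] ⁻¹' (W 0).1 = (pre T (n 0) (W 0)).1 from rfl, z2]
      rfl
    have iR : Integrable (cprob μ (pinsker μ T) R) μ := integrable_cprob (m0 := m0)
    have iA : Integrable (cprob μ (pinsker μ T) (A.1 ∩ R)) μ := integrable_cprob (m0 := m0)
    have iprod := integrable_prod_cprob (μ := μ) hT (fun i : Fin (l + 1) => W i.succ)
      (fun i => n i.succ)
    have iAR : Integrable (fun z => cprob μ (pinsker μ T) A.1 z * cprob μ (pinsker μ T) R z) μ :=
      integrable_mul_of_mem (aestronglyMeasurable_cprob (m0 := m0)) (cprob_mem (m0 := m0)) iR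
    rw [Fin.sum_univ_succ, hsplit, ← s2]
    refine le_trans ?_ (add_le_add s1 ih)
    have i1 : Integrable (fun z => |cprob μ (pinsker μ T) (A.1 ∩ R) z -
        cprob μ (pinsker μ T) A.1 z * cprob μ (pinsker μ T) R z|) μ := (iA.sub iAR).abs
    have i2 : Integrable (fun z => |cprob μ (pinsker μ T) R z -
        ∏ i : Fin (l + 1), cprob μ (pinsker μ T) (W i.succ).1 ((⇑T)^[n i.succ] z)|) μ :=
      (iR.sub iprod).abs
    rw [← integral_add i1 i2]
    refine integral_mono_of_nonneg (ae_of_all _ fun z => abs_nonneg _)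
      (i1.add i2) ?_
    filter_upwards [cprob_pinsker_pre hT (n 0) (W 0),
      cprob_mem (m0 := m0) (μ := μ) (G := (pinsker μ T))
      (A := A.1)] with z z1 z2
    rw [Fin.prod_univ_succ]
    rw [Function.comp_apply] at z1
    rw [← z1]
    set x := cprob μ (pinsker μ T) (A.1 ∩ R) z
    set y := cprob μ (pinsker μ T) R z
    set w := ∏ i : Fin (l + 1), cprob μ (pinsker μ T) (W i.succ).1 ((⇑T)^[n i.succ] z)
    change |x - cprob μ (pinsker μ T) A.1 z * w| ≤ |x - cprob μ (pinsker μ T) A.1 z * y| + |y - w|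
    have t1 : x - cprob μ (pinsker μ T) A.1 z * w =
        (x - cprob μ (pinsker μ T) A.1 z * y) + cprob μ (pinsker μ T) A.1 z * (y - w) := by
      ring
    rw [t1]
    refine (abs_add_le _ _).trans ?_
    rw [abs_mul, abs_of_nonneg z2.1]
    have := mul_le_of_le_one_left (abs_nonneg (y - w)) z2.2
    linarith

end Independence

section Recurrence

open scoped Classical

lemma GoodLiminfRecurrence.liminf_pos {ℓ : ℕ} {a : Fin ℓ → ℕ → ℕ}
    (hgood : GoodLiminfRecurrence a) {X : Type*} [MeasurableSpace X] [StandardBorelSpace X]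
    {μ : Measure X} [IsProbabilityMeasure μ] {T : X ≃ᵐ X} (hT : MeasurePreserving T μ μ)
    {A : Set X} (hA : MeasurableSet A) (hpos : 0 < μ A) :
    0 < Filter.atTop.liminf (fun N : ℕ =>
      (1 / N : ℝ) * ∑ n ∈ Finset.Icc 1 N,
        (μ (A ∩ ⋂ i : Fin ℓ, (⇑T)^[a i n] ⁻¹' A)).toReal) := by
  obtain ⟨f, hf⟩ := exists_measurableEmbedding_real X
  let e : X ≃ᵐ range f := hf.equivRange
  have hstd : StandardBorelSpace (range f) := hf.measurableSet_range.standardBorel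
  let S : range f ≃ᵐ range f := e.symm.trans (T.trans e)
  let ν : Measure (range f) := μ.map e
  have hν : IsProbabilityMeasure ν := Measure.isProbabilityMeasure_map e.measurable.aemeasurable
  have he : MeasurePreserving e μ ν := ⟨e.measurable, rfl⟩
  have hS : MeasurePreserving S ν ν := by
    have := he.comp (hT.comp (he.symm e))
    exact this
  have hit : ∀ k z, S^[k] (e z) = e (T^[k] z) := by
    intro k z
    have hsc : Function.Semiconj e T S := fun z => by simp [S]
    exact ((hsc.iterate_right k) z).symm
  have hA' : MeasurableSet (e.symm ⁻¹' A) := e.symm.measurable hA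
  have hset : ∀ n, ν (e.symm ⁻¹' A ∩ ⋂ i : Fin ℓ, S^[a i n] ⁻¹' (e.symm ⁻¹' A)) =
      μ (A ∩ ⋂ i : Fin ℓ, (⇑T)^[a i n] ⁻¹' A) := by
    intro n
    rw [e.map_apply]
    congr 1
    ext z
    simp [hit]
  have hposν : 0 < ν (e.symm ⁻¹' A) := by
    rw [e.map_apply]
    simpa [← preimage_comp] using hpos
  have := hgood (range f) ν S hS _ hA' hposν
  simp_rw [hset] at this
  exact this

lemma CondStar.tendsto_card_lt {a : ℕ → ℕ} (h : CondStar a) (K : ℕ) :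
    Tendsto (fun N : ℕ => (((Finset.Icc 1 N).filter (fun n => a n < K)).card : ℝ) / N)
      atTop (𝓝 0) := by
  have h1 := (h (K + 1) (Nat.succ_pos K)).sqrt
  rw [Real.sqrt_zero] at h1
  refine squeeze_zero (fun N => by positivity) (fun N => ?_) h1
  refine Real.le_sqrt_of_sq_le ?_
  rw [div_pow]
  refine div_le_div_of_nonneg_right ?_ (by positivity)
  have hsub : ((Finset.Icc 1 N).filter (fun n => a n < K)) ×ˢ
      ((Finset.Icc 1 N).filter (fun n => a n < K)) ⊆
      ((Finset.Icc 1 N) ×ˢ (Finset.Icc 1 N)).filter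
        (fun p => |(a p.1 : ℤ) - (a p.2 : ℤ)| ≤ ((K + 1 : ℕ) : ℤ)) := by
    rintro ⟨m, n⟩ hp
    simp only [Finset.mem_product, Finset.mem_filter] at hp ⊢
    refine ⟨⟨hp.1.1, hp.2.1⟩, ?_⟩
    rw [abs_le]
    push_cast
    omega
  have hc := Finset.card_le_card hsub
  rw [Finset.card_product] at hc
  rw [sq]
  exact_mod_cast hc

lemma CondStarStar.tendsto_card {ℓ : ℕ} {a : Fin ℓ → ℕ → ℕ} (h : CondStarStar a) (hℓ : 1 ≤ ℓ)
    (K : ℕ) :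
    Tendsto (fun N : ℕ => (((Finset.Icc 1 N).filter (fun n =>
      ¬ ((∀ i, K ≤ a i n) ∧ ∀ i j, i < j → a i n + K ≤ a j n))).card : ℝ) / N)
      atTop (𝓝 0) := by
  have hgap : ∀ᶠ n in atTop, ∀ i j : Fin ℓ, i < j → a i n + K ≤ a j n := by
    have h1 : ∀ᶠ n in atTop, ∀ i : Fin ℓ, ∀ hi : i.1 + 1 < ℓ, a i n + K ≤ a ⟨i + 1, hi⟩ n := by
      rw [eventually_all]
      intro i
      by_cases hi : i.1 + 1 < ℓ
      · filter_upwards [(h.2 i hi).eventually_ge_atTop (K : ℤ)] with n hn _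
        have : a i n = a ⟨i, Nat.lt_of_succ_lt hi⟩ n := rfl
        omega
      · exact Eventually.of_forall fun n hi' => absurd hi' hi
    filter_upwards [h1] with n hn
    have key : ∀ m (hm : m < ℓ) (i : Fin ℓ), i.1 < m → a i n + K ≤ a ⟨m, hm⟩ n := by
      intro m
      induction m with
      | zero => intro _ i hi; omega
      | succ m ih =>
        intro hm i hi
        have h2 := hn ⟨m, by omega⟩ hm
        simp only at h2
        rcases Nat.lt_succ_iff_lt_or_eq.1 hi with h3 | h3
        · have := ih (by omega) i h3
          omega
        · have : i = ⟨m, by omega⟩ := Fin.ext h3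
          rw [this]; exact h2
    exact fun i j hij => key j.1 j.2 i hij
  obtain ⟨n0, hn0⟩ := eventually_atTop.1 hgap
  have t1 := (h.1 ⟨0, hℓ⟩).tendsto_card_lt K
  have t2 : Tendsto (fun N : ℕ => (n0 : ℝ) / N) atTop (𝓝 0) :=
    tendsto_const_div_atTop_nhds_zero_nat _
  have t3 := t1.add t2
  rw [add_zero] at t3
  refine squeeze_zero (fun N => by positivity) (fun N => ?_) t3
  rw [← add_div]
  refine div_le_div_of_nonneg_right ?_ (by positivity)
  have hsub : (Finset.Icc 1 N).filter (fun n =>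
      ¬ ((∀ i, K ≤ a i n) ∧ ∀ i j, i < j → a i n + K ≤ a j n)) ⊆
      (Finset.Icc 1 N).filter (fun n => a ⟨0, hℓ⟩ n < K) ∪ Finset.range n0 := by
    intro n hn
    rw [Finset.mem_filter] at hn
    by_contra hcon
    simp only [Finset.mem_union, Finset.mem_filter, Finset.mem_range, not_or, not_and, not_lt]
      at hcon
    have g := hn0 n hcon.2
    refine hn.2 ⟨fun i => ?_, g⟩
    have h0 := hcon.1 hn.1
    rcases Nat.eq_zero_or_pos i.1 with hi | hi
    · have : i = ⟨0, hℓ⟩ := Fin.ext hi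
      rw [this]; exact h0
    · have := g ⟨0, hℓ⟩ i hi
      omega
  have := (Finset.card_le_card hsub).trans (Finset.card_union_le _ _)
  rw [Finset.card_range] at this
  exact_mod_cast this

/-- A bounded sequence with positive lower average is bounded below at some point outside any
set of density zero. -/
lemma exists_le_of_liminf_average_pos {f : ℕ → ℝ} (hf0 : ∀ n, 0 ≤ f n) (hf1 : ∀ n, f n ≤ 1)
    (hf : 0 < Filter.atTop.liminf (fun N : ℕ => (1 / N : ℝ) * ∑ n ∈ Finset.Icc 1 N, f n)) :
    ∃ δ > 0, ∀ p : ℕ → Prop,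
      Tendsto (fun N : ℕ => (((Finset.Icc 1 N).filter (fun n => ¬ p n)).card : ℝ) / N)
        atTop (𝓝 0) → ∃ n, 1 ≤ n ∧ p n ∧ δ ≤ f n := by
  obtain ⟨d, hd0, hd⟩ := exists_between hf
  refine ⟨d / 2, by positivity, fun p hp => ?_⟩
  have hev := eventually_lt_of_lt_liminf hd
    ⟨0, by
      rw [eventually_map]
      exact Eventually.of_forall fun N =>
        mul_nonneg (by positivity) (Finset.sum_nonneg fun n _ => hf0 n)⟩
  have hev2 := hp.eventually_lt_const (show (0 : ℝ) < d / 2 by positivity)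
  obtain ⟨N, h1, h2, hN⟩ := (hev.and (hev2.and (eventually_gt_atTop 0))).exists
  by_contra! hcon
  have hN' : (0 : ℝ) < N := by exact_mod_cast hN
  have hsum : ∑ n ∈ Finset.Icc 1 N, f n ≤
      ((Finset.Icc 1 N).filter (fun n => ¬ p n)).card + N * (d / 2) := by
    calc _ ≤ ∑ n ∈ Finset.Icc 1 N, ((if ¬ p n then (1 : ℝ) else 0) + d / 2) := by
          refine Finset.sum_le_sum fun n hn => ?_
          by_cases h : p n
          · have := hcon n (Finset.mem_Icc.1 hn).1 h
            simp [h, this.le]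
          · have := hf1 n
            simp only [h, not_false_eq_true, if_true]
            linarith
      _ = _ := by
          rw [Finset.sum_add_distrib, Finset.sum_boole]
          simp
  rw [div_lt_iff₀ hN'] at h2
  rw [one_div, inv_mul_eq_div, lt_div_iff₀ hN'] at h1
  linarith

end Recurrence

section Spread

open scoped Classical

lemma exists_uniform_lower_bound {X : Type*} [MeasurableSpace X] {μ : Measure X}
    {ι : Type*} [Finite ι] {p : ι → X → ℝ} (h : 0 < μ {z | ∀ i, 0 < p i z}) :
    ∃ c > 0, 0 < μ {z | ∀ i, c < p i z} := by
  have hU : {z | ∀ i, 0 < p i z} ⊆ ⋃ k : ℕ, {z | ∀ i, 1 / ((k : ℝ) + 1) < p i z} := by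
    intro z hz
    have hz' : ∀ i, 0 < p i z := hz
    have : ∀ᶠ k : ℕ in atTop, ∀ i, 1 / ((k : ℝ) + 1) < p i z :=
      eventually_all.2 fun i =>
        (tendsto_one_div_add_atTop_nhds_zero_nat (𝕜 := ℝ)).eventually_lt_const (hz' i)
    obtain ⟨k, hk⟩ := this.exists
    exact mem_iUnion.2 ⟨k, hk⟩
  obtain ⟨k, hk⟩ := exists_measure_pos_of_not_measure_iUnion_null
    (h.trans_le (measure_mono hU)).ne'
  exact ⟨1 / ((k : ℝ) + 1), by positivity, hk⟩

variable {X : Type*} [m0 : MeasurableSpace X] {μ : Measure X} [IsProbabilityMeasure μ]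
  {T : X ≃ᵐ X}

/-- If the times `n i` are well separated, then on any set of measure at least `δ` whose points
have all conditional probabilities of the members `U i` at those times bounded below, some point
sees all the intersections `⋂ i, T^{-n i} U (s i)` with conditional probability bounded below. -/
lemma exists_gap_spread (hT : MeasurePreserving T μ μ) {ι : Type*} [Fintype ι] (U : ι → MSet X)
    (l : ℕ) {q δ : ℝ} (hq : 0 < q) (hδ : 0 < δ) :
    ∃ K : ℕ, ∀ n : Fin (l + 1) → ℕ, (∀ i j, i < j → n i + K ≤ n j) →
      ∀ B : Set X, δ ≤ μ.real B →
      (∀ᵐ z ∂μ, z ∈ B → ∀ s : Fin (l + 1) → ι,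
        q ≤ ∏ i, cprob μ (pinsker μ T) (U (s i)).1 ((⇑T)^[n i] z)) →
      ¬ ∀ᵐ z ∂μ, ¬ ∀ s : Fin (l + 1) → ι,
        q / 2 < cprob μ (pinsker μ T) (⋂ i, (pre T (n i) (U (s i))).1) z := by
  set V : Finset (MSet X) := Finset.univ.image U with hV
  have hUV : ∀ i, U i ∈ V := fun i => Finset.mem_image_of_mem _ (Finset.mem_univ i)
  set c : ℝ := ((Fintype.card (Fin (l + 1) → ι) : ℕ) : ℝ) with hc
  have hc0 : 0 ≤ c := Nat.cast_nonneg _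
  set ε : ℝ := δ * (q / 2) / (2 * ((c + 1) * (l + 1))) with hε
  have hε0 : 0 < ε := by positivity
  have hεc : c * ((l + 1) * ε) < δ * (q / 2) := by
    have : (c + 1) * ((l + 1) * ε) = δ * (q / 2) / 2 := by rw [hε]; field_simp
    have h1 : 0 < δ * (q / 2) := by positivity
    have h2 : 0 < (l + 1) * ε := by positivity
    nlinarith
  have hK : ∀ᶠ K in atTop, ∀ i, ∫ z, |cprob μ (tailAlg T V K ⊔ pinsker μ T) (U i).1 z
      - cprob μ (pinsker μ T) (U i).1 z| ∂μ < ε :=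
    eventually_all.2 fun i => (tendsto_cprob_tail hT (hUV i)).eventually_lt_const hε0
  obtain ⟨K, hK⟩ := hK.exists
  refine ⟨K, fun n hn B hB hprod hnot => ?_⟩
  set err : (Fin (l + 1) → ι) → X → ℝ := fun s z =>
    |cprob μ (pinsker μ T) (⋂ i, (pre T (n i) (U (s i))).1) z
      - ∏ i, cprob μ (pinsker μ T) (U (s i)).1 ((⇑T)^[n i] z)| with herr
  have herr0 : ∀ s z, 0 ≤ err s z := fun s z => abs_nonneg _
  have herri : ∀ s, Integrable (err s) μ := fun s =>
    ((integrable_cprob (m0 := m0)).sub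
      (integrable_prod_cprob hT (fun i => U (s i)) n)).abs
  have hsum : ∫ z, ∑ s, err s z ∂μ ≤ c * ((l + 1) * ε) := by
    rw [integral_finsetSum _ fun s _ => herri s]
    calc _ ≤ ∑ s : Fin (l + 1) → ι, (l + 1) * ε := by
          refine Finset.sum_le_sum fun s _ => ?_
          refine (integral_abs_cprob_iInter_sub_le hT V K l (fun i => U (s i))
            (fun i => hUV _) n hn).trans ?_
          refine (Finset.sum_le_sum fun i _ => (hK (s i)).le).trans ?_
          simp
      _ = _ := by simp [hc]
  have hmarkov := mul_meas_ge_le_integral_of_nonneg (μ := μ) (f := fun z => ∑ s, err s z)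
    (ae_of_all _ fun z => Finset.sum_nonneg fun s _ => herr0 s z)
    (integrable_finsetSum _ fun s _ => herri s) (q / 2)
  have hsub : μ.real B ≤ μ.real {z | q / 2 ≤ ∑ s, err s z} := by
    refine ENNReal.toReal_mono (measure_ne_top _ _) (measure_mono_ae ?_)
    filter_upwards [hprod, hnot] with z h1 h2 hz
    push Not at h2
    obtain ⟨s, hs⟩ := h2
    have h3 := h1 hz s
    have h4 : err s z ≤ ∑ s, err s z :=
      Finset.single_le_sum (fun s _ => herr0 s z) (Finset.mem_univ s)
    have h5 := neg_le_abs (cprob μ (pinsker μ T) (⋂ i, (pre T (n i) (U (s i))).1) z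
      - ∏ i, cprob μ (pinsker μ T) (U (s i)).1 ((⇑T)^[n i] z))
    change q / 2 ≤ ∑ s, err s z
    simp only [herr] at h4 ⊢
    linarith
  have h6 := mul_le_mul_of_nonneg_right (hB.trans hsub) (show 0 ≤ q / 2 by positivity)
  linarith

end Spread

/-- Key lemma: if `Λ` is good for liminf-ℓ-recurrence and satisfies Condition (**), and
`U_1,…,U_M` are nonempty measurable sets with `μ{z : μ_z(U_i) > 0 for all i} > 0`, then
there exist `L ∈ ℕ` and `c > 0` with `μ{z : μ_z(U_s^L) > c for all s ∈ {1,…,M}^{ℓ+1}} > 0`,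
where `U_s^L = U_{s(1)} ∩ T^{-a_1(L)}U_{s(2)} ∩ ⋯ ∩ T^{-a_ℓ(L)}U_{s(ℓ+1)}`. -/
theorem key_lemma_spread
    {ℓ : ℕ} (hℓ : 1 ≤ ℓ) (a : Fin ℓ → ℕ → ℕ) (hpos : ∀ i n, 0 < a i n)
    (hΛ : CondStarStar a) (hgood : GoodLiminfRecurrence a)
    {X : Type*} [MeasurableSpace X] [StandardBorelSpace X]
    (μ : Measure X) [IsProbabilityMeasure μ]
    (T : X ≃ᵐ X) (hT : MeasurePreserving T μ μ)
    (μd : X → Measure X) (hmeas : Measurable μd)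
    (hprob : ∀ z, IsProbabilityMeasure (μd z))
    (hdis : ∀ f : X → ℝ, Integrable f μ →
      (μ[f | pinsker μ ⇑T]) =ᵐ[μ] fun z => ∫ y, f y ∂(μd z))
    (M : ℕ) (hM : 1 ≤ M) (U : Fin M → Set X)
    (hUne : ∀ i, (U i).Nonempty) (hUmeas : ∀ i, MeasurableSet (U i))
    (hpos' : 0 < μ {z : X | ∀ i, 0 < μd z (U i)}) :
    ∃ L : ℕ, 1 ≤ L ∧ ∃ c : ℝ≥0∞, 0 < c ∧
      0 < μ {z : X | ∀ s : Fin (ℓ + 1) → Fin M,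
        c < μd z (U (s 0) ∩ ⋂ i : Fin ℓ, (⇑T)^[a i L] ⁻¹' U (s i.succ))} := by
  set p : Fin M → X → ℝ := fun i z => (μd z).real (U i) with hp
  have hpos2 : 0 < μ {z : X | ∀ i, 0 < p i z} := by
    refine hpos'.trans_le (measure_mono fun z hz i => ?_)
    exact ENNReal.toReal_pos (hz i).ne' (measure_ne_top _ _)
  obtain ⟨c, hc, hA0⟩ := exists_uniform_lower_bound hpos2
  set A : Set X := {z | ∀ i, c < p i z} with hA
  have hpm : ∀ i, Measurable (p i) := fun i =>
    ((Measure.measurable_coe (hUmeas i)).comp hmeas).ennreal_toReal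
  have hAm : MeasurableSet A := by
    have : A = ⋂ i, p i ⁻¹' Ioi c := by ext z; simp [hA]
    rw [this]
    exact MeasurableSet.iInter fun i => hpm i measurableSet_Ioi
  have hcp : ∀ B : Set X, MeasurableSet B →
      cprob μ (pinsker μ T) B =ᵐ[μ] fun z => (μd z).real B := by
    intro B hB
    filter_upwards [hdis _ (integrable_ind hB)] with z hz
    rw [cprob, hz, integral_indicator_const _ hB]
    simp
  obtain ⟨δ, hδ, hrec⟩ := exists_le_of_liminf_average_pos (fun n => ENNReal.toReal_nonneg)
    (fun n => by
      have := measureReal_le_one (μ := μ) (s := A ∩ ⋂ i : Fin ℓ, (⇑T)^[a i n] ⁻¹' A)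
      exact this) (hgood.liminf_pos hT hAm hA0)
  obtain ⟨K, hK⟩ := exists_gap_spread hT (fun i => (⟨U i, hUmeas i⟩ : MSet X)) ℓ
    (q := c ^ (ℓ + 1)) (by positivity) hδ
  obtain ⟨L, hL, ⟨hL1, hL2⟩, hLδ⟩ := hrec
    (fun n => (∀ i, K ≤ a i n) ∧ ∀ i j, i < j → a i n + K ≤ a j n)
    (by convert hΛ.tendsto_card hℓ K)
  refine ⟨L, hL, ENNReal.ofReal (c ^ (ℓ + 1) / 2), by simp; positivity, ?_⟩
  set n : Fin (ℓ + 1) → ℕ := Fin.cons 0 (fun i => a i L) with hn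
  have hgap : ∀ i j, i < j → n i + K ≤ n j := by
    intro i j
    refine Fin.cases ?_ (fun j => ?_) j
    · intro h; exact absurd h (Fin.not_lt_zero i)
    · refine Fin.cases ?_ (fun i => ?_) i
      · intro _; simpa [hn] using hL1 j
      · intro h; simpa [hn] using hL2 i j (Fin.succ_lt_succ_iff.1 h)
  have hset : ∀ s : Fin (ℓ + 1) → Fin M,
      (⋂ i, (pre T (n i) (⟨U (s i), hUmeas (s i)⟩ : MSet X)).1)
        = U (s 0) ∩ ⋂ i : Fin ℓ, (⇑T)^[a i L] ⁻¹' U (s i.succ) := by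
    intro s; ext z; simp [Fin.forall_fin_succ, pre, hn]
  have hspread := hK n hgap (A ∩ ⋂ i : Fin ℓ, (⇑T)^[a i L] ⁻¹' A) hLδ ?_
  · rw [pos_iff_ne_zero]
    intro h0
    refine hspread ?_
    have hall : ∀ᵐ z ∂μ, ∀ s : Fin (ℓ + 1) → Fin M,
        cprob μ (pinsker μ T) (⋂ i, (pre T (n i) (⟨U (s i), hUmeas (s i)⟩ : MSet X)).1) z
          = (μd z).real (U (s 0) ∩ ⋂ i : Fin ℓ, (⇑T)^[a i L] ⁻¹' U (s i.succ)) := by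
      refine ae_all_iff.2 fun s => ?_
      rw [hset s]
      exact hcp _ ((hUmeas _).inter (MeasurableSet.iInter fun i =>
        (T.measurable.iterate _) (hUmeas _)))
    have h0' : ∀ᵐ z ∂μ, ¬ ∀ s : Fin (ℓ + 1) → Fin M, ENNReal.ofReal (c ^ (ℓ + 1) / 2) <
        μd z (U (s 0) ∩ ⋂ i : Fin ℓ, (⇑T)^[a i L] ⁻¹' U (s i.succ)) := by
      rw [ae_iff]; simpa using h0
    filter_upwards [hall, h0'] with z h1 h2 h3
    refine h2 fun s => ?_
    have := h3 s
    rw [h1 s] at this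
    rwa [ENNReal.ofReal_lt_iff_lt_toReal (by positivity) (measure_ne_top _ _)]
  · have hall : ∀ᵐ z ∂μ, ∀ (i : Fin (ℓ + 1)) (k : Fin M),
        cprob μ (pinsker μ T) (U k) ((⇑T)^[n i] z) = p k ((⇑T)^[n i] z) :=
      ae_all_iff.2 fun i => ae_all_iff.2 fun k =>
        (hT.iterate (n i)).quasiMeasurePreserving.ae (hcp _ (hUmeas k))
    filter_upwards [hall] with z h1 hz s
    have hmem : ∀ i, (⇑T)^[n i] z ∈ A := by
      intro i
      refine Fin.cases ?_ (fun i => ?_) i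
      · simpa [hn] using hz.1
      · simpa [hn] using mem_iInter.1 hz.2 i
    calc c ^ (ℓ + 1) = ∏ i : Fin (ℓ + 1), c := by simp
      _ ≤ _ := by
        refine Finset.prod_le_prod (fun _ _ => hc.le) fun i _ => ?_
        simp only [h1]
        exact (hmem i (s i)).le
end
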